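/- Let n ≡ 1 (mod 4), n ≥ 5. If the structure group of Sⁿ reduces to a closed connected subgroup G ⊆ SO(n), then dim G ≥ n − 2. -/

import Mathlib

/-- The special orthogonal group SO(n) as a set of matrices. -/
def SOSet (n : ℕ) : Set (Matrix (Fin n) (Fin n) ℝ) :=
  {A | A * A.transpose = 1 ∧ A.det = 1}

/-- The characteristic (clutching) map of the tangent bundle of Sⁿ: for x in the equator
S^{n-1} ⊆ ℝⁿ, the reflection through x^⊥ composed with a fixed reflection, an element
of SO(n). -/
noncomputable def charMatrix (n : ℕ) (x : EuclideanSpace ℝ (Fin n)) :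
    Matrix (Fin n) (Fin n) ℝ :=
  (1 - (2 : ℝ) • Matrix.vecMulVec (fun i => x i) (fun i => x i)) *
    Matrix.diagonal (fun i : Fin n => if i.val = 0 then (-1 : ℝ) else 1)

/-- The structure group of Sⁿ reduces to a subgroup G ⊆ GL(n,ℝ) (a set of matrices):
the characteristic map χₙ : S^{n-1} → SO(n) ⊆ GL(n,ℝ) is homotopic, through invertible
matrices, to a map with image in G. -/
def SphereStructureGroupReducesTo (n : ℕ) (G : Set (Matrix (Fin n) (Fin n) ℝ)) : Prop :=
  ∃ χ g : C(Metric.sphere (0 : EuclideanSpace ℝ (Fin n)) 1, Matrix (Fin n) (Fin n) ℝ),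
    (∀ x : Metric.sphere (0 : EuclideanSpace ℝ (Fin n)) 1, χ x = charMatrix n ↑x) ∧
    (∀ x, g x ∈ G) ∧
    ContinuousMap.HomotopicWith χ g fun h => ∀ x, IsUnit (h x)

namespace SphereReduction

open Filter Topology

section Determinant

variable {H : Type*} [NormedAddCommGroup H] [InnerProductSpace ℝ H]

/-- The determinant of the compression of `Y` to a finite-dimensional subspace `U`. -/
noncomputable def compressionDet (U : Submodule ℝ H) [FiniteDimensional ℝ U]
    (Y : H →L[ℝ] H) : ℝ :=
  (U.orthogonalProjectionOnto ∘L Y ∘L U.subtypeL).det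

theorem continuous_compressionDet (U : Submodule ℝ H) [FiniteDimensional ℝ U] :
    Continuous (compressionDet U) := by
  unfold compressionDet
  refine ContinuousLinearMap.continuous_det.comp ?_
  fun_prop

theorem compressionDet_ne_zero (U : Submodule ℝ H) [FiniteDimensional ℝ U] {Y : H →L[ℝ] H}
    (h : ∀ v ∈ U, U.starProjection (Y v) = 0 → v = 0) : compressionDet U Y ≠ 0 := by
  unfold compressionDet
  intro h0
  obtain ⟨v, hv, hv0⟩ := Submodule.exists_mem_ne_zero_of_ne_bot
    (LinearMap.bot_lt_ker_of_det_eq_zero h0).ne'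
  refine hv0 (Subtype.ext (h v v.2 ?_))
  have : U.orthogonalProjectionOnto (Y v) = 0 := by simpa using hv
  rw [Submodule.starProjection_apply, this]
  rfl

/-- Operators which are invertible, commute with `X`, and are compact perturbations of `1`. -/
def fredholmUnits (X : H →L[ℝ] H) : Set (H →L[ℝ] H) :=
  {Y | IsUnit Y ∧ Commute Y X ∧ IsCompactOperator (Y - 1 : H →L[ℝ] H)}

theorem tendsto_norm_comp_compact (A : ℕ → H →L[ℝ] H) (hA : ∀ N, ‖A N‖ ≤ 1)
    {T : H →L[ℝ] H} (hT : IsCompactOperator T)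
    (h : ∀ v, Tendsto (fun N => A N (T v)) atTop (𝓝 0)) {ε : ℝ} (hε : 0 < ε) :
    ∀ᶠ N in atTop, ∀ v, ‖A N (T v)‖ ≤ ε * ‖v‖ := by
  have hc := (hT.isCompact_closure_image_closedBall 1).totallyBounded.subset subset_closure
  obtain ⟨t, htS, htf, hcov⟩ := Metric.finite_approx_of_totallyBounded hc (ε / 2) (half_pos hε)
  have h1 : ∀ᶠ N in atTop, ∀ y ∈ t, ‖A N y‖ < ε / 2 := by
    refine (eventually_all_finite htf).2 fun y hy => ?_
    obtain ⟨v, -, rfl⟩ := htS hy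
    have := (h v).norm
    rw [norm_zero] at this
    exact this.eventually_lt_const (half_pos hε)
  filter_upwards [h1] with N hN
  have hone : ∀ v : H, ‖v‖ ≤ 1 → ‖A N (T v)‖ ≤ ε := fun v hv => by
    have hmem : T v ∈ T '' Metric.closedBall 0 1 := ⟨v, by simpa using hv, rfl⟩
    obtain ⟨y, hy, hyd⟩ := Set.mem_iUnion₂.1 (hcov hmem)
    rw [Metric.mem_ball, dist_eq_norm] at hyd
    have h2 : A N (T v) = A N (T v - y) + A N y := by simp
    rw [h2]
    have h3 : ‖A N (T v - y)‖ ≤ 1 * ‖T v - y‖ :=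
      ((A N).le_opNorm _).trans (by gcongr; exact hA N)
    exact (norm_add_le _ _).trans (by linarith [hN y hy])
  have := ContinuousLinearMap.opNorm_le_of_unit_norm (f := A N ∘L T) hε.le
    (fun v hv => hone v hv.le)
  exact fun v => (ContinuousLinearMap.le_opNorm (A N ∘L T) v).trans (by gcongr)

/-- The compressed determinants to an exhausting sequence of subspaces of the `+1` eigenspace. -/
theorem eventually_compressionDet_ne_zero [CompleteSpace H] {X : H →L[ℝ] H} (hX : X * X = 1)
    (U : ℕ → Submodule ℝ H) [∀ N, FiniteDimensional ℝ (U N)]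
    (hUX : ∀ N, ∀ v ∈ U N, X v = v)
    (hU : ∀ v, X v = v → Tendsto (fun N => (U N).starProjection v) atTop (𝓝 v))
    {Y : H →L[ℝ] H} (hY : Y ∈ fredholmUnits X) :
    ∀ᶠ p : ℕ × (H →L[ℝ] H) in atTop ×ˢ 𝓝 Y, compressionDet (U p.1) p.2 ≠ 0 := by
  obtain ⟨⟨u, rfl⟩, hcomm, hcomp⟩ := hY
  set C : ℝ := ‖(↑u⁻¹ : H →L[ℝ] H)‖ + 1 with hC
  have hC0 : 0 < C := by positivity
  have hCv : ∀ v, ‖v‖ ≤ C * ‖(↑u : H →L[ℝ] H) v‖ := fun v => by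
    have h1 : (↑u⁻¹ : H →L[ℝ] H) ((↑u : H →L[ℝ] H) v) = v := by
      rw [← mul_apply_eq_comp, Units.inv_mul, one_apply_eq_self]
    calc ‖v‖ = ‖(↑u⁻¹ : H →L[ℝ] H) ((↑u : H →L[ℝ] H) v)‖ := by rw [h1]
      _ ≤ ‖(↑u⁻¹ : H →L[ℝ] H)‖ * ‖(↑u : H →L[ℝ] H) v‖ := ContinuousLinearMap.le_opNorm _ _
      _ ≤ C * ‖(↑u : H →L[ℝ] H) v‖ := by gcongr; linarith
  set δ : ℝ := 1 / (4 * C) with hδ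
  have hδ0 : 0 < δ := by positivity
  set T : H →L[ℝ] H := ((1 / 2 : ℝ) • (1 + X)) * ((↑u : H →L[ℝ] H) - 1) with hT
  have hTc : IsCompactOperator T := by
    have := hcomp.clm_comp ((1 / 2 : ℝ) • (1 + X))
    rwa [← ContinuousLinearMap.coe_comp, ← ContinuousLinearMap.mul_def] at this
  have hXT : ∀ v, X (T v) = T v := fun v => by
    have : X * T = T := by
      rw [hT, ← mul_assoc, mul_smul_comm, mul_add, hX, mul_one, add_comm]
    rw [← mul_apply_eq_comp, this]
  have key := tendsto_norm_comp_compact (fun N => 1 - (U N).starProjection) (fun N => by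
      rw [← Submodule.starProjection_orthogonal']
      exact Submodule.starProjection_norm_le _) hTc (fun v => by
      simpa using (tendsto_const_nhds (x := T v)).sub (hU _ (hXT v))) hδ0
  have hball : ∀ᶠ Z : H →L[ℝ] H in 𝓝 (↑u : H →L[ℝ] H), ‖Z - (↑u : H →L[ℝ] H)‖ ≤ δ := by
    filter_upwards [Metric.closedBall_mem_nhds (↑u : H →L[ℝ] H) hδ0] with Z hZ
    simpa [dist_eq_norm] using hZ
  filter_upwards [key.prod_mk hball] with ⟨N, Z⟩ ⟨hN, hZ⟩
  refine compressionDet_ne_zero _ fun v hv hv0 => ?_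
  simp only at hN hZ hv hv0
  have hXv := hUX N v hv
  set Q := (U N).starProjection
  have hQv : Q v = v := Submodule.starProjection_eq_self_iff.2 hv
  have hTv : T v = (↑u : H →L[ℝ] H) v - v := by
    have h2 : X ((↑u : H →L[ℝ] H) v) = (↑u : H →L[ℝ] H) v := by
      rw [← mul_apply_eq_comp, ← hcomm.eq, mul_apply_eq_comp, hXv]
    simp only [hT, mul_apply_eq_comp, smul_apply,
      add_apply, sub_apply, one_apply_eq_self,
      map_sub, h2, hXv]
    module
  have h3 : ‖Q ((↑u : H →L[ℝ] H) v)‖ ≤ δ * ‖v‖ := by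
    have : Q ((↑u : H →L[ℝ] H) v) = - Q ((Z - ↑u) v) := by
      simp [hv0]
    rw [this, norm_neg]
    calc _ ≤ ‖(Z - ↑u) v‖ := Submodule.norm_starProjection_apply_le _ _
      _ ≤ ‖Z - ↑u‖ * ‖v‖ := ContinuousLinearMap.le_opNorm _ _
      _ ≤ _ := by gcongr
  have h4 : ‖(↑u : H →L[ℝ] H) v‖ ≤ δ * ‖v‖ + δ * ‖v‖ := by
    have : (↑u : H →L[ℝ] H) v = Q ((↑u : H →L[ℝ] H) v) + (1 - Q) (T v) := by
      simp [hTv, hQv]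
    rw [this]
    exact (norm_add_le _ _).trans (add_le_add h3 (hN v))
  have h5 : ‖v‖ ≤ 1 / 2 * ‖v‖ := by
    calc ‖v‖ ≤ C * ‖(↑u : H →L[ℝ] H) v‖ := hCv v
      _ ≤ C * (δ * ‖v‖ + δ * ‖v‖) := by gcongr
      _ = 1 / 2 * ‖v‖ := by rw [hδ]; field_simp; ring
  exact norm_le_zero_iff.1 (by linarith)

theorem eventually_compressionDet_mul_pos [CompleteSpace H] {X : H →L[ℝ] H} (hX : X * X = 1)
    (U : ℕ → Submodule ℝ H) [∀ N, FiniteDimensional ℝ (U N)]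
    (hUX : ∀ N, ∀ v ∈ U N, X v = v)
    (hU : ∀ v, X v = v → Tendsto (fun N => (U N).starProjection v) atTop (𝓝 v))
    {Y Z : H →L[ℝ] H} (hYZ : JoinedIn (fredholmUnits X) Y Z) :
    ∀ᶠ N in atTop, 0 < compressionDet (U N) Y * compressionDet (U N) Z := by
  obtain ⟨γ, hγ⟩ := hYZ
  have h1 : ∀ᶠ N in atTop, ∀ t : unitInterval, compressionDet (U N) (γ t) ≠ 0 := by
    have h2 : {p : ℕ × unitInterval | compressionDet (U p.1) (γ p.2) ≠ 0} ∈
        atTop ×ˢ nhdsSet Set.univ := isCompact_univ.mem_prod_nhdsSet_of_forall fun t _ => by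
      have hlim : Tendsto (fun p : ℕ × unitInterval => (p.1, γ p.2)) (atTop ×ˢ 𝓝 t)
          (atTop ×ˢ 𝓝 (γ t)) :=
        tendsto_fst.prodMk ((γ.continuous.tendsto t).comp tendsto_snd)
      exact hlim.eventually (eventually_compressionDet_ne_zero hX U hUX hU (hγ t))
    have h3 : ∀ᶠ p : ℕ × unitInterval in atTop ×ˢ nhdsSet Set.univ,
        compressionDet (U p.1) (γ p.2) ≠ 0 := h2
    rw [nhdsSet_univ] at h3
    exact h3.curry.mono fun N h => by simpa using h
  filter_upwards [h1] with N hN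
  have hcont : Continuous fun t => compressionDet (U N) (γ t) :=
    (continuous_compressionDet _).comp γ.continuous
  by_contra! hneg
  have hprod : compressionDet (U N) (γ 0) * compressionDet (U N) (γ 1) ≤ 0 := by simpa using hneg
  have : ∃ t, compressionDet (U N) (γ t) = 0 := by
    rcases le_total (compressionDet (U N) (γ 0)) 0 with h | h
    · refine mem_range_of_exists_le_of_exists_ge hcont ⟨0, h⟩ ⟨1, ?_⟩
      have := lt_of_le_of_ne h (hN 0)
      nlinarith
    · refine mem_range_of_exists_le_of_exists_ge hcont ⟨1, ?_⟩ ⟨0, h⟩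
      have := lt_of_le_of_ne h (hN 0).symm
      nlinarith
  obtain ⟨t, ht⟩ := this
  exact hN t ht

end Determinant

/-- A real endomorphism commuting with a complex structure has nonnegative determinant. -/
theorem det_nonneg_of_commute {V : Type*} [AddCommGroup V] [Module ℝ V] [FiniteDimensional ℝ V]
    (J T : Module.End ℝ V) (hJ : J * J = -1) (hc : T * J = J * T) : 0 ≤ LinearMap.det T := by
  let φ : ℂ →ₐ[ℝ] Module.End ℝ V := Complex.lift ⟨J, hJ⟩
  have hφ : ∀ z : ℂ, φ z = z.re • 1 + z.im • J := fun z => by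
    simp [φ, Complex.liftAux_apply, Algebra.algebraMap_eq_smul_one]
  let _ : Module ℂ V := Module.compHom V φ.toRingHom
  have hsm : ∀ (z : ℂ) (v : V), z • v = z.re • v + z.im • J v := fun z v => by
    change φ z v = _
    rw [hφ]
    simp
  have : IsScalarTower ℝ ℂ V := ⟨fun r z v => by simp [hsm, smul_add, mul_smul]⟩
  have : Module.Finite ℂ V := Module.Finite.of_restrictScalars_finite ℝ ℂ V
  let T' : V →ₗ[ℂ] V :=
    { toFun := T
      map_add' := map_add T
      map_smul' := fun z v => by
        have : T (J v) = J (T v) := LinearMap.congr_fun hc v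
        simp [hsm, this] }
  have : T'.restrictScalars ℝ = T := rfl
  rw [← this, LinearMap.det_restrictScalars, Algebra.norm_complex_apply]
  exact Complex.normSq_nonneg _

section Twist

variable {H : Type*} [NormedAddCommGroup H] [InnerProductSpace ℝ H]

theorem isCompactOperator_mul_left {T : H →L[ℝ] H} (A : H →L[ℝ] H) (hT : IsCompactOperator T) :
    IsCompactOperator (A * T : H →L[ℝ] H) := by
  have := hT.clm_comp A
  rwa [← ContinuousLinearMap.coe_comp, ← ContinuousLinearMap.mul_def] at this

theorem isCompactOperator_mul_right {T : H →L[ℝ] H} (hT : IsCompactOperator T) (A : H →L[ℝ] H) :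
    IsCompactOperator (T * A : H →L[ℝ] H) := by
  have := hT.comp_clm A
  rwa [← ContinuousLinearMap.coe_comp, ← ContinuousLinearMap.mul_def] at this

/-- The operators which commute with `X` and which commute with `F` up to compact operators. -/
def symbolAlgebra (X F : H →L[ℝ] H) (hF : F * F = 1) : Subalgebra ℝ (H →L[ℝ] H) where
  carrier := {B | Commute B X ∧ IsCompactOperator (F * B * F - B : H →L[ℝ] H)}
  mul_mem' := by
    rintro A B ⟨hA, hA'⟩ ⟨hB, hB'⟩
    refine ⟨hA.mul_left hB, ?_⟩
    have : F * (A * B) * F - A * B = (F * A * F - A) * (F * B * F) + A * (F * B * F - B) := by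
      calc F * (A * B) * F - A * B = F * A * (F * F) * B * F - A * B := by
            rw [hF]; noncomm_ring
        _ = _ := by noncomm_ring
    rw [this]
    exact (isCompactOperator_mul_right hA' _).add (isCompactOperator_mul_left _ hB')
  add_mem' := by
    rintro A B ⟨hA, hA'⟩ ⟨hB, hB'⟩
    refine ⟨hA.add_left hB, ?_⟩
    have : F * (A + B) * F - (A + B) = (F * A * F - A) + (F * B * F - B) := by noncomm_ring
    rw [this]
    exact hA'.add hB'
  algebraMap_mem' := by
    intro r
    refine ⟨Algebra.commutes r X, ?_⟩
    have : F * algebraMap ℝ (H →L[ℝ] H) r * F - algebraMap ℝ (H →L[ℝ] H) r = 0 := by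
      rw [← Algebra.commutes r F, mul_assoc, hF, mul_one, sub_self]
    rw [this]
    exact isCompactOperator_zero

theorem isClosed_symbolAlgebra [CompleteSpace H] (X F : H →L[ℝ] H) (hF : F * F = 1) :
    IsClosed (symbolAlgebra X F hF : Set (H →L[ℝ] H)) := by
  have h1 : IsClosed {B : H →L[ℝ] H | B * X = X * B} :=
    isClosed_eq (by fun_prop) (by fun_prop)
  have h2 : IsClosed {B : H →L[ℝ] H | IsCompactOperator (F * B * F - B : H →L[ℝ] H)} :=
    isClosed_setOfPred_isCompactOperator.preimage
      (f := fun B : H →L[ℝ] H => (F * B * F - B : H →L[ℝ] H)) (by fun_prop)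
  exact h1.inter h2

/-- The invertible elements of the symbol algebra. -/
def symbolUnits (X F : H →L[ℝ] H) (hF : F * F = 1) : Set (H →L[ℝ] H) :=
  {B | IsUnit B ∧ B ∈ symbolAlgebra X F hF}

variable {X F : H →L[ℝ] H} {hF : F * F = 1}

theorem mul_mem_symbolUnits {A B : H →L[ℝ] H} (hA : A ∈ symbolUnits X F hF)
    (hB : B ∈ symbolUnits X F hF) : A * B ∈ symbolUnits X F hF :=
  ⟨hA.1.mul hB.1, mul_mem hA.2 hB.2⟩

theorem joinedIn_mul {A A' B B' : H →L[ℝ] H} (hA : JoinedIn (symbolUnits X F hF) A A')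
    (hB : JoinedIn (symbolUnits X F hF) B B') :
    JoinedIn (symbolUnits X F hF) (A * B) (A' * B') := by
  obtain ⟨γ, hγ⟩ := hA
  obtain ⟨δ, hδ⟩ := hB
  exact ⟨γ.mul δ, fun t => mul_mem_symbolUnits (hγ t) (hδ t)⟩

/-- The operator `a⁻¹ F a F` attached to a symbol `a`. -/
noncomputable def twist (F a : H →L[ℝ] H) : H →L[ℝ] H := Ring.inverse a * F * a * F

theorem twist_mem (hXF : F * X = -(X * F)) {a : H →L[ℝ] H}
    (ha : a ∈ symbolUnits X F hF) : twist F a ∈ fredholmUnits X := by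
  obtain ⟨⟨u, rfl⟩, hc, hk⟩ := ha
  simp only [twist, Ring.inverse_unit]
  have hFu : IsUnit F := ⟨⟨F, F, hF, hF⟩, rfl⟩
  refine ⟨((u⁻¹.isUnit.mul hFu).mul u.isUnit).mul hFu, ?_, ?_⟩
  · have h1 : ↑u⁻¹ * X = X * ↑u⁻¹ := hc.units_inv_left
    have h2 : ↑u * X = X * ↑u := hc
    change ↑u⁻¹ * F * ↑u * F * X = X * (↑u⁻¹ * F * ↑u * F)
    calc ↑u⁻¹ * F * ↑u * F * X = ↑u⁻¹ * F * ↑u * (F * X) := by noncomm_ring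
      _ = -(↑u⁻¹ * F * (↑u * X) * F) := by rw [hXF]; noncomm_ring
      _ = -(↑u⁻¹ * (F * X) * ↑u * F) := by rw [h2]; noncomm_ring
      _ = ↑u⁻¹ * X * F * ↑u * F := by rw [hXF]; noncomm_ring
      _ = _ := by rw [h1]; noncomm_ring
  · have : (↑u⁻¹ * F * ↑u * F - 1 : H →L[ℝ] H) = ↑u⁻¹ * (F * ↑u * F - ↑u) := by
      rw [mul_sub, Units.inv_mul]; noncomm_ring
    rw [this]
    exact isCompactOperator_mul_left _ hk

theorem joinedIn_twist [CompleteSpace H] (hXF : F * X = -(X * F)) {a b : H →L[ℝ] H}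
    (h : JoinedIn (symbolUnits X F hF) a b) :
    JoinedIn (fredholmUnits X) (twist F a) (twist F b) := by
  obtain ⟨γ, hγ⟩ := h
  have hcont : Continuous fun t => twist F (γ t) := by
    have h1 : Continuous fun t => Ring.inverse (γ t) := by
      refine continuous_iff_continuousAt.2 fun t => ?_
      obtain ⟨u, hu⟩ := (hγ t).1
      have := NormedRing.inverse_continuousAt u
      rw [hu] at this
      exact this.comp γ.continuous.continuousAt
    unfold twist
    exact ((h1.mul continuous_const).mul γ.continuous).mul continuous_const
  exact ⟨⟨⟨_, hcont⟩, by simp, by simp⟩, fun t => twist_mem hXF (hγ t)⟩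

end Twist

section Base

variable {H : Type*} [NormedAddCommGroup H] [InnerProductSpace ℝ H] [CompleteSpace H]

theorem isUnit_one_sub_smul {D : H →L[ℝ] H} (hD : ‖D‖ < 1) {r : ℝ} (h0 : 0 ≤ r) (h1 : r ≤ 1) :
    IsUnit (1 - r • D) := by
  refine isUnit_one_sub_of_norm_lt_one ?_
  rw [norm_smul, Real.norm_of_nonneg h0]
  nlinarith [norm_nonneg D]

theorem joinedIn_one_sub_two_smul {X F R P Z : H →L[ℝ] H} (hX : X * X = 1)
    (hF : F * F = 1) (hXF : F * X = -(X * F)) (hR : R * R = 1) (hRX : R * X = X * R)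
    (hRc : IsCompactOperator (F * R * F - R : H →L[ℝ] H))
    (hZ : Z = (1 / 2 : ℝ) • (X * (R - F * R * F)))
    (hP : P * P = P) (hPc : IsCompactOperator P) (hPX : P * X = X * P)
    (hZP : Z * P = P) (hPZ : P * Z = P)
    (hTP : (R + F * R * F) * P = 0) (hPT : P * (R + F * R * F) = 0)
    (hnorm : ‖Z * Z - P‖ < 1) :
    JoinedIn (fredholmUnits X) (R * F * R * F) (1 - (2 : ℝ) • P) := by
  set R' := F * R * F with hR'
  have hR'2 : R' * R' = 1 := by
    calc R' * R' = F * R * (F * F) * R * F := by rw [hR']; noncomm_ring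
      _ = F * (R * R) * F := by rw [hF]; noncomm_ring
      _ = 1 := by rw [hR, mul_one, hF]
  have hR'X : R' * X = X * R' := by
    calc R' * X = F * R * (F * X) := by rw [hR']; noncomm_ring
      _ = -(F * (R * X) * F) := by rw [hXF]; noncomm_ring
      _ = -((F * X) * R * F) := by rw [hRX]; noncomm_ring
      _ = X * R' := by rw [hXF, hR']; noncomm_ring
  set T := (1 / 2 : ℝ) • (R + R') with hT
  set S := (1 / 2 : ℝ) • (R - R') with hS
  have hSZ : Z = X * S := by rw [hZ, hS, mul_smul_comm]
  have hTX : T * X = X * T := by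
    rw [hT, smul_mul_assoc, mul_smul_comm, add_mul, mul_add, hRX, hR'X]
  have hSX : S * X = X * S := by
    rw [hS, smul_mul_assoc, mul_smul_comm, sub_mul, mul_sub, hRX, hR'X]
  have hSc : IsCompactOperator S := by
    have : S = (-(1 / 2) : ℝ) • (R' - R) := by rw [hS]; module
    rw [this]
    exact hRc.smul _
  have hTP : T * P = 0 := by rw [hT, smul_mul_assoc, hTP, smul_zero]
  have hPT : P * T = 0 := by rw [hT, mul_smul_comm, hPT, smul_zero]
  have hSZ2 : S = X * Z := by rw [hSZ, ← mul_assoc, hX, one_mul]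
  have hS2 : S * S = Z * Z := by
    calc S * S = (X * X) * (S * S) := by rw [hX, one_mul]
      _ = X * (X * S) * S := by noncomm_ring
      _ = _ := by rw [← hSX, hSZ]; noncomm_ring
  have hT2 : T * T = 1 - Z * Z := by
    rw [← hS2, eq_sub_iff_add_eq, hT, hS]
    simp only [smul_mul_smul, add_mul, mul_add, sub_mul, mul_sub, hR, hR'2]
    module
  have hTS : T * S + S * T = 0 := by
    rw [hT, hS]
    simp only [smul_mul_smul, add_mul, mul_add, sub_mul, mul_sub, hR, hR'2]
    module
  have hXPS : X * P * S = P ∧ S * (X * P) = P := by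
    constructor
    · rw [← hPX, mul_assoc, ← hSZ, hPZ]
    · rw [← mul_assoc, hSX, ← hSZ, hZP]
  have hXPXP : X * P * (X * P) = P := by
    rw [← hPX]
    calc P * X * (P * X) = P * X * (X * P) := by rw [hPX]
      _ = P * (X * X) * P := by noncomm_ring
      _ = P := by rw [hX, mul_one, hP]
  have hTXP : T * (X * P) = 0 := by rw [← mul_assoc, hTX, mul_assoc, hTP, mul_zero]
  have hXPT : X * P * T = 0 := by rw [mul_assoc, hPT, mul_zero]
  set S' : ℝ → (H →L[ℝ] H) := fun s => s • S + (1 - s) • (X * P) with hS'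
  have hS'c : ∀ s, IsCompactOperator (S' s) := fun s =>
    (hSc.smul s).add ((isCompactOperator_mul_left X hPc).smul (1 - s))
  have hS'2 : ∀ s, T * T + S' s * S' s = 1 - (1 - s ^ 2) • (Z * Z - P) := fun s => by
    simp only [hS', add_mul, mul_add, smul_mul_smul, hXPXP, hXPS.1, hXPS.2, hS2, hT2]
    module
  have hTS' : ∀ s, T * S' s + S' s * T = 0 := fun s => by
    have : T * S' s + S' s * T = s • (T * S + S * T) := by
      simp only [hS', add_mul, mul_add, smul_mul_assoc, mul_smul_comm, hTXP, hXPT, smul_add]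
      module
    rw [this, hTS, smul_zero]
  have hS'X : ∀ s, S' s * X = X * S' s := fun s => by
    simp only [hS', add_mul, mul_add, smul_mul_assoc, mul_smul_comm, hSX, mul_assoc, hPX]
  have hunit : ∀ s ∈ unitInterval, IsUnit (T + S' s) ∧ IsUnit (T - S' s) := fun s hs => by
    have hu : IsUnit (1 - (1 - s ^ 2) • (Z * Z - P)) :=
      isUnit_one_sub_smul hnorm (by nlinarith [hs.1, hs.2]) (by nlinarith [hs.1, hs.2])
    have h1 : (T + S' s) * (T + S' s) = 1 - (1 - s ^ 2) • (Z * Z - P) := by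
      rw [← hS'2, ← add_zero (T * T + S' s * S' s), ← hTS' s]; noncomm_ring
    have h2 : (T - S' s) * (T - S' s) = 1 - (1 - s ^ 2) • (Z * Z - P) := by
      rw [← hS'2, ← sub_zero (T * T + S' s * S' s), ← hTS' s]; noncomm_ring
    exact ⟨((Commute.refl _).isUnit_mul_iff.1 (h1 ▸ hu)).1,
      ((Commute.refl _).isUnit_mul_iff.1 (h2 ▸ hu)).1⟩
  have hZX : Z * X = X * Z := by rw [hSZ, mul_assoc, hSX]
  have hZc : IsCompactOperator Z := hSZ ▸ isCompactOperator_mul_left X hSc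
  have hDX : (Z * Z - P) * X = X * (Z * Z - P) := by
    rw [sub_mul, mul_sub, hPX, mul_assoc, hZX, ← mul_assoc, hZX, mul_assoc]
  have hDc : IsCompactOperator (Z * Z - P : H →L[ℝ] H) :=
    (isCompactOperator_mul_left Z hZc).sub hPc
  refine JoinedIn.trans (y := 1 - Z * Z - P) (JoinedIn.symm ?_) ?_
  · refine JoinedIn.ofLine (f := fun s => (T + S' s) * (T - S' s)) ?_ ?_ ?_ ?_
    · simp only [hS']; fun_prop
    · simp only [hS', zero_smul, sub_zero, one_smul, zero_add, add_mul, mul_sub, hTXP, hXPT,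
        hXPXP, hT2, add_zero]
    · have h1 : T + S = R := by rw [hT, hS]; module
      have h2 : T - S = R' := by rw [hT, hS]; module
      simp only [hS', sub_self, zero_smul, one_smul, add_zero, h1, h2, hR']
      noncomm_ring
    · rintro _ ⟨s, hs, rfl⟩
      obtain ⟨h1, h2⟩ := hunit s hs
      refine ⟨h1.mul h2, ?_, ?_⟩
      · change (T + S' s) * (T - S' s) * X = X * ((T + S' s) * (T - S' s))
        have h3 : (T + S' s) * X = X * (T + S' s) := by rw [add_mul, mul_add, hTX, hS'X]
        have h4 : (T - S' s) * X = X * (T - S' s) := by rw [sub_mul, mul_sub, hTX, hS'X]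
        rw [mul_assoc, h4, ← mul_assoc, h3, mul_assoc]
      · have : (T + S' s) * (T - S' s) - 1 = S' s * (T - S' s) - T * S' s - Z * Z := by
          rw [add_mul, mul_sub T, hT2]; abel
        rw [this]
        exact ((isCompactOperator_mul_right (hS'c s) _).sub
          (isCompactOperator_mul_left T (hS'c s))).sub (isCompactOperator_mul_left Z hZc)
  · refine JoinedIn.ofLine
      (f := fun r : ℝ => (1 - (1 - r) • (Z * Z - P)) * (1 - (2 : ℝ) • P)) ?_ ?_ ?_ ?_
    · fun_prop
    · simp only [sub_zero, one_smul, mul_sub, sub_mul, mul_one, one_mul, mul_smul_comm, hP,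
        mul_assoc, hZP]
      module
    · simp
    · rintro _ ⟨r, hr, rfl⟩
      have h1 : IsUnit (1 - (1 - r) • (Z * Z - P)) :=
        isUnit_one_sub_smul hnorm (by linarith [hr.2]) (by linarith [hr.1])
      have h2 : IsUnit (1 - (2 : ℝ) • P) := by
        have : (1 - (2 : ℝ) • P) * (1 - (2 : ℝ) • P) = 1 := by
          simp only [mul_sub, sub_mul, mul_one, one_mul, smul_mul_smul, hP]
          module
        exact ⟨⟨_, _, this, this⟩, rfl⟩
      refine ⟨h1.mul h2, ?_, ?_⟩
      · have h3 : Commute (Z * Z - P) X := hDX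
        have h4 : Commute P X := hPX
        exact (((Commute.one_left X).sub_left (h3.smul_left _))).mul_left
          ((Commute.one_left X).sub_left (h4.smul_left _))
      · have : (1 - (1 - r) • (Z * Z - P)) * (1 - (2 : ℝ) • P) - 1 =
            -((1 - r) • ((Z * Z - P) * (1 - (2 : ℝ) • P))) - (2 : ℝ) • P := by
          rw [sub_mul, one_mul, smul_mul_assoc]; abel
        rw [this]
        exact (((isCompactOperator_mul_right hDc _).smul (1 - r)).neg).sub (hPc.smul (2 : ℝ))

end Base

section Clifford

/-- Subsets of `Fin N`, as indicator vectors; they index a basis of the Clifford algebra. -/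
abbrev Blade (N : ℕ) : Type := Fin N → ZMod 2

/-- The sign character of `ZMod 2`. -/
def sgn (z : ZMod 2) : ℝ := if z = 0 then 1 else -1

theorem sgn_zero : sgn 0 = 1 := if_pos rfl

theorem sgn_one : sgn 1 = -1 := if_neg one_ne_zero

theorem zmod_two_cases (a : ZMod 2) : a = 0 ∨ a = 1 := by
  revert a; decide

theorem sgn_add (a b : ZMod 2) : sgn (a + b) = sgn a * sgn b := by
  rcases zmod_two_cases a with rfl | rfl <;> rcases zmod_two_cases b with rfl | rfl <;>
    simp [sgn_zero, sgn_one, show (1 + 1 : ZMod 2) = 0 from rfl]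

theorem two_eq_zero_zmod : (2 : ZMod 2) = 0 := rfl

theorem blade_add_self {N : ℕ} (A : Blade N) : A + A = 0 := by
  ext i; exact CharTwo.add_self_eq_zero _

theorem blade_add_add_cancel {N : ℕ} (S A : Blade N) : S + A + A = S := by
  rw [add_assoc, blade_add_self, add_zero]

/-- The exponent of the sign occurring in the product of two blades. -/
def bladeForm {N : ℕ} (A B : Blade N) : ZMod 2 := ∑ a, ∑ b, if b < a then A a * B b else 0

variable {N : ℕ}

theorem bladeForm_add_left (A A' B : Blade N) :
    bladeForm (A + A') B = bladeForm A B + bladeForm A' B := by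
  simp only [bladeForm, ← Finset.sum_add_distrib]
  refine Finset.sum_congr rfl fun a _ => Finset.sum_congr rfl fun b _ => ?_
  split_ifs <;> simp [add_mul]

theorem bladeForm_add_right (A B B' : Blade N) :
    bladeForm A (B + B') = bladeForm A B + bladeForm A B' := by
  simp only [bladeForm, ← Finset.sum_add_distrib]
  refine Finset.sum_congr rfl fun a _ => Finset.sum_congr rfl fun b _ => ?_
  split_ifs <;> simp [mul_add]

section Module

variable {V : Type*} [AddCommGroup V] [Module ℝ V]

/-- Left multiplication by a blade. -/
def cliffL (A : Blade N) : (Blade N → V) →ₗ[ℝ] (Blade N → V) where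
  toFun f S := sgn (bladeForm A (S + A)) • f (S + A)
  map_add' f g := by ext; simp
  map_smul' r f := by ext; simp [smul_comm r]

/-- Right multiplication by a blade. -/
def cliffR (A : Blade N) : (Blade N → V) →ₗ[ℝ] (Blade N → V) where
  toFun f S := sgn (bladeForm (S + A) A) • f (S + A)
  map_add' f g := by ext; simp
  map_smul' r f := by ext; simp [smul_comm r]

theorem cliffL_apply (A : Blade N) (f : Blade N → V) (S : Blade N) :
    cliffL A f S = sgn (bladeForm A (S + A)) • f (S + A) := rfl

theorem cliffR_apply (A : Blade N) (f : Blade N → V) (S : Blade N) :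
    cliffR A f S = sgn (bladeForm (S + A) A) • f (S + A) := rfl

theorem cliffL_cliffL (A B : Blade N) (f : Blade N → V) :
    cliffL A (cliffL B f) = sgn (bladeForm A B) • cliffL (A + B) f := by
  ext S
  simp only [cliffL_apply, Pi.smul_apply, smul_smul, ← sgn_add, ← add_assoc]
  congr 2
  simp only [bladeForm_add_left, bladeForm_add_right]
  linear_combination -bladeForm A B * two_eq_zero_zmod

theorem cliffR_cliffR (A B : Blade N) (f : Blade N → V) :
    cliffR A (cliffR B f) = sgn (bladeForm B A) • cliffR (A + B) f := by
  ext S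
  simp only [cliffR_apply, Pi.smul_apply, smul_smul, ← sgn_add, ← add_assoc]
  congr 2
  simp only [bladeForm_add_left, bladeForm_add_right]
  linear_combination -bladeForm B A * two_eq_zero_zmod

theorem cliffL_cliffR (A B : Blade N) (f : Blade N → V) :
    cliffL A (cliffR B f) = cliffR B (cliffL A f) := by
  ext S
  simp only [cliffL_apply, cliffR_apply, smul_smul, ← sgn_add, add_right_comm S B A]
  congr 2
  simp only [bladeForm_add_left, bladeForm_add_right]
  ring_nf

theorem cliffL_zero (f : Blade N → V) : cliffL 0 f = f := by
  ext S
  have : bladeForm (0 : Blade N) S = 0 := by simp [bladeForm]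
  simp [cliffL_apply, this, sgn_zero]

theorem cliffR_zero (f : Blade N → V) : cliffR 0 f = f := by
  ext S
  have : bladeForm S (0 : Blade N) = 0 := by simp [bladeForm]
  simp [cliffR_apply, this, sgn_zero]

end Module

/-- The blades representing the `N + 1` generators. -/
def genBlade : Fin (N + 1) → Blade N := Fin.lastCases (fun _ => 1) (fun i => Pi.single i 1)

theorem genBlade_last : genBlade (Fin.last N) = fun _ => 1 := by simp [genBlade]

theorem genBlade_castSucc (i : Fin N) : genBlade i.castSucc = Pi.single i 1 := by simp [genBlade]

theorem bladeForm_single_left (i : Fin N) (B : Blade N) :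
    bladeForm (Pi.single i 1) B = ∑ b, if b < i then B b else 0 := by
  rw [bladeForm, Finset.sum_eq_single i]
  · simp
  · intro a _ ha; simp [ha]
  · simp

theorem bladeForm_single_right (i : Fin N) (B : Blade N) :
    bladeForm B (Pi.single i 1) = ∑ a, if i < a then B a else 0 := by
  rw [bladeForm]
  refine Finset.sum_congr rfl fun a _ => ?_
  rw [Finset.sum_eq_single i]
  · simp
  · intro a _ ha; simp [ha]
  · simp

theorem bladeForm_single_comm (i : Fin N) (S : Blade N) :
    bladeForm (Pi.single i 1) S + bladeForm S (Pi.single i 1) = (∑ b, S b) + S i := by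
  rw [bladeForm_single_left, bladeForm_single_right, ← Finset.sum_add_distrib,
    ← Finset.add_sum_erase _ _ (Finset.mem_univ i),
    ← Finset.add_sum_erase _ (fun b => S b) (Finset.mem_univ i)]
  have : ∀ b ∈ Finset.univ.erase i, ((if b < i then S b else 0) + if i < b then S b else 0) = S b :=
    fun b hb => by
      rcases lt_or_gt_of_ne (Finset.ne_of_mem_erase hb) with h | h <;> simp [h, h.not_gt]
  rw [Finset.sum_congr rfl this]
  simp only [lt_irrefl, if_false, add_zero, zero_add]
  linear_combination -(S i) * two_eq_zero_zmod

theorem bladeForm_one_comm (hN : Even N) (S : Blade N) :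
    bladeForm (fun _ => 1) S + bladeForm S (fun _ => 1) = ∑ b, S b := by
  have hN0 : (N : ZMod 2) = 0 := (ZMod.natCast_eq_zero_iff_even).2 hN
  have h1 : (fun _ => 1 : Blade N) = ∑ i, Pi.single i 1 := by
    ext j; simp [Finset.sum_apply, Pi.single_apply]
  have hl : ∀ s : Finset (Fin N), bladeForm (∑ i ∈ s, Pi.single i 1) S =
      ∑ i ∈ s, bladeForm (Pi.single i 1) S := fun s =>
    map_sum (AddMonoidHom.mk' (fun A => bladeForm A S) fun A B => bladeForm_add_left A B S) _ _
  have hr : ∀ s : Finset (Fin N), bladeForm S (∑ i ∈ s, Pi.single i 1) =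
      ∑ i ∈ s, bladeForm S (Pi.single i 1) := fun s =>
    map_sum (AddMonoidHom.mk' (fun A => bladeForm S A) fun A B => bladeForm_add_right S A B) _ _
  rw [h1, hl, hr, ← Finset.sum_add_distrib]
  simp only [bladeForm_single_comm, Finset.sum_add_distrib]
  simp [hN0]

theorem bladeForm_genBlade_self (hN : 4 ∣ N) (i : Fin (N + 1)) :
    bladeForm (genBlade i : Blade N) (genBlade i) = 0 := by
  induction i using Fin.lastCases with
  | cast i =>
    rw [genBlade_castSucc, bladeForm_single_left]
    refine Finset.sum_eq_zero fun b _ => ?_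
    split_ifs with h
    · simp [h.ne]
    · rfl
  | last =>
    rw [genBlade_last]
    have h1 : bladeForm (fun _ => 1 : Blade N) (fun _ => 1) = ((∑ a : Fin N, (a : ℕ) : ℕ) : ZMod 2) := by
      rw [bladeForm, Nat.cast_sum]
      refine Finset.sum_congr rfl fun a _ => ?_
      simp [Finset.filter_gt_eq_Iio]
    rw [h1, Fin.sum_univ_eq_sum_range (fun a => a) N, ZMod.natCast_eq_zero_iff,
      Finset.sum_range_id]
    obtain ⟨k, rfl⟩ := hN
    refine ⟨k * (4 * k - 1), ?_⟩
    rw [show 4 * k * (4 * k - 1) = 2 * (2 * (k * (4 * k - 1))) by ring]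
    omega

theorem bladeForm_genBlade_comm (hN : 4 ∣ N) {i j : Fin (N + 1)} (hij : i ≠ j) :
    bladeForm (genBlade i : Blade N) (genBlade j) + bladeForm (genBlade j : Blade N) (genBlade i)
      = 1 := by
  have h2 : Even N := (even_iff_two_dvd).2 (dvd_trans (by norm_num) hN)
  induction i using Fin.lastCases with
  | cast i =>
    rw [genBlade_castSucc, bladeForm_single_comm]
    induction j using Fin.lastCases with
    | cast j =>
      have : i ≠ j := fun h => hij (by rw [h])
      simp [genBlade_castSucc, Pi.single_apply, this]
    | last =>
      simp [genBlade_last, (ZMod.natCast_eq_zero_iff_even).2 h2]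
  | last =>
    rw [genBlade_last, bladeForm_one_comm h2]
    induction j using Fin.lastCases with
    | cast j => simp [genBlade_castSucc, Pi.single_apply]
    | last => exact absurd rfl hij

/-- The eigenvalue on the blade `S` of the sum of the products of left and right generators. -/
noncomputable def bladeEigenvalue (S : Blade N) : ℝ :=
  ∑ i : Fin (N + 1), sgn (bladeForm (genBlade i) S + bladeForm S (genBlade i))

theorem bladeEigenvalue_zero : bladeEigenvalue (0 : Blade N) = N + 1 := by
  simp [bladeEigenvalue, bladeForm, sgn_zero]

theorem abs_bladeEigenvalue_le (hN : 4 ∣ N) {S : Blade N} (hS : S ≠ 0) :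
    |bladeEigenvalue S| ≤ N - 1 := by
  have h2 : Even N := (even_iff_two_dvd).2 (dvd_trans (by norm_num) hN)
  obtain ⟨i, hi⟩ := Function.ne_iff.1 hS
  have hi1 : S i = 1 := (zmod_two_cases (S i)).resolve_left hi
  rw [bladeEigenvalue, Fin.sum_univ_castSucc]
  simp only [genBlade_last, bladeForm_one_comm h2, genBlade_castSucc, bladeForm_single_comm]
  rw [← Finset.add_sum_erase _ _ (Finset.mem_univ i), hi1, sgn_add _ 1, sgn_one]
  have : |∑ x ∈ Finset.univ.erase i, sgn (∑ b, S b + S x)| ≤ ∑ x ∈ Finset.univ.erase i, (1 : ℝ) := by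
    refine (Finset.abs_sum_le_sum_abs _ _).trans (Finset.sum_le_sum fun x _ => ?_)
    rw [sgn]; split_ifs <;> simp
  rw [Finset.sum_const, Finset.card_erase_of_mem (Finset.mem_univ i), Finset.card_univ,
    Fintype.card_fin, nsmul_eq_mul, mul_one, Nat.cast_sub i.pos, Nat.cast_one] at this
  convert this using 2
  ring

section Generators

variable {V : Type*} [AddCommGroup V] [Module ℝ V]

theorem genL_sq (hN : 4 ∣ N) (i : Fin (N + 1)) (f : Blade N → V) :
    cliffL (genBlade i) (cliffL (genBlade i) f) = f := by
  rw [cliffL_cliffL, bladeForm_genBlade_self hN, sgn_zero, one_smul, blade_add_self, cliffL_zero]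

theorem genR_sq (hN : 4 ∣ N) (i : Fin (N + 1)) (f : Blade N → V) :
    cliffR (genBlade i) (cliffR (genBlade i) f) = f := by
  rw [cliffR_cliffR, bladeForm_genBlade_self hN, sgn_zero, one_smul, blade_add_self, cliffR_zero]

theorem sgn_add_eq_zero {a b : ZMod 2} (h : a + b = 1) : sgn a + sgn b = 0 := by
  have : b = 1 + a := by linear_combination h - a * two_eq_zero_zmod
  rw [this, sgn_add, sgn_one]; ring

theorem genL_anticomm (hN : 4 ∣ N) {i j : Fin (N + 1)} (hij : i ≠ j) (f : Blade N → V) :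
    cliffL (genBlade i) (cliffL (genBlade j) f) + cliffL (genBlade j) (cliffL (genBlade i) f)
      = 0 := by
  rw [cliffL_cliffL, cliffL_cliffL, add_comm (genBlade j), ← add_smul,
    sgn_add_eq_zero (bladeForm_genBlade_comm hN hij), zero_smul]

theorem genR_anticomm (hN : 4 ∣ N) {i j : Fin (N + 1)} (hij : i ≠ j) (f : Blade N → V) :
    cliffR (genBlade i) (cliffR (genBlade j) f) + cliffR (genBlade j) (cliffR (genBlade i) f)
      = 0 := by
  rw [cliffR_cliffR, cliffR_cliffR, add_comm (genBlade j), ← add_smul,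
    sgn_add_eq_zero (bladeForm_genBlade_comm hN hij.symm), zero_smul]

theorem sum_genL_genR (hN : 4 ∣ N) (f : Blade N → V) (S : Blade N) :
    (∑ i : Fin (N + 1), cliffL (genBlade i) (cliffR (genBlade i) f)) S =
      bladeEigenvalue S • f S := by
  rw [Finset.sum_apply, bladeEigenvalue, Finset.sum_smul]
  refine Finset.sum_congr rfl fun i _ => ?_
  rw [cliffL_apply, cliffR_apply, smul_smul, ← sgn_add, blade_add_add_cancel,
    bladeForm_add_right, bladeForm_genBlade_self hN, add_zero]

end Generators

end Clifford

section PolynomialSpinors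

/-- Polynomial maps with values in the Clifford algebra. -/
abbrev PolySpinor (N : ℕ) : Type := Blade N → MvPolynomial (Fin (N + 1)) ℝ

variable {N : ℕ}

/-- Left multiplication by a generator. -/
noncomputable def eL (i : Fin (N + 1)) : Module.End ℝ (PolySpinor N) := cliffL (genBlade i)

/-- Right multiplication by a generator. -/
noncomputable def eR (i : Fin (N + 1)) : Module.End ℝ (PolySpinor N) := cliffR (genBlade i)

/-- Partial derivative. -/
noncomputable def dP (i : Fin (N + 1)) : Module.End ℝ (PolySpinor N) :=
  LinearMap.compLeft (MvPolynomial.pderiv i).toLinearMap (Blade N)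

/-- Multiplication by a coordinate. -/
noncomputable def xP (i : Fin (N + 1)) : Module.End ℝ (PolySpinor N) :=
  LinearMap.compLeft (LinearMap.mulLeft ℝ (MvPolynomial.X i)) (Blade N)

theorem dP_apply (i : Fin (N + 1)) (f : PolySpinor N) (S : Blade N) :
    dP i f S = MvPolynomial.pderiv i (f S) := rfl

theorem xP_apply (i : Fin (N + 1)) (f : PolySpinor N) (S : Blade N) :
    xP i f S = MvPolynomial.X i * f S := rfl

theorem eL_apply (i : Fin (N + 1)) (f : PolySpinor N) (S : Blade N) :
    eL i f S = sgn (bladeForm (genBlade i) (S + genBlade i)) • f (S + genBlade i) := rfl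

theorem eR_apply (i : Fin (N + 1)) (f : PolySpinor N) (S : Blade N) :
    eR i f S = sgn (bladeForm (S + genBlade i) (genBlade i)) • f (S + genBlade i) := rfl

theorem eL_mul_dP (i j : Fin (N + 1)) :
    (eL i * dP j : Module.End ℝ (PolySpinor N)) = dP j * eL i :=
  LinearMap.ext fun f => funext fun S => by
    simp only [Module.End.mul_apply, eL_apply, dP_apply, Derivation.map_smul]

theorem eL_mul_xP (i j : Fin (N + 1)) :
    (eL i * xP j : Module.End ℝ (PolySpinor N)) = xP j * eL i :=
  LinearMap.ext fun f => funext fun S => by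
    simp only [Module.End.mul_apply, eL_apply, xP_apply, mul_smul_comm]

theorem eR_mul_dP (i j : Fin (N + 1)) :
    (eR i * dP j : Module.End ℝ (PolySpinor N)) = dP j * eR i :=
  LinearMap.ext fun f => funext fun S => by
    simp only [Module.End.mul_apply, eR_apply, dP_apply, Derivation.map_smul]

theorem eL_mul_eR (i j : Fin (N + 1)) : (eL i * eR j : Module.End ℝ (PolySpinor N)) = eR j * eL i :=
  LinearMap.ext fun f => cliffL_cliffR _ _ f

theorem pderiv_pderiv_comm {σ : Type*} (i j : σ) (p : MvPolynomial σ ℝ) :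
    MvPolynomial.pderiv i (MvPolynomial.pderiv j p) =
      MvPolynomial.pderiv j (MvPolynomial.pderiv i p) := by
  classical
  have : ⁅(MvPolynomial.pderiv i : Derivation ℝ (MvPolynomial σ ℝ) (MvPolynomial σ ℝ)),
      MvPolynomial.pderiv j⁆ =
      (0 : Derivation ℝ (MvPolynomial σ ℝ) (MvPolynomial σ ℝ)) := by
    refine MvPolynomial.derivation_ext fun k => ?_
    rw [Derivation.commutator_apply, MvPolynomial.pderiv_X, MvPolynomial.pderiv_X,
      Pi.single_apply, Pi.single_apply]
    split_ifs <;> simp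
  have h := congrArg (fun D : Derivation ℝ (MvPolynomial σ ℝ) (MvPolynomial σ ℝ) => D p) this
  simp only [Derivation.commutator_apply, Derivation.zero_apply] at h
  exact sub_eq_zero.1 h

theorem dP_mul_dP (i j : Fin (N + 1)) : (dP i * dP j : Module.End ℝ (PolySpinor N)) = dP j * dP i := by
  refine LinearMap.ext fun f => funext fun S => ?_
  simp only [Module.End.mul_apply, dP_apply]
  exact pderiv_pderiv_comm _ _ _

theorem dP_mul_xP (i j : Fin (N + 1)) :
    (dP i * xP j : Module.End ℝ (PolySpinor N)) = xP j * dP i + if i = j then 1 else 0 := by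
  refine LinearMap.ext fun f => funext fun S => ?_
  simp only [Module.End.mul_apply, LinearMap.add_apply, Pi.add_apply, dP_apply, xP_apply,
    Derivation.leibniz, MvPolynomial.pderiv_X, smul_eq_mul, Pi.single_apply, eq_comm (a := j)]
  split_ifs <;> simp

theorem eL_clifford (hN : 4 ∣ N) (i j : Fin (N + 1)) :
    (eL i * eL j + eL j * eL i : Module.End ℝ (PolySpinor N)) = if i = j then 2 else 0 := by
  split_ifs with h
  · subst h
    have : (eL i * eL i : Module.End ℝ (PolySpinor N)) = 1 :=
      LinearMap.ext fun f => genL_sq hN i f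
    rw [this]; norm_num
  · exact LinearMap.ext fun f => genL_anticomm hN h f

theorem eL_mul_self (hN : 4 ∣ N) (i : Fin (N + 1)) :
    (eL i * eL i : Module.End ℝ (PolySpinor N)) = 1 :=
  LinearMap.ext fun f => genL_sq hN i f

/-- The Dirac operator. -/
noncomputable def dirac : Module.End ℝ (PolySpinor N) := ∑ i, eL i * dP i

/-- Left multiplication by the position vector. -/
noncomputable def vecX : Module.End ℝ (PolySpinor N) := ∑ i, eL i * xP i

/-- The Euler operator. -/
noncomputable def euler : Module.End ℝ (PolySpinor N) := ∑ i, xP i * dP i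

theorem dirac_mul_xP (i : Fin (N + 1)) :
    (dirac * xP i : Module.End ℝ (PolySpinor N)) = xP i * dirac + eL i := by
  rw [dirac, Finset.sum_mul, Finset.mul_sum]
  have : ∀ j : Fin (N + 1), eL j * dP j * xP i = xP i * (eL j * dP j) + if j = i then eL j else 0 :=
    fun j => by
      rw [mul_assoc, dP_mul_xP, mul_add, ← mul_assoc, eL_mul_xP, mul_assoc]
      split_ifs <;> simp
  rw [Finset.sum_congr rfl fun j _ => this j, Finset.sum_add_distrib]
  simp

theorem dirac_mul_eL (hN : 4 ∣ N) (i : Fin (N + 1)) :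
    (dirac * eL i : Module.End ℝ (PolySpinor N)) = 2 * dP i - eL i * dirac := by
  rw [dirac, eq_sub_iff_add_eq, Finset.sum_mul, Finset.mul_sum, ← Finset.sum_add_distrib]
  have : ∀ j : Fin (N + 1), eL j * dP j * eL i + eL i * (eL j * dP j) =
      if j = i then 2 * dP j else 0 := fun j => by
    rw [mul_assoc, ← eL_mul_dP, ← mul_assoc, ← mul_assoc, ← add_mul, eL_clifford hN]
    split_ifs <;> simp
  rw [Finset.sum_congr rfl fun j _ => this j]
  simp

theorem dirac_mul_vecX (hN : 4 ∣ N) :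
    (dirac * vecX : Module.End ℝ (PolySpinor N)) = (N + 1 : ℝ) • 1 + 2 * euler - vecX * dirac := by
  have h : ∀ i : Fin (N + 1), dirac * (eL i * xP i) = 2 * (xP i * dP i) + 1 - eL i * xP i * dirac :=
    fun i => by
      rw [← mul_assoc, dirac_mul_eL hN, sub_mul, mul_assoc 2, dP_mul_xP, if_pos rfl,
        mul_assoc (eL i), dirac_mul_xP, mul_add, mul_add, eL_mul_self hN]
      noncomm_ring
  rw [vecX, Finset.mul_sum, Finset.sum_congr rfl fun i _ => h i, Finset.sum_sub_distrib,
    Finset.sum_add_distrib, euler, Finset.mul_sum, Finset.sum_mul]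
  simp only [Finset.sum_const, Finset.card_univ, Fintype.card_fin]
  rw [← Nat.cast_smul_eq_nsmul ℝ]
  push_cast
  abel

theorem dirac_mul_dP (i : Fin (N + 1)) :
    (dirac * dP i : Module.End ℝ (PolySpinor N)) = dP i * dirac := by
  rw [dirac, Finset.sum_mul, Finset.mul_sum]
  refine Finset.sum_congr rfl fun j _ => ?_
  rw [mul_assoc, dP_mul_dP, ← mul_assoc, eL_mul_dP, mul_assoc]

theorem eR_mul_dirac (i : Fin (N + 1)) :
    (eR i * dirac : Module.End ℝ (PolySpinor N)) = dirac * eR i := by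
  rw [dirac, Finset.sum_mul, Finset.mul_sum]
  refine Finset.sum_congr rfl fun j _ => ?_
  rw [← mul_assoc, ← eL_mul_eR, mul_assoc, eR_mul_dP, mul_assoc]

/-- Spinors with homogeneous components of degree `j`. -/
noncomputable def homogSpinor (N j : ℕ) : Submodule ℝ (PolySpinor N) :=
  Submodule.pi Set.univ fun _ => MvPolynomial.homogeneousSubmodule (Fin (N + 1)) ℝ j

theorem mem_homogSpinor {j : ℕ} {f : PolySpinor N} :
    f ∈ homogSpinor N j ↔ ∀ S, (f S).IsHomogeneous j := by
  simp [homogSpinor, Submodule.mem_pi]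

theorem eL_mem_homogSpinor {j : ℕ} {f : PolySpinor N} (hf : f ∈ homogSpinor N j)
    (i : Fin (N + 1)) : eL i f ∈ homogSpinor N j := by
  rw [mem_homogSpinor] at *
  exact fun S => (MvPolynomial.homogeneousSubmodule _ ℝ j).smul_mem _ (hf _)

theorem eR_mem_homogSpinor {j : ℕ} {f : PolySpinor N} (hf : f ∈ homogSpinor N j)
    (i : Fin (N + 1)) : eR i f ∈ homogSpinor N j := by
  rw [mem_homogSpinor] at *
  exact fun S => (MvPolynomial.homogeneousSubmodule _ ℝ j).smul_mem _ (hf _)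

theorem xP_mem_homogSpinor {j : ℕ} {f : PolySpinor N} (hf : f ∈ homogSpinor N j)
    (i : Fin (N + 1)) : xP i f ∈ homogSpinor N (j + 1) := by
  rw [mem_homogSpinor] at *
  intro S
  rw [xP_apply, add_comm j 1]
  exact (MvPolynomial.isHomogeneous_X _ i).mul (hf S)

theorem dP_mem_homogSpinor {j : ℕ} {f : PolySpinor N} (hf : f ∈ homogSpinor N j)
    (i : Fin (N + 1)) : dP i f ∈ homogSpinor N (j - 1) := by
  rw [mem_homogSpinor] at *
  exact fun S => (hf S).pderiv

theorem dP_eq_zero {f : PolySpinor N} (hf : f ∈ homogSpinor N 0) (i : Fin (N + 1)) :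
    dP i f = 0 := by
  rw [mem_homogSpinor] at hf
  funext S
  have h := hf S
  rw [← MvPolynomial.totalDegree_zero_iff_isHomogeneous,
    MvPolynomial.totalDegree_eq_zero_iff_eq_C] at h
  rw [dP_apply, h, MvPolynomial.pderiv_C]
  rfl

theorem vecX_mem_homogSpinor {j : ℕ} {f : PolySpinor N} (hf : f ∈ homogSpinor N j) :
    vecX f ∈ homogSpinor N (j + 1) := by
  rw [vecX, LinearMap.sum_apply]
  exact Submodule.sum_mem _ fun i _ => eL_mem_homogSpinor (xP_mem_homogSpinor hf i) i

theorem euler_apply {j : ℕ} {f : PolySpinor N} (hf : f ∈ homogSpinor N j) :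
    euler f = (j : ℝ) • f := by
  rw [mem_homogSpinor] at hf
  funext S
  have := (hf S).sum_X_mul_pderiv
  rw [Pi.smul_apply, Nat.cast_smul_eq_nsmul, ← this, euler, LinearMap.sum_apply, Finset.sum_apply]
  rfl

/-- Homogeneous solutions of the Dirac equation. -/
noncomputable def monogenic (N j : ℕ) : Submodule ℝ (PolySpinor N) := homogSpinor N j ⊓ LinearMap.ker dirac

instance finiteDimensional_homogSpinor (j : ℕ) : FiniteDimensional ℝ (homogSpinor N j) := by
  have : FiniteDimensional ℝ (MvPolynomial.homogeneousSubmodule (Fin (N + 1)) ℝ j) :=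
    Module.Finite.iff_fg.2 (MvPolynomial.homogeneousSubmodule_fg _ _ j)
  let φ : homogSpinor N j →ₗ[ℝ]
      (Blade N → MvPolynomial.homogeneousSubmodule (Fin (N + 1)) ℝ j) :=
    { toFun := fun f S => ⟨f.1 S, mem_homogSpinor.1 f.2 S⟩
      map_add' := fun _ _ => rfl
      map_smul' := fun _ _ => rfl }
  refine Module.Finite.of_injective φ fun f g h => ?_
  ext1; funext S
  exact congrArg Subtype.val (congrFun h S)

instance finiteDimensional_monogenic (j : ℕ) : FiniteDimensional ℝ (monogenic N j) :=
  Submodule.finiteDimensional_of_le (inf_le_left : _ ≤ homogSpinor N j)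

theorem eR_mem_monogenic {j : ℕ} {f : PolySpinor N} (hf : f ∈ monogenic N j)
    (i : Fin (N + 1)) : eR i f ∈ monogenic N j := by
  refine ⟨eR_mem_homogSpinor hf.1 i, ?_⟩
  change dirac (eR i f) = 0
  have h : dirac f = 0 := hf.2
  rw [← Module.End.mul_apply, ← eR_mul_dirac, Module.End.mul_apply, h, map_zero]

theorem dP_mem_monogenic {j : ℕ} {f : PolySpinor N} (hf : f ∈ monogenic N j)
    (i : Fin (N + 1)) : dP i f ∈ monogenic N (j - 1) := by
  refine ⟨dP_mem_homogSpinor hf.1 i, ?_⟩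
  change dirac (dP i f) = 0
  have h : dirac f = 0 := hf.2
  rw [← Module.End.mul_apply, dirac_mul_dP, Module.End.mul_apply, h, map_zero]

theorem dirac_vecX_apply (hN : 4 ∣ N) (f : PolySpinor N) :
    dirac (vecX f) = (N + 1 : ℝ) • f + (2 : ℝ) • euler f - vecX (dirac f) := by
  have h2 := congrArg (fun T : Module.End ℝ (PolySpinor N) => T f) (dirac_mul_vecX hN)
  rw [two_mul] at h2
  rw [two_smul]
  exact h2

theorem dirac_eL_apply (hN : 4 ∣ N) (i : Fin (N + 1)) (f : PolySpinor N) :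
    dirac (eL i f) = (2 : ℝ) • dP i f - eL i (dirac f) := by
  have h2 := congrArg (fun T : Module.End ℝ (PolySpinor N) => T f) (dirac_mul_eL hN i)
  rw [two_mul] at h2
  rw [two_smul]
  exact h2

theorem dirac_xP_apply (i : Fin (N + 1)) (f : PolySpinor N) :
    dirac (xP i f) = xP i (dirac f) + eL i f :=
  congrArg (fun T : Module.End ℝ (PolySpinor N) => T f) (dirac_mul_xP i)

theorem dirac_vecX (hN : 4 ∣ N) {j : ℕ} {f : PolySpinor N} (hf : f ∈ monogenic N j) :
    dirac (vecX f) = (2 * j + (N + 1) : ℝ) • f := by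
  have h : dirac f = 0 := hf.2
  rw [dirac_vecX_apply hN, h, map_zero, euler_apply hf.1]
  module

theorem dirac_vecX_vecX (hN : 4 ∣ N) {j : ℕ} {f : PolySpinor N} (hf : f ∈ monogenic N j) :
    dirac (vecX (vecX f)) = (2 : ℝ) • vecX f := by
  rw [dirac_vecX_apply hN, dirac_vecX hN hf, map_smul, euler_apply (vecX_mem_homogSpinor hf.1)]
  push_cast
  module

/-- The component of degree `j - 1` in the product of a monogenic spinor with a coordinate. -/
noncomputable def lowerPart (j : ℕ) (i : Fin (N + 1)) (f : PolySpinor N) : PolySpinor N :=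
  (2 * j + (N + 1) - 2 : ℝ)⁻¹ • dP i f

/-- The component of degree `j` in the product of a monogenic spinor with a coordinate. -/
noncomputable def middlePart (j : ℕ) (i : Fin (N + 1)) (f : PolySpinor N) : PolySpinor N :=
  (2 * j + (N + 1) : ℝ)⁻¹ • (eL i f - (2 : ℝ) • vecX (lowerPart j i f))

/-- The component of degree `j + 1` in the product of a monogenic spinor with a coordinate. -/
noncomputable def upperPart (j : ℕ) (i : Fin (N + 1)) (f : PolySpinor N) : PolySpinor N :=
  xP i f - vecX (middlePart j i f) - vecX (vecX (lowerPart j i f))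

theorem lowerPart_mem {j : ℕ} {f : PolySpinor N} (hf : f ∈ monogenic N j) (i : Fin (N + 1)) :
    lowerPart j i f ∈ monogenic N (j - 1) :=
  Submodule.smul_mem _ _ (dP_mem_monogenic hf i)

theorem lowerPart_zero {f : PolySpinor N} (hf : f ∈ monogenic N 0) (i : Fin (N + 1)) :
    lowerPart 0 i f = 0 := by
  rw [lowerPart, dP_eq_zero hf.1, smul_zero]

theorem vecX_lowerPart_mem {j : ℕ} {f : PolySpinor N} (hf : f ∈ monogenic N j)
    (i : Fin (N + 1)) : vecX (lowerPart j i f) ∈ homogSpinor N j := by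
  rcases j with _ | j
  · rw [lowerPart_zero hf, map_zero]; exact zero_mem _
  · exact vecX_mem_homogSpinor (lowerPart_mem hf i).1

theorem dirac_vecX_lowerPart (hN : 4 ∣ N) (hN0 : 2 ≤ N) {j : ℕ} {f : PolySpinor N}
    (hf : f ∈ monogenic N j) (i : Fin (N + 1)) : dirac (vecX (lowerPart j i f)) = dP i f := by
  rcases j with _ | j
  · rw [lowerPart_zero hf, map_zero, map_zero, dP_eq_zero hf.1]
  · rw [dirac_vecX hN (lowerPart_mem hf i), lowerPart, smul_smul]
    have h2 : (2 : ℝ) ≤ N := by exact_mod_cast hN0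
    have h3 : (2 * ((j + 1 : ℕ) : ℝ) + (N + 1) - 2) ≠ 0 := by
      apply ne_of_gt
      have : (0 : ℝ) ≤ j := Nat.cast_nonneg j
      push_cast
      linarith
    have : (2 * ((j + 1 - 1 : ℕ) : ℝ) + (N + 1)) * (2 * ((j + 1 : ℕ) : ℝ) + (N + 1) - 2)⁻¹ = 1 := by
      rw [mul_inv_eq_one₀ h3]
      push_cast
      ring
    rw [this, one_smul]

theorem dirac_vecX_vecX_lowerPart (hN : 4 ∣ N) {j : ℕ} {f : PolySpinor N}
    (hf : f ∈ monogenic N j) (i : Fin (N + 1)) :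
    dirac (vecX (vecX (lowerPart j i f))) = (2 : ℝ) • vecX (lowerPart j i f) :=
  dirac_vecX_vecX hN (lowerPart_mem hf i)

theorem two_mul_add_pos (N j : ℕ) : (0 : ℝ) < 2 * j + (N + 1) := by positivity

theorem middlePart_mem (hN : 4 ∣ N) (hN0 : 2 ≤ N) {j : ℕ} {f : PolySpinor N}
    (hf : f ∈ monogenic N j) (i : Fin (N + 1)) : middlePart j i f ∈ monogenic N j := by
  refine Submodule.smul_mem _ _ ⟨Submodule.sub_mem _ (eL_mem_homogSpinor hf.1 i)
    (Submodule.smul_mem _ _ (vecX_lowerPart_mem hf i)), ?_⟩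
  change dirac _ = 0
  have h : dirac f = 0 := hf.2
  rw [map_sub, map_smul, dirac_vecX_lowerPart hN hN0 hf, dirac_eL_apply hN, h, map_zero, sub_zero,
    sub_self]

theorem upperPart_mem (hN : 4 ∣ N) (hN0 : 2 ≤ N) {j : ℕ} {f : PolySpinor N}
    (hf : f ∈ monogenic N j) (i : Fin (N + 1)) : upperPart j i f ∈ monogenic N (j + 1) := by
  have hq := middlePart_mem hN hN0 hf i
  refine ⟨Submodule.sub_mem _ (Submodule.sub_mem _ (xP_mem_homogSpinor hf.1 i)
    (vecX_mem_homogSpinor hq.1)) (vecX_mem_homogSpinor (vecX_lowerPart_mem hf i)), ?_⟩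
  change dirac (upperPart j i f) = 0
  have h : dirac f = 0 := hf.2
  rw [upperPart, map_sub, map_sub, dirac_vecX_vecX_lowerPart hN hf, dirac_vecX hN hq,
    dirac_xP_apply, h, map_zero,
    middlePart, smul_smul, mul_inv_cancel₀ (two_mul_add_pos N j).ne']
  module

theorem xP_eq (j : ℕ) (i : Fin (N + 1)) (f : PolySpinor N) :
    xP i f = upperPart j i f + vecX (middlePart j i f) + vecX (vecX (lowerPart j i f)) := by
  rw [upperPart]; abel

end PolynomialSpinors

section Blocks

variable {H : Type*} [NormedAddCommGroup H] [InnerProductSpace ℝ H] {ι : Type*}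
  {V : ι → Submodule ℝ H}

theorem isCompactOperator_starProjection (U : Submodule ℝ H) [FiniteDimensional ℝ U] :
    IsCompactOperator (U.starProjection : H →L[ℝ] H) := by
  have : ProperSpace U := FiniteDimensional.proper ℝ U
  have h1 : IsCompactOperator (U.orthogonalProjectionOnto : H →L[ℝ] U) :=
    isCompactOperator_of_locallyCompactSpace_dom U.orthogonalProjectionOnto
  exact h1.clm_comp U.subtypeL

/-- A block diagonal operator is bounded by the bound on its blocks. -/
theorem opNorm_le_of_blocks (hV : OrthogonalFamily ℝ (fun i => V i) fun i => (V i).subtypeₗᵢ)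
    (hd : (⨆ i, V i).topologicalClosure = ⊤) (T : H →L[ℝ] H) {c : ℝ} (hc : 0 ≤ c)
    (hT : ∀ i, ∀ v ∈ V i, T v ∈ V i) (hb : ∀ i, ∀ v ∈ V i, ‖T v‖ ≤ c * ‖v‖) : ‖T‖ ≤ c := by
  classical
  refine T.opNorm_le_bound hc fun v => ?_
  have hv : v ∈ closure ((⨆ i, V i : Submodule ℝ H) : Set H) := by
    rw [← Submodule.topologicalClosure_coe, hd]; trivial
  refine closure_minimal (t := {v | ‖T v‖ ≤ c * ‖v‖}) (fun w hw => ?_)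
    (isClosed_le (by fun_prop) (by fun_prop)) hv
  obtain ⟨f, rfl⟩ := (Submodule.mem_iSup_iff_exists_dfinsupp' V w).1 hw
  have h1 : (f.sum fun i x => (x : H)) = ∑ i ∈ f.support, (V i).subtypeₗᵢ (f i) := by
    simp [DFinsupp.sum]
  have h2 : T (∑ i ∈ f.support, (V i).subtypeₗᵢ (f i)) =
      ∑ i ∈ f.support, (V i).subtypeₗᵢ (⟨T (f i), hT i _ (f i).2⟩) := by
    simp
  have h3 : ‖T (∑ i ∈ f.support, (V i).subtypeₗᵢ (f i))‖ ^ 2 ≤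
      (c * ‖∑ i ∈ f.support, (V i).subtypeₗᵢ (f i)‖) ^ 2 := by
    rw [h2, mul_pow, hV.norm_sum, hV.norm_sum, Finset.mul_sum]
    refine Finset.sum_le_sum fun i _ => ?_
    rw [← mul_pow]
    exact pow_le_pow_left₀ (norm_nonneg _) (hb i _ (f i).2) 2
  rw [Set.mem_ofPred_eq, h1]
  exact (pow_le_pow_iff_left₀ (norm_nonneg _) (by positivity) two_ne_zero).1 h3

/-- A block diagonal operator with finite-dimensional blocks tending to zero is compact. -/
theorem isCompactOperator_of_blocks [CompleteSpace H] [∀ i, FiniteDimensional ℝ (V i)]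
    (hV : OrthogonalFamily ℝ (fun i => V i) fun i => (V i).subtypeₗᵢ)
    (hd : (⨆ i, V i).topologicalClosure = ⊤) (T : H →L[ℝ] H)
    (hT : ∀ i, ∀ v ∈ V i, T v ∈ V i)
    (hb : ∀ c > 0, ∃ s : Finset ι, ∀ i ∉ s, ∀ v ∈ V i, ‖T v‖ ≤ c * ‖v‖) :
    IsCompactOperator T := by
  classical
  let U : Finset ι → Submodule ℝ H := fun s => ⨆ i ∈ s, V i
  have hU : ∀ s, FiniteDimensional ℝ (U s) := fun s => by
    have := Submodule.finiteDimensional_finset_sup s V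
    rwa [Finset.sup_eq_iSup] at this
  have hmem : ∀ s, ∀ i ∈ s, ∀ v ∈ V i, (U s).starProjection v = v := fun s i hi v hv =>
    Submodule.starProjection_eq_self_iff.2 (Submodule.mem_iSup_of_mem i
      (Submodule.mem_iSup_of_mem hi hv))
  have hnot : ∀ s, ∀ i ∉ s, ∀ v ∈ V i, (U s).starProjection v = 0 := fun s i hi v hv => by
    rw [Submodule.starProjection_apply_eq_zero_iff, Submodule.mem_orthogonal']
    intro u hu
    refine Submodule.iSup_induction (fun k : ι => ⨆ (_ : k ∈ s), V k)
      (motive := fun u => inner ℝ v u = 0) hu (fun k w hw => ?_) (inner_zero_right _) ?_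
    · by_cases hk : k ∈ s
      · simp only [hk, iSup_pos] at hw
        have hne : i ≠ k := fun h => hi (by rwa [h])
        exact hV hne ⟨v, hv⟩ ⟨w, hw⟩
      · simp only [hk, not_false_eq_true, iSup_neg, Submodule.mem_bot] at hw
        rw [hw, inner_zero_right]
    · intro x y hx hy
      rw [inner_add_right, hx, hy, add_zero]
  have hcl : T ∈ closure {A : H →L[ℝ] H | IsCompactOperator A} := by
    rw [Metric.mem_closure_iff]
    intro ε hε
    obtain ⟨s, hs⟩ := hb (ε / 2) (by positivity)
    refine ⟨T * (U s).starProjection, ?_, ?_⟩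
    · exact isCompactOperator_mul_left T (isCompactOperator_starProjection (U s))
    · rw [dist_eq_norm]
      refine lt_of_le_of_lt (opNorm_le_of_blocks hV hd _ (by positivity : 0 ≤ ε / 2)
        (fun i v hv => ?_) fun i v hv => ?_) (half_lt_self hε)
      · rw [sub_apply, mul_apply_eq_comp]
        by_cases hi : i ∈ s
        · rw [hmem s i hi v hv, sub_self]; exact zero_mem _
        · rw [hnot s i hi v hv, map_zero, sub_zero]; exact hT i v hv
      · rw [sub_apply, mul_apply_eq_comp]
        by_cases hi : i ∈ s
        · rw [hmem s i hi v hv, sub_self, norm_zero]; positivity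
        · rw [hnot s i hi v hv, map_zero, sub_zero]; exact hs i hi v hv
  exact isClosed_setOfPred_isCompactOperator.closure_subset_iff.2 subset_rfl hcl

end Blocks

section Model

/-- The unit sphere in `ℝ ^ (N + 1)`. -/
abbrev USphere (N : ℕ) : Type := Metric.sphere (0 : EuclideanSpace ℝ (Fin (N + 1))) 1

/-- A coordinate function on the sphere. -/
noncomputable def coordFun {N : ℕ} (i : Fin (N + 1)) : C(USphere N, ℝ) :=
  ⟨fun x => (x : EuclideanSpace ℝ (Fin (N + 1))) i, by fun_prop⟩

/-- Infinitesimal rotation on polynomial spinors. -/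
noncomputable def rotP {N : ℕ} (i j : Fin (N + 1)) : Module.End ℝ (PolySpinor N) :=
  xP i * dP j - xP j * dP i

/-- A Hilbert space of Clifford algebra valued functions on the sphere. -/
structure SpinorModel (N : ℕ) (H : Type*) [NormedAddCommGroup H] [InnerProductSpace ℝ H] where
  /-- Multiplication by continuous functions. -/
  mul : C(USphere N, ℝ) →ₐ[ℝ] (H →L[ℝ] H)
  /-- Left Clifford multiplications. -/
  E : Fin (N + 1) → H →L[ℝ] H
  /-- Right Clifford multiplications. -/
  G : Fin (N + 1) → H →L[ℝ] H
  /-- Restriction of polynomials to the sphere. -/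
  ψ : PolySpinor N →ₗ[ℝ] H
  continuous_mul : Continuous mul
  mul_symm (φ : C(USphere N, ℝ)) (u v : H) : inner ℝ (mul φ u) v = inner ℝ u (mul φ v)
  E_symm (i : Fin (N + 1)) (u v : H) : inner ℝ (E i u) v = inner ℝ u (E i v)
  G_symm (i : Fin (N + 1)) (u v : H) : inner ℝ (G i u) v = inner ℝ u (G i v)
  E_sq (i : Fin (N + 1)) : E i * E i = 1
  G_sq (i : Fin (N + 1)) : G i * G i = 1
  E_anticomm (i j : Fin (N + 1)) (h : i ≠ j) : E i * E j + E j * E i = 0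
  G_anticomm (i j : Fin (N + 1)) (h : i ≠ j) : G i * G j + G j * G i = 0
  commute_E_G (i j : Fin (N + 1)) : Commute (E i) (G j)
  commute_mul_E (φ : C(USphere N, ℝ)) (i : Fin (N + 1)) : Commute (mul φ) (E i)
  commute_mul_G (φ : C(USphere N, ℝ)) (i : Fin (N + 1)) : Commute (mul φ) (G i)
  ψ_xP (i : Fin (N + 1)) (f : PolySpinor N) : ψ (xP i f) = mul (coordFun i) (ψ f)
  ψ_eL (i : Fin (N + 1)) (f : PolySpinor N) : ψ (eL i f) = E i (ψ f)
  ψ_eR (i : Fin (N + 1)) (f : PolySpinor N) : ψ (eR i f) = G i (ψ f)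
  dense_ψ : DenseRange ψ
  inner_rotP (i j : Fin (N + 1)) (f g : PolySpinor N) :
    inner ℝ (ψ (rotP i j f)) (ψ g) = - inner ℝ (ψ f) (ψ (rotP i j g))
  /-- The total measure of the sphere. -/
  vol : ℝ
  vol_pos : 0 < vol
  inner_const (a b : Blade N → ℝ) :
    inner ℝ (ψ fun S => MvPolynomial.C (a S)) (ψ fun S => MvPolynomial.C (b S)) =
      vol * ∑ S, a S * b S

variable {N : ℕ} {H : Type*} [NormedAddCommGroup H] [InnerProductSpace ℝ H]

namespace SpinorModel

variable (𝓜 : SpinorModel N H)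

/-- Left Clifford multiplication by a vector-valued function. -/
noncomputable def clL (u : Fin (N + 1) → C(USphere N, ℝ)) : H →L[ℝ] H :=
  ∑ i, 𝓜.mul (u i) * 𝓜.E i

/-- Right Clifford multiplication by a vector-valued function. -/
noncomputable def cl (u : Fin (N + 1) → C(USphere N, ℝ)) : H →L[ℝ] H :=
  ∑ i, 𝓜.mul (u i) * 𝓜.G i

/-- Left Clifford multiplication by the position vector. -/
noncomputable def X : H →L[ℝ] H := 𝓜.clL coordFun

theorem commute_mul_mul (φ χ : C(USphere N, ℝ)) : Commute (𝓜.mul φ) (𝓜.mul χ) := by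
  rw [Commute, SemiconjBy, ← map_mul, ← map_mul, mul_comm]

theorem cl_mul_cl_add (u v : Fin (N + 1) → C(USphere N, ℝ)) :
    𝓜.cl u * 𝓜.cl v + 𝓜.cl v * 𝓜.cl u = (2 : ℝ) • 𝓜.mul (∑ i, u i * v i) := by
  have h : ∀ i j, 𝓜.mul (u i) * 𝓜.G i * (𝓜.mul (v j) * 𝓜.G j) +
      𝓜.mul (v j) * 𝓜.G j * (𝓜.mul (u i) * 𝓜.G i) =
      if i = j then (2 : ℝ) • 𝓜.mul (u i * v i) else 0 := fun i j => by
    rw [(𝓜.commute_mul_G (v j) i).symm.mul_mul_mul_comm,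
      (𝓜.commute_mul_G (u i) j).symm.mul_mul_mul_comm, (𝓜.commute_mul_mul (v j) (u i)).eq, ← mul_add]
    split_ifs with hij
    · subst hij
      rw [𝓜.G_sq, ← map_mul, two_smul, mul_add, mul_one]
    · rw [𝓜.G_anticomm i j hij, mul_zero]
  rw [cl, cl, Finset.sum_mul_sum, Finset.sum_mul_sum, Finset.sum_comm (γ := Fin (N + 1)),
    ← Finset.sum_add_distrib]
  simp only [← Finset.sum_add_distrib]
  rw [Finset.sum_comm]
  simp only [h]
  simp [Finset.smul_sum]

theorem clL_mul_clL_add (u v : Fin (N + 1) → C(USphere N, ℝ)) :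
    𝓜.clL u * 𝓜.clL v + 𝓜.clL v * 𝓜.clL u = (2 : ℝ) • 𝓜.mul (∑ i, u i * v i) := by
  have h : ∀ i j, 𝓜.mul (u i) * 𝓜.E i * (𝓜.mul (v j) * 𝓜.E j) +
      𝓜.mul (v j) * 𝓜.E j * (𝓜.mul (u i) * 𝓜.E i) =
      if i = j then (2 : ℝ) • 𝓜.mul (u i * v i) else 0 := fun i j => by
    rw [(𝓜.commute_mul_E (v j) i).symm.mul_mul_mul_comm,
      (𝓜.commute_mul_E (u i) j).symm.mul_mul_mul_comm, (𝓜.commute_mul_mul (v j) (u i)).eq, ← mul_add]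
    split_ifs with hij
    · subst hij
      rw [𝓜.E_sq, ← map_mul, two_smul, mul_add, mul_one]
    · rw [𝓜.E_anticomm i j hij, mul_zero]
  rw [clL, clL, Finset.sum_mul_sum, Finset.sum_mul_sum, Finset.sum_comm (γ := Fin (N + 1)),
    ← Finset.sum_add_distrib]
  simp only [← Finset.sum_add_distrib]
  rw [Finset.sum_comm]
  simp only [h]
  simp [Finset.smul_sum]

theorem commute_mul_cl (φ : C(USphere N, ℝ)) (u : Fin (N + 1) → C(USphere N, ℝ)) :
    Commute (𝓜.mul φ) (𝓜.cl u) :=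
  Commute.sum_right _ _ _ fun _ _ => (𝓜.commute_mul_mul _ _).mul_right (𝓜.commute_mul_G _ _)

theorem commute_mul_clL (φ : C(USphere N, ℝ)) (u : Fin (N + 1) → C(USphere N, ℝ)) :
    Commute (𝓜.mul φ) (𝓜.clL u) :=
  Commute.sum_right _ _ _ fun _ _ => (𝓜.commute_mul_mul _ _).mul_right (𝓜.commute_mul_E _ _)

theorem commute_G_clL (j : Fin (N + 1)) (u : Fin (N + 1) → C(USphere N, ℝ)) :
    Commute (𝓜.G j) (𝓜.clL u) :=
  Commute.sum_right _ _ _ fun _ _ =>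
    ((𝓜.commute_mul_G _ _).symm).mul_right (𝓜.commute_E_G _ _).symm

theorem sum_coordFun_mul_self : ∑ i, coordFun i * coordFun i = (1 : C(USphere N, ℝ)) := by
  ext x
  have h := x.2
  rw [mem_sphere_zero_iff_norm] at h
  have h2 := EuclideanSpace.real_norm_sq_eq (x : EuclideanSpace ℝ (Fin (N + 1)))
  rw [h] at h2
  simp only [ContinuousMap.coe_sum, Finset.sum_apply, ContinuousMap.mul_apply,
    ContinuousMap.one_apply, coordFun, ContinuousMap.coe_mk]
  rw [one_pow] at h2
  exact (h2.trans (Finset.sum_congr rfl fun i _ => sq _)).symm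

theorem X_mul_X : 𝓜.X * 𝓜.X = 1 := by
  have h := 𝓜.clL_mul_clL_add coordFun coordFun
  rw [sum_coordFun_mul_self, map_one, ← two_smul ℝ] at h
  exact smul_right_injective _ (two_ne_zero (α := ℝ)) h

theorem X_X (v : H) : 𝓜.X (𝓜.X v) = v := by
  rw [← mul_apply_eq_comp, X_mul_X, one_apply_eq_self]

theorem cl_coordFun_mul_self : 𝓜.cl coordFun * 𝓜.cl coordFun = 1 := by
  have h := 𝓜.cl_mul_cl_add coordFun coordFun
  rw [sum_coordFun_mul_self, map_one, ← two_smul ℝ] at h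
  exact smul_right_injective _ (two_ne_zero (α := ℝ)) h

theorem clL_symm (w : Fin (N + 1) → C(USphere N, ℝ)) (u v : H) :
    inner ℝ (𝓜.clL w u) v = inner ℝ u (𝓜.clL w v) := by
  simp only [clL, sum_apply, sum_inner, inner_sum, mul_apply_eq_comp]
  refine Finset.sum_congr rfl fun i _ => ?_
  rw [𝓜.mul_symm, 𝓜.E_symm, ← mul_apply_eq_comp, ← mul_apply_eq_comp, (𝓜.commute_mul_E _ _).eq]

theorem cl_symm (w : Fin (N + 1) → C(USphere N, ℝ)) (u v : H) :
    inner ℝ (𝓜.cl w u) v = inner ℝ u (𝓜.cl w v) := by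
  simp only [cl, sum_apply, sum_inner, inner_sum, mul_apply_eq_comp]
  refine Finset.sum_congr rfl fun i _ => ?_
  rw [𝓜.mul_symm, 𝓜.G_symm, ← mul_apply_eq_comp, ← mul_apply_eq_comp, (𝓜.commute_mul_G _ _).eq]

theorem X_symm (u v : H) : inner ℝ (𝓜.X u) v = inner ℝ u (𝓜.X v) := 𝓜.clL_symm _ u v

theorem norm_X (v : H) : ‖𝓜.X v‖ = ‖v‖ := by
  rw [norm_eq_sqrt_real_inner, 𝓜.X_symm, X_X, ← norm_eq_sqrt_real_inner]

theorem norm_cl_coordFun (v : H) : ‖𝓜.cl coordFun v‖ = ‖v‖ := by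
  rw [norm_eq_sqrt_real_inner, 𝓜.cl_symm, ← mul_apply_eq_comp, cl_coordFun_mul_self,
    one_apply_eq_self, ← norm_eq_sqrt_real_inner]

theorem norm_E (i : Fin (N + 1)) (v : H) : ‖𝓜.E i v‖ = ‖v‖ := by
  rw [norm_eq_sqrt_real_inner, 𝓜.E_symm, ← mul_apply_eq_comp, 𝓜.E_sq,
    one_apply_eq_self, ← norm_eq_sqrt_real_inner]

theorem norm_G (i : Fin (N + 1)) (v : H) : ‖𝓜.G i v‖ = ‖v‖ := by
  rw [norm_eq_sqrt_real_inner, 𝓜.G_symm, ← mul_apply_eq_comp, 𝓜.G_sq,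
    one_apply_eq_self, ← norm_eq_sqrt_real_inner]

theorem ψ_vecX (f : PolySpinor N) : 𝓜.ψ (vecX f) = 𝓜.X (𝓜.ψ f) := by
  rw [vecX, LinearMap.sum_apply, map_sum, X, clL, sum_apply]
  refine Finset.sum_congr rfl fun i _ => ?_
  rw [(𝓜.commute_mul_E _ _).eq, Module.End.mul_apply, 𝓜.ψ_eL, 𝓜.ψ_xP]
  rfl

/-- The tangential Dirac operator. -/
noncomputable def gammaP : Module.End ℝ (PolySpinor N) := vecX * dirac - euler

theorem two_smul_gammaP (hN : 4 ∣ N) :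
    (2 : ℝ) • (gammaP : Module.End ℝ (PolySpinor N)) = ∑ i, ∑ j, eL i * eL j * rotP i j := by
  have h1 : ∀ i j : Fin (N + 1), eL i * eL j * rotP i j = eL i * xP i * (eL j * dP j) +
      eL j * xP j * (eL i * dP i) - if i = j then (2 : Module.End ℝ (PolySpinor N)) * (xP j * dP i) else 0 :=
    fun i j => by
      have h2 := eL_clifford hN i j
      have h3 : eL i * xP i * (eL j * dP j) = eL i * eL j * (xP i * dP j) := by
        rw [mul_assoc, ← mul_assoc (xP i), ← eL_mul_xP]; simp only [mul_assoc]
      have h4 : eL j * xP j * (eL i * dP i) = eL j * eL i * (xP j * dP i) := by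
        rw [mul_assoc, ← mul_assoc (xP j), ← eL_mul_xP]; simp only [mul_assoc]
      have h5 : (if i = j then (2 : Module.End ℝ (PolySpinor N)) * (xP j * dP i) else 0) =
          (eL i * eL j + eL j * eL i) * (xP j * dP i) := by
        rw [h2]; split_ifs <;> simp
      rw [h3, h4, h5, rotP, mul_sub, add_mul]
      abel
  simp only [h1, Finset.sum_sub_distrib, Finset.sum_add_distrib]
  rw [Finset.sum_comm (f := fun i j => eL j * xP j * (eL i * dP i))]
  simp only [Finset.sum_ite_eq, Finset.mem_univ, if_true]
  rw [gammaP, vecX, dirac, euler, two_smul, Finset.sum_mul_sum, ← Finset.mul_sum, two_mul]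
  abel

theorem inner_gammaP (hN : 4 ∣ N) (f g : PolySpinor N) :
    inner ℝ (𝓜.ψ (gammaP f)) (𝓜.ψ g) = inner ℝ (𝓜.ψ f) (𝓜.ψ (gammaP g)) := by
  have hc : ∀ i j k : Fin (N + 1),
      (rotP i j * eL k : Module.End ℝ (PolySpinor N)) = eL k * rotP i j := fun i j k => by
    rw [rotP, sub_mul, mul_sub, mul_assoc, ← eL_mul_dP, ← mul_assoc, ← eL_mul_xP, mul_assoc,
      mul_assoc, ← eL_mul_dP, ← mul_assoc (xP j), ← eL_mul_xP, mul_assoc]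
  have key : ∀ i j, inner ℝ (𝓜.ψ ((eL i * eL j * rotP i j) f)) (𝓜.ψ g) =
      inner ℝ (𝓜.ψ f) (𝓜.ψ ((eL i * eL j * rotP i j) g)) := fun i j => by
    by_cases hij : i = j
    · subst hij
      have : (rotP i i : Module.End ℝ (PolySpinor N)) = 0 := sub_self _
      simp [this]
    · have h1 : inner ℝ (𝓜.ψ ((eL i * eL j * rotP i j) f)) (𝓜.ψ g) =
          inner ℝ (𝓜.ψ (rotP i j f)) (𝓜.ψ ((eL j * eL i) g)) := by
        simp only [Module.End.mul_apply, 𝓜.ψ_eL, 𝓜.E_symm]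
      have h2 : (eL j * eL i : Module.End ℝ (PolySpinor N)) = -(eL i * eL j) := by
        have := eL_clifford hN j i
        rw [if_neg (Ne.symm hij)] at this
        exact eq_neg_of_add_eq_zero_left this
      rw [h1, 𝓜.inner_rotP, ← Module.End.mul_apply, ← mul_assoc, hc, mul_assoc, hc, ← mul_assoc,
        h2, Module.End.mul_apply, LinearMap.neg_apply, Module.End.mul_apply (eL i * eL j), map_neg, inner_neg_right, neg_neg]
  have h2 : ∀ f : PolySpinor N, gammaP f =
      (2 : ℝ)⁻¹ • ∑ i, ∑ j, (eL i * eL j * rotP i j) f := fun f => by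
    have := congrArg (fun T : Module.End ℝ (PolySpinor N) => (2 : ℝ)⁻¹ • T f) (two_smul_gammaP hN)
    simpa using this
  simp only [h2, map_smul, map_sum, inner_smul_left, inner_smul_right, sum_inner, inner_sum, key]
  simp

theorem inner_eq_zero_of_gammaP (hN : 4 ∣ N) {f g : PolySpinor N} {a b : ℝ}
    (hf : gammaP f = a • f) (hg : gammaP g = b • g) (hab : a ≠ b) :
    inner ℝ (𝓜.ψ f) (𝓜.ψ g) = 0 := by
  have h := 𝓜.inner_gammaP hN f g
  rw [hf, hg, map_smul, map_smul, real_inner_smul_left, real_inner_smul_right] at h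
  have h2 : (a - b) * inner ℝ (𝓜.ψ f) (𝓜.ψ g) = 0 := by linarith
  exact (mul_eq_zero.1 h2).resolve_left (sub_ne_zero.2 hab)

theorem gammaP_monogenic {j : ℕ} {f : PolySpinor N} (hf : f ∈ monogenic N j) :
    gammaP f = (-(j : ℝ)) • f := by
  have h : dirac f = 0 := hf.2
  rw [gammaP, LinearMap.sub_apply, Module.End.mul_apply, h, map_zero, euler_apply hf.1]
  module

theorem gammaP_vecX (hN : 4 ∣ N) {j : ℕ} {f : PolySpinor N} (hf : f ∈ monogenic N j) :
    gammaP (vecX f) = (j + N : ℝ) • vecX f := by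
  rw [gammaP, LinearMap.sub_apply, Module.End.mul_apply, dirac_vecX hN hf, map_smul,
    euler_apply (vecX_mem_homogSpinor hf.1)]
  push_cast
  module

/-- The orthogonal blocks: monogenics and their products with the position vector. -/
noncomputable def block (p : ℕ × Bool) : Submodule ℝ H :=
  ((monogenic N p.1).map 𝓜.ψ).map
    (bif p.2 then (𝓜.X : H →ₗ[ℝ] H) else LinearMap.id)

theorem mem_block_false {j : ℕ} {v : H} :
    v ∈ 𝓜.block (j, false) ↔ ∃ f ∈ monogenic N j, 𝓜.ψ f = v := by
  simp [block]

theorem mem_block_true {j : ℕ} {v : H} :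
    v ∈ 𝓜.block (j, true) ↔ ∃ f ∈ monogenic N j, 𝓜.X (𝓜.ψ f) = v := by
  simp [block]

instance finiteDimensional_block (p : ℕ × Bool) : FiniteDimensional ℝ (𝓜.block p) := by
  unfold block; infer_instance

theorem block_orthogonal (hN : 4 ∣ N) (hN0 : 2 ≤ N) : OrthogonalFamily ℝ (fun p => 𝓜.block p)
    fun p => (𝓜.block p).subtypeₗᵢ := by
  have h : ∀ p, ∀ v ∈ 𝓜.block p, ∃ f : PolySpinor N, 𝓜.ψ f = v ∧
      gammaP f = (bif p.2 then (p.1 + N : ℝ) else -(p.1 : ℝ)) • f := by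
    rintro ⟨j, b⟩ v hv
    cases b
    · obtain ⟨f, hf, rfl⟩ := 𝓜.mem_block_false.1 hv
      exact ⟨f, rfl, gammaP_monogenic hf⟩
    · obtain ⟨f, hf, rfl⟩ := 𝓜.mem_block_true.1 hv
      exact ⟨vecX f, 𝓜.ψ_vecX f, gammaP_vecX hN hf⟩
  rintro p q hpq ⟨v, hv⟩ ⟨w, hw⟩
  obtain ⟨f, rfl, hf⟩ := h p v hv
  obtain ⟨g, rfl, hg⟩ := h q w hw
  refine 𝓜.inner_eq_zero_of_gammaP hN hf hg fun he => hpq ?_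
  obtain ⟨j, b⟩ := p
  obtain ⟨k, c⟩ := q
  have hN' : (0 : ℝ) < N := by exact_mod_cast (by omega : 0 < N)
  have hj : (0 : ℝ) ≤ j := Nat.cast_nonneg j
  have hk : (0 : ℝ) ≤ k := Nat.cast_nonneg k
  cases b <;> cases c <;> simp only [cond_true, cond_false, Prod.mk.injEq, and_true,
    reduceCtorEq, and_false] at he ⊢
  · have : (j : ℝ) = k := by linarith
    exact_mod_cast this
  · linarith
  · linarith
  · have : (j : ℝ) = k := by linarith
    exact_mod_cast this

end SpinorModel

end Model

namespace SpinorModel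

variable {N : ℕ} {H : Type*} [NormedAddCommGroup H] [InnerProductSpace ℝ H]
  (𝓜 : SpinorModel N H)

theorem mul_coordFun_ψ (j : ℕ) (i : Fin (N + 1)) (f : PolySpinor N) :
    𝓜.mul (coordFun i) (𝓜.ψ f) =
      𝓜.ψ (upperPart j i f) + 𝓜.X (𝓜.ψ (middlePart j i f)) + 𝓜.ψ (lowerPart j i f) := by
  rw [← 𝓜.ψ_xP, xP_eq j i f, map_add, map_add, 𝓜.ψ_vecX, 𝓜.ψ_vecX, 𝓜.ψ_vecX, X_X]

theorem mul_X_apply (φ : C(USphere N, ℝ)) (v : H) : 𝓜.mul φ (𝓜.X v) = 𝓜.X (𝓜.mul φ v) := by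
  rw [← mul_apply_eq_comp, X, (𝓜.commute_mul_clL _ _).eq, mul_apply_eq_comp]

theorem ψ_mem_block {j : ℕ} {f : PolySpinor N} (hf : f ∈ monogenic N j) :
    𝓜.ψ f ∈ 𝓜.block (j, false) := 𝓜.mem_block_false.2 ⟨f, hf, rfl⟩

theorem X_ψ_mem_block {j : ℕ} {f : PolySpinor N} (hf : f ∈ monogenic N j) :
    𝓜.X (𝓜.ψ f) ∈ 𝓜.block (j, true) := 𝓜.mem_block_true.2 ⟨f, hf, rfl⟩

theorem single_C_mem_monogenic (S : Blade N) (a : ℝ) :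
    (Pi.single S (MvPolynomial.C a) : PolySpinor N) ∈ monogenic N 0 := by
  have h : (Pi.single S (MvPolynomial.C a) : PolySpinor N) ∈ homogSpinor N 0 := by
    rw [mem_homogSpinor]
    intro T
    rcases eq_or_ne T S with rfl | hT
    · rw [Pi.single_eq_same]; exact MvPolynomial.isHomogeneous_C _ _
    · rw [Pi.single_eq_of_ne hT]; exact MvPolynomial.isHomogeneous_zero _ _ _
  refine ⟨h, ?_⟩
  change dirac _ = 0
  rw [dirac, LinearMap.sum_apply]
  refine Finset.sum_eq_zero fun i _ => ?_
  rw [Module.End.mul_apply, dP_eq_zero h, map_zero]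

theorem ψ_mem_iSup_block (hN : 4 ∣ N) (hN0 : 2 ≤ N) (f : PolySpinor N) :
    𝓜.ψ f ∈ ⨆ p, 𝓜.block p := by
  have h1 : ∀ i, ∀ v ∈ ⨆ p, 𝓜.block p, 𝓜.mul (coordFun i) v ∈ ⨆ p, 𝓜.block p := fun i v hv => by
    refine Submodule.iSup_induction (fun p => 𝓜.block p)
      (motive := fun v => 𝓜.mul (coordFun i) v ∈ ⨆ p, 𝓜.block p) hv ?_
      (by rw [map_zero]; exact zero_mem _) fun x y hx hy => by
        rw [map_add]; exact add_mem hx hy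
    rintro ⟨j, b⟩ v hv
    cases b
    · obtain ⟨f, hf, rfl⟩ := 𝓜.mem_block_false.1 hv
      rw [𝓜.mul_coordFun_ψ j]
      exact add_mem (add_mem
        (Submodule.mem_iSup_of_mem (j + 1, false) (𝓜.ψ_mem_block (upperPart_mem hN hN0 hf i)))
        (Submodule.mem_iSup_of_mem (j, true) (𝓜.X_ψ_mem_block (middlePart_mem hN hN0 hf i))))
        (Submodule.mem_iSup_of_mem (j - 1, false) (𝓜.ψ_mem_block (lowerPart_mem hf i)))
    · obtain ⟨f, hf, rfl⟩ := 𝓜.mem_block_true.1 hv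
      rw [𝓜.mul_X_apply, 𝓜.mul_coordFun_ψ j, map_add, map_add, X_X]
      exact add_mem (add_mem
        (Submodule.mem_iSup_of_mem (j + 1, true) (𝓜.X_ψ_mem_block (upperPart_mem hN hN0 hf i)))
        (Submodule.mem_iSup_of_mem (j, false) (𝓜.ψ_mem_block (middlePart_mem hN hN0 hf i))))
        (Submodule.mem_iSup_of_mem (j - 1, true) (𝓜.X_ψ_mem_block (lowerPart_mem hf i)))
  have h2 : ∀ (S : Blade N) (p : MvPolynomial (Fin (N + 1)) ℝ),
      𝓜.ψ (Pi.single S p) ∈ ⨆ p, 𝓜.block p := by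
    intro S p
    refine MvPolynomial.induction_on (motive := fun p => 𝓜.ψ (Pi.single S p) ∈ ⨆ p, 𝓜.block p) p
      (fun a => ?_) (fun p q hp hq => ?_) fun p i hp => ?_
    · exact Submodule.mem_iSup_of_mem (0, false) (𝓜.ψ_mem_block (single_C_mem_monogenic S a))
    · rw [Pi.single_add, map_add]
      exact add_mem hp hq
    · have : (Pi.single S (p * MvPolynomial.X i) : PolySpinor N) = xP i (Pi.single S p) := by
        funext T
        rw [xP_apply]
        rcases eq_or_ne T S with rfl | hT
        · rw [Pi.single_eq_same, Pi.single_eq_same, mul_comm]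
        · rw [Pi.single_eq_of_ne hT, Pi.single_eq_of_ne hT, mul_zero]
      rw [this, 𝓜.ψ_xP]
      exact h1 i _ hp
  rw [← Finset.univ_sum_single f, map_sum]
  exact Submodule.sum_mem _ fun S _ => h2 S _

theorem iSup_block_topologicalClosure (hN : 4 ∣ N) (hN0 : 2 ≤ N) :
    (⨆ p, 𝓜.block p).topologicalClosure = ⊤ := by
  rw [← Submodule.dense_iff_topologicalClosure_eq_top]
  refine 𝓜.dense_ψ.mono ?_
  rintro _ ⟨f, rfl⟩
  exact 𝓜.ψ_mem_iSup_block hN hN0 f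

theorem ext_block (hN : 4 ∣ N) (hN0 : 2 ≤ N) {A B : H →L[ℝ] H}
    (h : ∀ j, ∀ f ∈ monogenic N j, A (𝓜.ψ f) = B (𝓜.ψ f) ∧
      A (𝓜.X (𝓜.ψ f)) = B (𝓜.X (𝓜.ψ f))) : A = B := by
  have hd := 𝓜.iSup_block_topologicalClosure hN hN0
  rw [← Submodule.dense_iff_topologicalClosure_eq_top] at hd
  refine ContinuousLinearMap.ext fun v => congrFun (Continuous.ext_on hd A.continuous B.continuous
    fun v hv => ?_) v
  refine Submodule.iSup_induction (fun p => 𝓜.block p)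
    (motive := fun v => A v = B v) hv ?_ (by rw [map_zero, map_zero]) fun x y hx hy => by
      rw [map_add, map_add, hx, hy]
  rintro ⟨j, b⟩ v hv
  cases b
  · obtain ⟨f, hf, rfl⟩ := 𝓜.mem_block_false.1 hv
    exact (h j f hf).1
  · obtain ⟨f, hf, rfl⟩ := 𝓜.mem_block_true.1 hv
    exact (h j f hf).2

/-- The closed span of the monogenics. -/
noncomputable def hardy : Submodule ℝ H := (⨆ j, 𝓜.block (j, false)).topologicalClosure

theorem commute_G_X (i : Fin (N + 1)) : Commute (𝓜.G i) 𝓜.X := 𝓜.commute_G_clL _ _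

variable [CompleteSpace H]

instance : CompleteSpace 𝓜.hardy :=
  (Submodule.isClosed_topologicalClosure _).completeSpace_coe

/-- Reflection in the closed span of the monogenics. -/
noncomputable def F : H →L[ℝ] H := (2 : ℝ) • 𝓜.hardy.starProjection - 1

theorem F_mul_F : 𝓜.F * 𝓜.F = 1 := by
  have h : 𝓜.hardy.starProjection * 𝓜.hardy.starProjection = 𝓜.hardy.starProjection :=
    𝓜.hardy.isIdempotentElem_starProjection
  rw [F, sub_mul, mul_sub, smul_mul_smul_comm, h, one_mul, mul_one]
  module

theorem F_symm (u v : H) : inner ℝ (𝓜.F u) v = inner ℝ u (𝓜.F v) := by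
  have := 𝓜.hardy.inner_starProjection_left_eq_right u v
  simp only [F, sub_apply, smul_apply, one_apply_eq_self, inner_sub_left, inner_sub_right,
    real_inner_smul_left, real_inner_smul_right, this]

theorem F_ψ {j : ℕ} {f : PolySpinor N} (hf : f ∈ monogenic N j) : 𝓜.F (𝓜.ψ f) = 𝓜.ψ f := by
  have h : 𝓜.hardy.starProjection (𝓜.ψ f) = 𝓜.ψ f :=
    Submodule.starProjection_eq_self_iff.2 (Submodule.le_topologicalClosure _
      (Submodule.mem_iSup_of_mem j (𝓜.ψ_mem_block hf)))
  rw [F, sub_apply, smul_apply, h, one_apply_eq_self]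
  module

theorem F_X_ψ (hN : 4 ∣ N) (hN0 : 2 ≤ N) {j : ℕ} {f : PolySpinor N} (hf : f ∈ monogenic N j) :
    𝓜.F (𝓜.X (𝓜.ψ f)) = -𝓜.X (𝓜.ψ f) := by
  have h : 𝓜.hardy.starProjection (𝓜.X (𝓜.ψ f)) = 0 := by
    rw [Submodule.starProjection_apply_eq_zero_iff, hardy, Submodule.orthogonal_closure,
      Submodule.mem_orthogonal']
    intro u hu
    refine Submodule.iSup_induction (fun j => 𝓜.block (j, false))
      (motive := fun u => inner ℝ (𝓜.X (𝓜.ψ f)) u = 0) hu (fun k w hw => ?_)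
      (inner_zero_right _) fun x y hx hy => by rw [inner_add_right, hx, hy, add_zero]
    have hne : ((j, true) : ℕ × Bool) ≠ (k, false) := by simp
    exact 𝓜.block_orthogonal hN hN0 hne ⟨_, 𝓜.X_ψ_mem_block hf⟩ ⟨w, hw⟩
  rw [F, sub_apply, smul_apply, h, one_apply_eq_self, smul_zero, zero_sub]

theorem F_mul_X (hN : 4 ∣ N) (hN0 : 2 ≤ N) : 𝓜.F * 𝓜.X = -(𝓜.X * 𝓜.F) := by
  refine 𝓜.ext_block hN hN0 fun j f hf => ?_
  rw [mul_apply_eq_comp, mul_apply_eq_comp, neg_apply, neg_apply, mul_apply_eq_comp,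
    mul_apply_eq_comp, 𝓜.F_X_ψ hN hN0 hf, X_X, 𝓜.F_ψ hf, map_neg, X_X, neg_neg]
  exact ⟨rfl, rfl⟩

theorem commute_G_F (hN : 4 ∣ N) (hN0 : 2 ≤ N) (i : Fin (N + 1)) : Commute (𝓜.G i) 𝓜.F := by
  refine 𝓜.ext_block hN hN0 fun j f hf => ?_
  have h := eR_mem_monogenic hf i
  have h2 : 𝓜.G i (𝓜.X (𝓜.ψ f)) = 𝓜.X (𝓜.G i (𝓜.ψ f)) := by
    rw [← mul_apply_eq_comp, (𝓜.commute_G_X i).eq, mul_apply_eq_comp]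
  rw [mul_apply_eq_comp, mul_apply_eq_comp, mul_apply_eq_comp, mul_apply_eq_comp,
    𝓜.F_X_ψ hN hN0 hf, 𝓜.F_ψ hf, map_neg, h2, ← 𝓜.ψ_eR, 𝓜.F_ψ h, 𝓜.F_X_ψ hN hN0 h]
  exact ⟨rfl, rfl⟩

/-- The compact part of an operator with respect to the reflection. -/
noncomputable def defect (A : H →L[ℝ] H) : H →L[ℝ] H :=
  (1 / 2 : ℝ) • (𝓜.X * (A - 𝓜.F * A * 𝓜.F))

/-- If `A` maps a monogenic to a monogenic part plus `X` times a monogenic `g`, then the defect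
maps it to `g`. -/
theorem defect_ψ (hN : 4 ∣ N) (hN0 : 2 ≤ N) {A : H →L[ℝ] H} {i j k l : ℕ}
    {f p q r : PolySpinor N} (hf : f ∈ monogenic N j) (hp : p ∈ monogenic N k)
    (hq : q ∈ monogenic N i)
    (hr : r ∈ monogenic N l) (h : A (𝓜.ψ f) = 𝓜.ψ p + 𝓜.X (𝓜.ψ q) + 𝓜.ψ r) :
    𝓜.defect A (𝓜.ψ f) = 𝓜.ψ q := by
  rw [defect, smul_apply, mul_apply_eq_comp, sub_apply, mul_apply_eq_comp, mul_apply_eq_comp,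
    𝓜.F_ψ hf, h, map_add, map_add, 𝓜.F_ψ hp, 𝓜.F_ψ hr, 𝓜.F_X_ψ hN hN0 hq]
  simp only [map_add, map_sub, map_neg, X_X]
  module

theorem defect_mul_X (hN : 4 ∣ N) (hN0 : 2 ≤ N) {A : H →L[ℝ] H} (hA : Commute A 𝓜.X) :
    𝓜.defect A * 𝓜.X = 𝓜.X * 𝓜.defect A := by
  have h := 𝓜.F_mul_X hN hN0
  have h1 : 𝓜.F * A * 𝓜.F * 𝓜.X = 𝓜.X * (𝓜.F * A * 𝓜.F) := by
    rw [mul_assoc, h, mul_neg, ← mul_assoc, mul_assoc _ A, hA.eq, ← mul_assoc, h, neg_mul, neg_mul,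
      neg_neg, mul_assoc, mul_assoc, mul_assoc]
  rw [defect, smul_mul_assoc, mul_smul_comm, mul_assoc, sub_mul, h1, hA.eq, ← mul_sub]

theorem defect_X_ψ (hN : 4 ∣ N) (hN0 : 2 ≤ N) {A : H →L[ℝ] H} (hA : Commute A 𝓜.X) (v : H) :
    𝓜.defect A (𝓜.X v) = 𝓜.X (𝓜.defect A v) := by
  rw [← mul_apply_eq_comp, 𝓜.defect_mul_X hN hN0 hA, mul_apply_eq_comp]

theorem norm_middlePart_le (hN : 4 ∣ N) (hN0 : 2 ≤ N) {j : ℕ} {f : PolySpinor N}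
    (hf : f ∈ monogenic N j) (i : Fin (N + 1)) :
    ‖𝓜.ψ (middlePart j i f)‖ ≤ (2 * j + (N + 1) : ℝ)⁻¹ * (1 + 2 * ‖𝓜.mul (coordFun i)‖) * ‖𝓜.ψ f‖ := by
  have hl : ‖𝓜.ψ (lowerPart j i f)‖ ≤ ‖𝓜.mul (coordFun i)‖ * ‖𝓜.ψ f‖ := by
    refine le_trans ?_ ((𝓜.mul (coordFun i)).le_opNorm _)
    rcases j with _ | j
    · rw [lowerPart_zero hf, map_zero, norm_zero]; positivity
    have h1 : inner ℝ (𝓜.ψ (lowerPart (j + 1) i f)) (𝓜.mul (coordFun i) (𝓜.ψ f)) =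
        ‖𝓜.ψ (lowerPart (j + 1) i f)‖ ^ 2 := by
      have hlm := 𝓜.ψ_mem_block (lowerPart_mem hf i)
      have hum := 𝓜.ψ_mem_block (upperPart_mem hN hN0 hf i)
      have hmm := 𝓜.X_ψ_mem_block (middlePart_mem hN hN0 hf i)
      have hne : ((j + 1 - 1, false) : ℕ × Bool) ≠ (j + 1 + 1, false) := by simp; omega
      have hne2 : ((j + 1 - 1, false) : ℕ × Bool) ≠ (j + 1, true) := by simp
      have e1 : inner ℝ (𝓜.ψ (lowerPart (j + 1) i f)) (𝓜.ψ (upperPart (j + 1) i f)) = 0 :=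
        𝓜.block_orthogonal hN hN0 hne ⟨_, hlm⟩ ⟨_, hum⟩
      have e2 : inner ℝ (𝓜.ψ (lowerPart (j + 1) i f)) (𝓜.X (𝓜.ψ (middlePart (j + 1) i f))) = 0 :=
        𝓜.block_orthogonal hN hN0 hne2 ⟨_, hlm⟩ ⟨_, hmm⟩
      rw [𝓜.mul_coordFun_ψ (j + 1), inner_add_right, inner_add_right, e1, e2,
        real_inner_self_eq_norm_sq]
      ring
    have h2 := real_inner_le_norm (𝓜.ψ (lowerPart (j + 1) i f)) (𝓜.mul (coordFun i) (𝓜.ψ f))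
    rw [h1, sq] at h2
    rcases eq_or_lt_of_le (norm_nonneg (𝓜.ψ (lowerPart (j + 1) i f))) with h3 | h3
    · rw [← h3]; positivity
    · exact le_of_mul_le_mul_left h2 h3
  have hpos := two_mul_add_pos N j
  rw [middlePart, map_smul, norm_smul, map_sub, map_smul, 𝓜.ψ_eL, 𝓜.ψ_vecX, norm_inv,
    Real.norm_of_nonneg hpos.le, mul_assoc]
  refine mul_le_mul_of_nonneg_left ?_ (by positivity)
  refine (norm_sub_le _ _).trans ?_
  rw [𝓜.norm_E, norm_smul, 𝓜.norm_X, Real.norm_of_nonneg zero_le_two]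
  linarith

theorem isCompactOperator_defect_mul_coordFun (hN : 4 ∣ N) (hN0 : 2 ≤ N) (i : Fin (N + 1)) :
    IsCompactOperator (𝓜.defect (𝓜.mul (coordFun i))) := by
  have hc : Commute (𝓜.mul (coordFun i)) 𝓜.X := 𝓜.commute_mul_clL _ _
  have hd : ∀ j, ∀ f ∈ monogenic N j, 𝓜.defect (𝓜.mul (coordFun i)) (𝓜.ψ f) =
      𝓜.ψ (middlePart j i f) := fun j f hf =>
    𝓜.defect_ψ hN hN0 hf (upperPart_mem hN hN0 hf i) (middlePart_mem hN hN0 hf i)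
      (lowerPart_mem hf i) (𝓜.mul_coordFun_ψ j i f)
  refine isCompactOperator_of_blocks (𝓜.block_orthogonal hN hN0)
    (𝓜.iSup_block_topologicalClosure hN hN0) _ ?_ fun c hc0 => ?_
  · rintro ⟨j, b⟩ v hv
    cases b
    · obtain ⟨f, hf, rfl⟩ := 𝓜.mem_block_false.1 hv
      rw [hd j f hf]
      exact 𝓜.ψ_mem_block (middlePart_mem hN hN0 hf i)
    · obtain ⟨f, hf, rfl⟩ := 𝓜.mem_block_true.1 hv
      rw [𝓜.defect_X_ψ hN hN0 hc, hd j f hf]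
      exact 𝓜.X_ψ_mem_block (middlePart_mem hN hN0 hf i)
  · obtain ⟨n, hn⟩ := exists_nat_gt ((1 + 2 * ‖𝓜.mul (coordFun i)‖) / c)
    have key : ∀ j, n ≤ j → ∀ f ∈ monogenic N j,
        ‖𝓜.ψ (middlePart j i f)‖ ≤ c * ‖𝓜.ψ f‖ := fun j hj f hf => by
      refine (𝓜.norm_middlePart_le hN hN0 hf i).trans
        (mul_le_mul_of_nonneg_right ?_ (norm_nonneg _))
      rw [inv_mul_le_iff₀ (two_mul_add_pos N j)]
      rw [div_lt_iff₀ hc0] at hn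
      have hj' : (n : ℝ) ≤ j := by exact_mod_cast hj
      have : (n : ℝ) ≤ 2 * j + (N + 1) := by
        have : (0 : ℝ) ≤ n := Nat.cast_nonneg n
        have : (0 : ℝ) ≤ N := Nat.cast_nonneg N
        linarith
      nlinarith
    refine ⟨Finset.range n ×ˢ Finset.univ, ?_⟩
    rintro ⟨j, b⟩ hp v hv
    have hj : n ≤ j := by
      simpa using hp
    cases b
    · obtain ⟨f, hf, rfl⟩ := 𝓜.mem_block_false.1 hv
      rw [hd j f hf]
      exact key j hj f hf
    · obtain ⟨f, hf, rfl⟩ := 𝓜.mem_block_true.1 hv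
      rw [𝓜.defect_X_ψ hN hN0 hc, hd j f hf, 𝓜.norm_X, 𝓜.norm_X]
      exact key j hj f hf

theorem isCompactOperator_of_defect {A : H →L[ℝ] H} (h : IsCompactOperator (𝓜.defect A)) :
    IsCompactOperator (𝓜.F * A * 𝓜.F - A) := by
  have : 𝓜.F * A * 𝓜.F - A = (-2 : ℝ) • 𝓜.X * 𝓜.defect A := by
    rw [defect, smul_mul_smul_comm, ← mul_assoc, X_mul_X, one_mul]
    module
  rw [this]
  exact isCompactOperator_mul_left _ h

/-- The algebra of operators commuting with `X` and commuting with `F` modulo compacts. -/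
noncomputable def alg : Subalgebra ℝ (H →L[ℝ] H) := symbolAlgebra 𝓜.X 𝓜.F 𝓜.F_mul_F

theorem mul_mem_alg (hN : 4 ∣ N) (hN0 : 2 ≤ N) (φ : C(USphere N, ℝ)) : 𝓜.mul φ ∈ 𝓜.alg := by
  let B : Subalgebra ℝ C(USphere N, ℝ) := Algebra.adjoin ℝ (Set.range coordFun)
  have hB : B.topologicalClosure = ⊤ := by
    refine ContinuousMap.subalgebra_topologicalClosure_eq_top_of_separatesPoints B ?_
    intro x y hxy
    by_contra! hcon
    refine hxy (Subtype.ext (PiLp.ext fun i => ?_))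
    exact hcon _ ⟨coordFun i, Algebra.subset_adjoin ⟨i, rfl⟩, rfl⟩
  have hle : B ≤ 𝓜.alg.comap 𝓜.mul := Algebra.adjoin_le (by
    rintro _ ⟨i, rfl⟩
    exact ⟨𝓜.commute_mul_clL _ _,
      𝓜.isCompactOperator_of_defect (𝓜.isCompactOperator_defect_mul_coordFun hN hN0 i)⟩)
  have hcl : IsClosed ((𝓜.alg.comap 𝓜.mul : Subalgebra ℝ C(USphere N, ℝ)) :
      Set C(USphere N, ℝ)) :=
    (isClosed_symbolAlgebra (X := 𝓜.X) 𝓜.F 𝓜.F_mul_F).preimage 𝓜.continuous_mul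
  have := Subalgebra.topologicalClosure_minimal hle hcl
  rw [hB] at this
  exact this trivial

theorem G_mem_alg (hN : 4 ∣ N) (hN0 : 2 ≤ N) (i : Fin (N + 1)) : 𝓜.G i ∈ 𝓜.alg := by
  refine ⟨𝓜.commute_G_X i, ?_⟩
  rw [← (𝓜.commute_G_F hN hN0 i).eq, mul_assoc, F_mul_F, mul_one, sub_self]
  exact isCompactOperator_zero

theorem cl_mem_alg (hN : 4 ∣ N) (hN0 : 2 ≤ N) (u : Fin (N + 1) → C(USphere N, ℝ)) :
    𝓜.cl u ∈ 𝓜.alg :=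
  Subalgebra.sum_mem _ fun i _ =>
    Subalgebra.mul_mem _ (𝓜.mul_mem_alg hN hN0 _) (𝓜.G_mem_alg hN hN0 i)

end SpinorModel

namespace SpinorModel

variable {N : ℕ} {H : Type*} [NormedAddCommGroup H] [InnerProductSpace ℝ H]
  (𝓜 : SpinorModel N H)

theorem real_bound_of_monogenic {N q s r c : ℝ} (hN : 0 ≤ N) (hs : 0 ≤ s) (_hr : 0 ≤ r)
    (hq : 0 ≤ q) (hc : N + 3 ≤ c) (h1 : c * q ≤ (N + 1) * s + 2 * r) (h2 : q ^ 2 + r ^ 2 ≤ s ^ 2) :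
    q ≤ (1 - 1 / (N + 3) ^ 2) * s := by
  have hM : 0 < N + 3 := by linarith
  by_contra! hcon
  have e : (1 - 1 / (N + 3) ^ 2) * s * (N + 3) ^ 2 = ((N + 3) ^ 2 - 1) * s := by
    field_simp
  have hcon2 : ((N + 3) ^ 2 - 1) * s < q * (N + 3) ^ 2 := by
    rw [← e]; exact mul_lt_mul_of_pos_right hcon (by positivity)
  have h3 : (N + 3) * q ≤ (N + 1) * s + 2 * r :=
    (mul_le_mul_of_nonneg_right hc hq).trans h1
  have hqs : q ≤ s := by nlinarith
  have h5 : (2 * (N + 3) - 1) * s < 2 * r * (N + 3) := by nlinarith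
  have hr2 : r ^ 2 * (N + 3) ^ 2 ≤ 2 * s ^ 2 := by
    have h6 : r ^ 2 ≤ (s - q) * (s + q) := by nlinarith
    have h7 : (s - q) * (N + 3) ^ 2 ≤ s := by nlinarith
    calc r ^ 2 * (N + 3) ^ 2 ≤ (s - q) * (s + q) * (N + 3) ^ 2 := by gcongr
      _ = ((s - q) * (N + 3) ^ 2) * (s + q) := by ring
      _ ≤ s * (s + q) := by gcongr
      _ ≤ s * (s + s) := by gcongr
      _ = 2 * s ^ 2 := by ring
  have h8 : 5 * s < 2 * r * (N + 3) := by nlinarith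
  have h9 : (5 * s) ^ 2 < (2 * r * (N + 3)) ^ 2 := pow_lt_pow_left₀ h8 (by positivity) two_ne_zero
  nlinarith [sq_nonneg s]

/-- Component of the right product of a monogenic with the position vector. -/
noncomputable def rightUpper (j : ℕ) (f : PolySpinor N) : PolySpinor N :=
  ∑ i, upperPart j i (eR i f)

/-- Component of the right product of a monogenic with the position vector. -/
noncomputable def rightMiddle (j : ℕ) (f : PolySpinor N) : PolySpinor N :=
  ∑ i, middlePart j i (eR i f)

/-- Component of the right product of a monogenic with the position vector. -/
noncomputable def rightLower (j : ℕ) (f : PolySpinor N) : PolySpinor N :=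
  ∑ i, lowerPart j i (eR i f)

section

variable {j : ℕ} {f : PolySpinor N}

theorem rightUpper_mem (hN : 4 ∣ N) (hN0 : 2 ≤ N) (hf : f ∈ monogenic N j) :
    rightUpper j f ∈ monogenic N (j + 1) :=
  Submodule.sum_mem _ fun i _ => upperPart_mem hN hN0 (eR_mem_monogenic hf i) i

theorem rightMiddle_mem (hN : 4 ∣ N) (hN0 : 2 ≤ N) (hf : f ∈ monogenic N j) :
    rightMiddle j f ∈ monogenic N j :=
  Submodule.sum_mem _ fun i _ => middlePart_mem hN hN0 (eR_mem_monogenic hf i) i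

theorem rightLower_mem (hf : f ∈ monogenic N j) : rightLower j f ∈ monogenic N (j - 1) :=
  Submodule.sum_mem _ fun i _ => lowerPart_mem (eR_mem_monogenic hf i) i

theorem cl_coordFun_ψ (j : ℕ) (f : PolySpinor N) :
    𝓜.cl coordFun (𝓜.ψ f) =
      𝓜.ψ (rightUpper j f) + 𝓜.X (𝓜.ψ (rightMiddle j f)) + 𝓜.ψ (rightLower j f) := by
  rw [cl, sum_apply, rightUpper, rightMiddle, rightLower, map_sum, map_sum, map_sum, map_sum,
    ← Finset.sum_add_distrib, ← Finset.sum_add_distrib]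
  refine Finset.sum_congr rfl fun i _ => ?_
  rw [mul_apply_eq_comp, ← 𝓜.ψ_eR, 𝓜.mul_coordFun_ψ j]

theorem smul_rightMiddle (j : ℕ) (f : PolySpinor N) :
    (2 * j + (N + 1) : ℝ) • rightMiddle j f =
      ∑ i, eL i (eR i f) - (2 : ℝ) • vecX (rightLower j f) := by
  rw [rightMiddle, Finset.smul_sum, rightLower, map_sum, Finset.smul_sum, ← Finset.sum_sub_distrib]
  refine Finset.sum_congr rfl fun i _ => ?_
  rw [middlePart, smul_smul, mul_inv_cancel₀ (two_mul_add_pos N j).ne', one_smul]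

theorem norm_sq_ψ (hN : 4 ∣ N) (hN0 : 2 ≤ N) (hf : f ∈ monogenic N j) :
    ‖𝓜.ψ f‖ ^ 2 = ‖𝓜.ψ (rightUpper j f)‖ ^ 2 + ‖𝓜.ψ (rightMiddle j f)‖ ^ 2 +
      ‖𝓜.ψ (rightLower j f)‖ ^ 2 := by
  have hu := 𝓜.ψ_mem_block (rightUpper_mem hN hN0 hf)
  have hm := 𝓜.X_ψ_mem_block (rightMiddle_mem hN hN0 hf)
  have hl := 𝓜.ψ_mem_block (rightLower_mem hf)
  have n1 : ((j + 1, false) : ℕ × Bool) ≠ (j, true) := by simp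
  have n2 : ((j + 1, false) : ℕ × Bool) ≠ (j - 1, false) := by simp; omega
  have n3 : ((j, true) : ℕ × Bool) ≠ (j - 1, false) := by simp
  have e1 : inner ℝ (𝓜.ψ (rightUpper j f)) (𝓜.X (𝓜.ψ (rightMiddle j f))) = 0 :=
    𝓜.block_orthogonal hN hN0 n1 ⟨_, hu⟩ ⟨_, hm⟩
  have e2 : inner ℝ (𝓜.ψ (rightUpper j f)) (𝓜.ψ (rightLower j f)) = 0 :=
    𝓜.block_orthogonal hN hN0 n2 ⟨_, hu⟩ ⟨_, hl⟩
  have e3 : inner ℝ (𝓜.X (𝓜.ψ (rightMiddle j f))) (𝓜.ψ (rightLower j f)) = 0 :=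
    𝓜.block_orthogonal hN hN0 n3 ⟨_, hm⟩ ⟨_, hl⟩
  rw [← 𝓜.norm_cl_coordFun, 𝓜.cl_coordFun_ψ j, norm_add_sq_real, norm_add_sq_real, inner_add_left,
    e1, e2, e3, 𝓜.norm_X]
  ring

theorem norm_rightMiddle_le (hN : 4 ∣ N) (hN0 : 2 ≤ N) (hf : f ∈ monogenic N j) (hj : j ≠ 0) :
    ‖𝓜.ψ (rightMiddle j f)‖ ≤ (1 - 1 / ((N : ℝ) + 3) ^ 2) * ‖𝓜.ψ f‖ := by
  have hj1 : (1 : ℝ) ≤ j := by exact_mod_cast Nat.one_le_iff_ne_zero.2 hj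
  refine real_bound_of_monogenic (c := 2 * j + (N + 1)) (r := ‖𝓜.ψ (rightLower j f)‖)
    (Nat.cast_nonneg N) (norm_nonneg _) (norm_nonneg _)
    (norm_nonneg _) (by linarith) ?_ ?_
  · have h := congrArg (fun g => ‖𝓜.ψ g‖) (smul_rightMiddle j f)
    simp only [map_smul, map_sub, map_sum, 𝓜.ψ_vecX, 𝓜.ψ_eL, 𝓜.ψ_eR] at h
    rw [norm_smul, Real.norm_of_nonneg (two_mul_add_pos N j).le] at h
    rw [h]
    refine (norm_sub_le _ _).trans (add_le_add ?_ ?_)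
    · refine (norm_sum_le _ _).trans ?_
      simp [𝓜.norm_E, 𝓜.norm_G]
    · rw [norm_smul, 𝓜.norm_X, Real.norm_of_nonneg zero_le_two]
  · rw [𝓜.norm_sq_ψ hN hN0 hf]
    nlinarith [sq_nonneg ‖𝓜.ψ (rightUpper j f)‖]

end

/-- Constant spinors. -/
noncomputable def constSpinor (a : Blade N → ℝ) : PolySpinor N := fun S => MvPolynomial.C (a S)

theorem constSpinor_mem_monogenic (a : Blade N → ℝ) : constSpinor a ∈ monogenic N 0 := by
  rw [← Finset.univ_sum_single (constSpinor a)]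
  exact Submodule.sum_mem _ fun S _ => single_C_mem_monogenic S (a S)

theorem exists_constSpinor {f : PolySpinor N} (hf : f ∈ monogenic N 0) :
    ∃ a, f = constSpinor a := by
  have h := mem_homogSpinor.1 hf.1
  refine ⟨fun S => MvPolynomial.coeff 0 (f S), funext fun S => ?_⟩
  have h2 := h S
  rw [← MvPolynomial.totalDegree_zero_iff_isHomogeneous,
    MvPolynomial.totalDegree_eq_zero_iff_eq_C] at h2
  exact h2

theorem rightLower_zero {f : PolySpinor N} (hf : f ∈ monogenic N 0) : rightLower 0 f = 0 :=
  Finset.sum_eq_zero fun i _ => lowerPart_zero (eR_mem_monogenic hf i) i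

theorem rightMiddle_constSpinor (hN : 4 ∣ N) (a : Blade N → ℝ) :
    rightMiddle 0 (constSpinor a) =
      constSpinor fun S => (N + 1 : ℝ)⁻¹ * bladeEigenvalue S * a S := by
  have h := smul_rightMiddle 0 (constSpinor a)
  rw [rightLower_zero (constSpinor_mem_monogenic a), map_zero, smul_zero, sub_zero, Nat.cast_zero,
    mul_zero, zero_add] at h
  have h0 : (N + 1 : ℝ) ≠ 0 := by positivity
  rw [← inv_smul_smul₀ h0 (rightMiddle 0 (constSpinor a)), h]
  funext S
  have h2 := sum_genL_genR hN (constSpinor a) S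
  have h3 : (∑ i, eL i (eR i (constSpinor a)) : PolySpinor N) S =
      bladeEigenvalue S • constSpinor a S := h2
  rw [Pi.smul_apply, h3, constSpinor, constSpinor, smul_smul, MvPolynomial.smul_eq_C_mul,
    ← MvPolynomial.C_mul]

/-- The constant function one. -/
noncomputable def one : H := 𝓜.ψ (constSpinor (Pi.single 0 1))

theorem rightMiddle_one (hN : 4 ∣ N) :
    rightMiddle 0 (constSpinor (Pi.single 0 1) : PolySpinor N) = constSpinor (Pi.single 0 1) := by
  rw [rightMiddle_constSpinor hN]
  congr 1
  funext S
  rcases eq_or_ne S 0 with rfl | hS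
  · have h0 : (N + 1 : ℝ) ≠ 0 := by positivity
    rw [Pi.single_eq_same, bladeEigenvalue_zero, mul_one, inv_mul_cancel₀ h0]
  · rw [Pi.single_eq_of_ne hS, mul_zero]

theorem cl_coordFun_one (hN : 4 ∣ N) (hN0 : 2 ≤ N) : 𝓜.cl coordFun 𝓜.one = 𝓜.X 𝓜.one := by
  have hf := constSpinor_mem_monogenic (N := N) (Pi.single 0 1)
  have h := 𝓜.norm_sq_ψ hN hN0 hf
  rw [rightMiddle_one hN, rightLower_zero hf, map_zero, norm_zero] at h
  have h2 : ‖𝓜.ψ (rightUpper 0 (constSpinor (Pi.single 0 1)))‖ ^ 2 = 0 := by linarith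
  rw [sq_eq_zero_iff, norm_eq_zero] at h2
  rw [one, 𝓜.cl_coordFun_ψ 0, h2, rightMiddle_one hN, rightLower_zero hf, map_zero, zero_add,
    add_zero]

theorem one_ne_zero : 𝓜.one ≠ 0 := by
  intro h
  have h2 := 𝓜.inner_const (Pi.single 0 1) (Pi.single 0 1)
  change inner ℝ 𝓜.one 𝓜.one = _ at h2
  rw [h, inner_zero_left] at h2
  have := 𝓜.vol_pos
  simp [Pi.single_apply] at h2
  exact this.ne h2

end SpinorModel

theorem starProjection_mul_of_symm {H : Type*} [NormedAddCommGroup H] [InnerProductSpace ℝ H]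
    (U : Submodule ℝ H) [U.HasOrthogonalProjection] {A : H →L[ℝ] H}
    (hA : ∀ u v, inner ℝ (A u) v = inner ℝ u (A v)) (hU : ∀ v ∈ U, A v ∈ U) :
    U.starProjection * A = A * U.starProjection := by
  refine ContinuousLinearMap.ext fun v => ?_
  rw [mul_apply_eq_comp, mul_apply_eq_comp]
  refine Submodule.eq_starProjection_of_mem_of_inner_eq_zero
    (hU _ (Submodule.starProjection_apply_mem _ _)) fun w hw => ?_
  rw [← map_sub, hA]
  exact Submodule.starProjection_inner_eq_zero v _ (hU w hw)

namespace SpinorModel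

variable {N : ℕ} {H : Type*} [NormedAddCommGroup H] [InnerProductSpace ℝ H]
  (𝓜 : SpinorModel N H)

/-- The span of the constant one and the position vector. -/
noncomputable def vac : Submodule ℝ H := Submodule.span ℝ {𝓜.one, 𝓜.X 𝓜.one}

instance : FiniteDimensional ℝ 𝓜.vac := FiniteDimensional.span_of_finite ℝ (Set.toFinite _)

theorem one_mem_vac : 𝓜.one ∈ 𝓜.vac := Submodule.subset_span (by simp)

theorem X_one_mem_vac : 𝓜.X 𝓜.one ∈ 𝓜.vac := Submodule.subset_span (by simp)

theorem mem_vac {v : H} : v ∈ 𝓜.vac ↔ ∃ a b : ℝ, a • 𝓜.one + b • 𝓜.X 𝓜.one = v :=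
  Submodule.mem_span_pair

theorem X_mem_vac {v : H} (hv : v ∈ 𝓜.vac) : 𝓜.X v ∈ 𝓜.vac := by
  obtain ⟨a, b, rfl⟩ := 𝓜.mem_vac.1 hv
  rw [map_add, map_smul, map_smul, X_X]
  exact add_mem (Submodule.smul_mem _ _ 𝓜.X_one_mem_vac) (Submodule.smul_mem _ _ 𝓜.one_mem_vac)

theorem one_mem_block : 𝓜.one ∈ 𝓜.block (0, false) :=
  𝓜.ψ_mem_block (constSpinor_mem_monogenic _)

theorem X_one_mem_block : 𝓜.X 𝓜.one ∈ 𝓜.block (0, true) :=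
  𝓜.X_ψ_mem_block (constSpinor_mem_monogenic _)

/-- Projection to the span of the constant one and the position vector. -/
noncomputable def vacProj : H →L[ℝ] H := 𝓜.vac.starProjection

theorem vacProj_mul_X : 𝓜.vacProj * 𝓜.X = 𝓜.X * 𝓜.vacProj :=
  starProjection_mul_of_symm _ 𝓜.X_symm fun _ => 𝓜.X_mem_vac

theorem vacProj_ψ_of_ne_zero (hN : 4 ∣ N) (hN0 : 2 ≤ N) {j : ℕ} (hj : j ≠ 0) {f : PolySpinor N}
    (hf : f ∈ monogenic N j) : 𝓜.vacProj (𝓜.ψ f) = 0 := by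
  rw [vacProj, Submodule.starProjection_apply_eq_zero_iff, Submodule.mem_orthogonal']
  intro u hu
  obtain ⟨a, b, rfl⟩ := 𝓜.mem_vac.1 hu
  have n1 : ((j, false) : ℕ × Bool) ≠ (0, false) := by simp [hj]
  have n2 : ((j, false) : ℕ × Bool) ≠ (0, true) := by simp
  have e1 : inner ℝ (𝓜.ψ f) 𝓜.one = 0 :=
    𝓜.block_orthogonal hN hN0 n1 ⟨_, 𝓜.ψ_mem_block hf⟩ ⟨_, 𝓜.one_mem_block⟩
  have e2 : inner ℝ (𝓜.ψ f) (𝓜.X 𝓜.one) = 0 :=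
    𝓜.block_orthogonal hN hN0 n2 ⟨_, 𝓜.ψ_mem_block hf⟩ ⟨_, 𝓜.X_one_mem_block⟩
  rw [inner_add_right, real_inner_smul_right, real_inner_smul_right, e1, e2, mul_zero, mul_zero,
    add_zero]

theorem vacProj_constSpinor (hN : 4 ∣ N) (hN0 : 2 ≤ N) (a : Blade N → ℝ) :
    𝓜.vacProj (𝓜.ψ (constSpinor a)) = a 0 • 𝓜.one := by
  refine Submodule.eq_starProjection_of_mem_of_inner_eq_zero
    (Submodule.smul_mem _ _ 𝓜.one_mem_vac) fun w hw => ?_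
  obtain ⟨b, c, rfl⟩ := 𝓜.mem_vac.1 hw
  have n2 : ((0, false) : ℕ × Bool) ≠ (0, true) := by simp
  have e2 : inner ℝ (𝓜.ψ (constSpinor a)) (𝓜.X 𝓜.one) = 0 :=
    𝓜.block_orthogonal hN hN0 n2 ⟨_, 𝓜.ψ_mem_block (constSpinor_mem_monogenic a)⟩
      ⟨_, 𝓜.X_one_mem_block⟩
  have e3 : inner ℝ 𝓜.one (𝓜.X 𝓜.one) = 0 :=
    𝓜.block_orthogonal hN hN0 n2 ⟨_, 𝓜.one_mem_block⟩ ⟨_, 𝓜.X_one_mem_block⟩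
  have e4 : inner ℝ (𝓜.ψ (constSpinor a)) 𝓜.one = 𝓜.vol * a 0 := by
    refine (𝓜.inner_const a (Pi.single 0 1)).trans ?_
    simp [Pi.single_apply]
  have e5 : inner ℝ 𝓜.one 𝓜.one = 𝓜.vol := by
    refine (𝓜.inner_const (Pi.single 0 1) (Pi.single 0 1)).trans ?_
    simp [Pi.single_apply]
  rw [inner_sub_left, real_inner_smul_left, inner_add_right, inner_add_right,
    real_inner_smul_right, real_inner_smul_right, real_inner_smul_right, real_inner_smul_right,
    e2, e3, e4, e5]
  ring

theorem commute_cl_X (u : Fin (N + 1) → C(USphere N, ℝ)) : Commute (𝓜.cl u) 𝓜.X :=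
  Commute.sum_left _ _ _ fun _ _ => (𝓜.commute_mul_clL _ _).mul_left (𝓜.commute_G_X _)

theorem norm_ψ_constSpinor_sq (a : Blade N → ℝ) :
    ‖𝓜.ψ (constSpinor a)‖ ^ 2 = 𝓜.vol * ∑ S, a S * a S := by
  rw [← real_inner_self_eq_norm_sq]
  exact 𝓜.inner_const a a

variable [CompleteSpace H]

/-- The defect of right multiplication by the position vector. -/
noncomputable def baseDefect : H →L[ℝ] H := 𝓜.defect (𝓜.cl coordFun)

section

variable (hN : 4 ∣ N) (hN0 : 2 ≤ N)

include hN hN0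

theorem baseDefect_ψ {j : ℕ} {f : PolySpinor N} (hf : f ∈ monogenic N j) :
    𝓜.baseDefect (𝓜.ψ f) = 𝓜.ψ (rightMiddle j f) :=
  𝓜.defect_ψ hN hN0 hf (rightUpper_mem hN hN0 hf) (rightMiddle_mem hN hN0 hf)
    (rightLower_mem hf) (𝓜.cl_coordFun_ψ j f)

theorem baseDefect_X (v : H) : 𝓜.baseDefect (𝓜.X v) = 𝓜.X (𝓜.baseDefect v) :=
  𝓜.defect_X_ψ hN hN0 (𝓜.commute_cl_X _) v

theorem baseDefect_of_mem_vac {v : H} (hv : v ∈ 𝓜.vac) : 𝓜.baseDefect v = v := by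
  have h : 𝓜.baseDefect 𝓜.one = 𝓜.one := by
    rw [one, 𝓜.baseDefect_ψ hN hN0 (constSpinor_mem_monogenic _), rightMiddle_one hN]
  obtain ⟨a, b, rfl⟩ := 𝓜.mem_vac.1 hv
  rw [map_add, map_smul, map_smul, 𝓜.baseDefect_X hN hN0, h]

theorem defect_symm {A : H →L[ℝ] H} (hA : ∀ u v, inner ℝ (A u) v = inner ℝ u (A v))
    (hAX : Commute A 𝓜.X) (u v : H) :
    inner ℝ (𝓜.defect A u) v = inner ℝ u (𝓜.defect A v) := by
  have hB : A - 𝓜.F * A * 𝓜.F = (2 : ℝ) • (𝓜.X * 𝓜.defect A) := by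
    rw [defect, mul_smul_comm, smul_smul, ← mul_assoc, X_mul_X, one_mul]
    norm_num
  have hs : inner ℝ ((A - 𝓜.F * A * 𝓜.F) u) (𝓜.X v) = inner ℝ u ((A - 𝓜.F * A * 𝓜.F) (𝓜.X v)) := by
    simp only [sub_apply, mul_apply_eq_comp, inner_sub_left, inner_sub_right, 𝓜.F_symm, hA]
  have h2 : inner ℝ (𝓜.defect A u) v = (1 / 2 : ℝ) * inner ℝ ((A - 𝓜.F * A * 𝓜.F) u) (𝓜.X v) := by
    rw [defect, smul_apply, real_inner_smul_left, mul_apply_eq_comp, 𝓜.X_symm]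
  rw [h2, hs, hB, smul_apply, mul_apply_eq_comp, 𝓜.defect_X_ψ hN hN0 hAX, X_X,
    real_inner_smul_right]
  ring

theorem baseDefect_symm (u v : H) : inner ℝ (𝓜.baseDefect u) v = inner ℝ u (𝓜.baseDefect v) :=
  𝓜.defect_symm hN hN0 (𝓜.cl_symm _) (𝓜.commute_cl_X _) u v

theorem baseDefect_mul_vacProj : 𝓜.baseDefect * 𝓜.vacProj = 𝓜.vacProj :=
  ContinuousLinearMap.ext fun v => by
    rw [mul_apply_eq_comp]
    exact 𝓜.baseDefect_of_mem_vac hN hN0 (Submodule.starProjection_apply_mem _ _)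

theorem vacProj_mul_baseDefect : 𝓜.vacProj * 𝓜.baseDefect = 𝓜.vacProj := by
  have h : 𝓜.vacProj * 𝓜.baseDefect = 𝓜.baseDefect * 𝓜.vacProj :=
    starProjection_mul_of_symm _ (𝓜.baseDefect_symm hN hN0) fun v hv => by
      rwa [𝓜.baseDefect_of_mem_vac hN hN0 hv]
  rw [h, 𝓜.baseDefect_mul_vacProj hN hN0]

theorem even_part_of_mem_vac {v : H} (hv : v ∈ 𝓜.vac) :
    (𝓜.cl coordFun + 𝓜.F * 𝓜.cl coordFun * 𝓜.F) v = 0 := by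
  have hf := constSpinor_mem_monogenic (N := N) (Pi.single 0 1)
  have h1 : 𝓜.F 𝓜.one = 𝓜.one := 𝓜.F_ψ hf
  have h2 : 𝓜.F (𝓜.X 𝓜.one) = -𝓜.X 𝓜.one := 𝓜.F_X_ψ hN hN0 hf
  have h3 := 𝓜.cl_coordFun_one hN hN0
  have h4 : 𝓜.cl coordFun (𝓜.X 𝓜.one) = 𝓜.one := by
    rw [← mul_apply_eq_comp, (𝓜.commute_cl_X _).eq, mul_apply_eq_comp, h3, X_X]
  obtain ⟨a, b, rfl⟩ := 𝓜.mem_vac.1 hv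
  simp only [add_apply, mul_apply_eq_comp, map_add, map_smul, h1, h2, h3, h4, map_neg]
  module

theorem even_part_mul_vacProj :
    (𝓜.cl coordFun + 𝓜.F * 𝓜.cl coordFun * 𝓜.F) * 𝓜.vacProj = 0 :=
  ContinuousLinearMap.ext fun v => by
    rw [mul_apply_eq_comp]
    exact 𝓜.even_part_of_mem_vac hN hN0 (Submodule.starProjection_apply_mem _ _)

theorem vacProj_mul_even_part :
    𝓜.vacProj * (𝓜.cl coordFun + 𝓜.F * 𝓜.cl coordFun * 𝓜.F) = 0 := by
  have h : 𝓜.vacProj * (𝓜.cl coordFun + 𝓜.F * 𝓜.cl coordFun * 𝓜.F) =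
      (𝓜.cl coordFun + 𝓜.F * 𝓜.cl coordFun * 𝓜.F) * 𝓜.vacProj :=
    starProjection_mul_of_symm _ (fun u v => by
      simp only [add_apply, mul_apply_eq_comp, inner_add_left, inner_add_right, 𝓜.F_symm,
        𝓜.cl_symm]) fun v hv => by
      rw [𝓜.even_part_of_mem_vac hN hN0 hv]; exact zero_mem _
  rw [h, 𝓜.even_part_mul_vacProj hN hN0]

theorem norm_baseDefect_sq_sub_lt :
    ‖𝓜.baseDefect * 𝓜.baseDefect - 𝓜.vacProj‖ < 1 := by
  set κ : ℝ := 1 - 1 / ((N : ℝ) + 3) ^ 2 with hκ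
  have hN1 : (0 : ℝ) ≤ N := Nat.cast_nonneg N
  have hN2 : (2 : ℝ) ≤ N := by exact_mod_cast hN0
  have hκ1 : κ < 1 := by
    have : (0 : ℝ) < 1 / ((N : ℝ) + 3) ^ 2 := by positivity
    linarith
  have hκ0 : 0 ≤ κ := by
    have : 1 / ((N : ℝ) + 3) ^ 2 ≤ 1 := by
      rw [div_le_one (by positivity)]; nlinarith
    linarith
  have hfalse : ∀ j, ∀ f ∈ monogenic N j, ∃ g ∈ monogenic N j,
      (𝓜.baseDefect * 𝓜.baseDefect - 𝓜.vacProj) (𝓜.ψ f) = 𝓜.ψ g ∧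
        ‖𝓜.ψ g‖ ≤ κ * ‖𝓜.ψ f‖ := fun j f hf => by
    have hq := rightMiddle_mem hN hN0 hf
    rcases eq_or_ne j 0 with rfl | hj
    · obtain ⟨a, rfl⟩ := exists_constSpinor hf
      set b : Blade N → ℝ := fun S =>
        ((N + 1 : ℝ)⁻¹ * bladeEigenvalue S) ^ 2 * a S - (Pi.single 0 (a 0) : Blade N → ℝ) S with hb
      refine ⟨constSpinor b, constSpinor_mem_monogenic _, ?_, ?_⟩
      · rw [sub_apply, mul_apply_eq_comp, 𝓜.vacProj_constSpinor hN hN0, 𝓜.baseDefect_ψ hN hN0 hf,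
          rightMiddle_constSpinor hN, 𝓜.baseDefect_ψ hN hN0 (constSpinor_mem_monogenic _),
          rightMiddle_constSpinor hN, one, ← map_smul, ← map_sub]
        congr 1
        funext S
        simp only [Pi.sub_apply, Pi.smul_apply, constSpinor, hb, MvPolynomial.smul_eq_C_mul]
        rw [← MvPolynomial.C_mul, ← MvPolynomial.C_sub]
        congr 1
        simp only [Pi.single_apply]
        split_ifs <;> ring
      · have hbS : ∀ S, b S * b S ≤ κ ^ 2 * (a S * a S) := fun S => by
          rcases eq_or_ne S 0 with rfl | hS
          · have h0 : (N + 1 : ℝ) ≠ 0 := by positivity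
            simp only [hb, Pi.single_eq_same, bladeEigenvalue_zero, inv_mul_cancel₀ h0]
            have := mul_self_nonneg (a 0)
            nlinarith [mul_nonneg (sq_nonneg κ) this]
          · simp only [hb, Pi.single_eq_of_ne hS, sub_zero]
            have h1 := abs_bladeEigenvalue_le hN hS
            have h2 : |(N + 1 : ℝ)⁻¹ * bladeEigenvalue S| ≤ κ := by
              rw [abs_mul, abs_of_pos (by positivity : (0 : ℝ) < (N + 1 : ℝ)⁻¹)]
              rw [inv_mul_le_iff₀ (by positivity)]
              refine h1.trans ?_
              rw [hκ, mul_sub, mul_one, mul_one_div]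
              have : ((N : ℝ) + 1) / (N + 3) ^ 2 ≤ 2 := by
                rw [div_le_iff₀ (by positivity)]; nlinarith
              linarith
            have h3 : ((N + 1 : ℝ)⁻¹ * bladeEigenvalue S) ^ 2 ≤ κ ^ 2 := sq_le_sq' (by
              linarith [neg_le_of_abs_le h2]) (le_of_abs_le h2)
            have h4 : ((N + 1 : ℝ)⁻¹ * bladeEigenvalue S) ^ 2 ≤ 1 := by nlinarith
            have h5 : (((N + 1 : ℝ)⁻¹ * bladeEigenvalue S) ^ 2) ^ 2 ≤ κ ^ 2 := by
              nlinarith [sq_nonneg ((N + 1 : ℝ)⁻¹ * bladeEigenvalue S)]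
            calc _ = (((N + 1 : ℝ)⁻¹ * bladeEigenvalue S) ^ 2) ^ 2 * (a S * a S) := by ring
              _ ≤ _ := mul_le_mul_of_nonneg_right h5 (mul_self_nonneg _)
        refine (pow_le_pow_iff_left₀ (norm_nonneg _) (by positivity) two_ne_zero).1 ?_
        rw [mul_pow, 𝓜.norm_ψ_constSpinor_sq, 𝓜.norm_ψ_constSpinor_sq, mul_left_comm]
        refine mul_le_mul_of_nonneg_left ?_ 𝓜.vol_pos.le
        rw [Finset.mul_sum]
        exact Finset.sum_le_sum fun S _ => hbS S
    · refine ⟨_, rightMiddle_mem hN hN0 hq, ?_, ?_⟩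
      · rw [sub_apply, mul_apply_eq_comp, 𝓜.vacProj_ψ_of_ne_zero hN hN0 hj hf,
          𝓜.baseDefect_ψ hN hN0 hf, 𝓜.baseDefect_ψ hN hN0 hq, sub_zero]
      · refine (𝓜.norm_rightMiddle_le hN hN0 hq hj).trans ?_
        refine mul_le_mul_of_nonneg_left ?_ hκ0
        refine (𝓜.norm_rightMiddle_le hN hN0 hf hj).trans ?_
        exact mul_le_of_le_one_left (norm_nonneg _) hκ1.le
  have hX : ∀ v, (𝓜.baseDefect * 𝓜.baseDefect - 𝓜.vacProj) (𝓜.X v) =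
      𝓜.X ((𝓜.baseDefect * 𝓜.baseDefect - 𝓜.vacProj) v) := fun v => by
    rw [sub_apply, sub_apply, mul_apply_eq_comp, mul_apply_eq_comp, 𝓜.baseDefect_X hN hN0,
      𝓜.baseDefect_X hN hN0, ← mul_apply_eq_comp 𝓜.vacProj, 𝓜.vacProj_mul_X, mul_apply_eq_comp,
      map_sub]
  refine lt_of_le_of_lt (opNorm_le_of_blocks (𝓜.block_orthogonal hN hN0)
    (𝓜.iSup_block_topologicalClosure hN hN0) _ hκ0 ?_ ?_) hκ1
  · rintro ⟨j, b⟩ v hv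
    cases b
    · obtain ⟨f, hf, rfl⟩ := 𝓜.mem_block_false.1 hv
      obtain ⟨g, hg, h, -⟩ := hfalse j f hf
      rw [h]; exact 𝓜.ψ_mem_block hg
    · obtain ⟨f, hf, rfl⟩ := 𝓜.mem_block_true.1 hv
      obtain ⟨g, hg, h, -⟩ := hfalse j f hf
      rw [hX, h]; exact 𝓜.X_ψ_mem_block hg
  · rintro ⟨j, b⟩ v hv
    cases b
    · obtain ⟨f, hf, rfl⟩ := 𝓜.mem_block_false.1 hv
      obtain ⟨g, hg, h, h2⟩ := hfalse j f hf
      rw [h]; exact h2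
    · obtain ⟨f, hf, rfl⟩ := 𝓜.mem_block_true.1 hv
      obtain ⟨g, hg, h, h2⟩ := hfalse j f hf
      rw [hX, h, 𝓜.norm_X, 𝓜.norm_X]; exact h2

theorem joinedIn_base : JoinedIn (fredholmUnits 𝓜.X)
    (𝓜.cl coordFun * 𝓜.F * 𝓜.cl coordFun * 𝓜.F) (1 - (2 : ℝ) • 𝓜.vacProj) :=
  joinedIn_one_sub_two_smul (Z := 𝓜.baseDefect) 𝓜.X_mul_X 𝓜.F_mul_F (𝓜.F_mul_X hN hN0)
    𝓜.cl_coordFun_mul_self (𝓜.commute_cl_X _).eq (𝓜.cl_mem_alg hN hN0 _).2 rfl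
    𝓜.vac.isIdempotentElem_starProjection (isCompactOperator_starProjection _) 𝓜.vacProj_mul_X
    (𝓜.baseDefect_mul_vacProj hN hN0) (𝓜.vacProj_mul_baseDefect hN hN0)
    (𝓜.even_part_mul_vacProj hN hN0) (𝓜.vacProj_mul_even_part hN hN0)
    (𝓜.norm_baseDefect_sq_sub_lt hN hN0)

end

end SpinorModel

namespace SpinorModel

variable {N : ℕ} {H : Type*} [NormedAddCommGroup H] [InnerProductSpace ℝ H]
  (𝓜 : SpinorModel N H)

/-- The image of the monogenics of degree less than `n` in the eigenspace of `X` for one. -/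
noncomputable def upper (n : ℕ) : Submodule ℝ H :=
  (⨆ j : Fin n, 𝓜.block (j, false)).map ((1 + 𝓜.X : H →L[ℝ] H) : H →ₗ[ℝ] H)

instance (n : ℕ) : FiniteDimensional ℝ (𝓜.upper n) := by unfold upper; infer_instance

theorem X_of_mem_upper {n : ℕ} {v : H} (hv : v ∈ 𝓜.upper n) : 𝓜.X v = v := by
  obtain ⟨u, -, rfl⟩ := Submodule.mem_map.1 hv
  change 𝓜.X ((1 + 𝓜.X : H →L[ℝ] H) u) = (1 + 𝓜.X : H →L[ℝ] H) u
  rw [add_apply, one_apply_eq_self, map_add, X_X, add_comm]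

theorem upper_mono : Monotone 𝓜.upper := fun _ n h =>
  Submodule.map_mono <| iSup_le fun j =>
    le_iSup (fun j : Fin n => 𝓜.block (j, false)) (Fin.castLE h j)

theorem add_X_mem_upper {j n : ℕ} (hj : j < n) {u : H} (hu : u ∈ 𝓜.block (j, false)) :
    u + 𝓜.X u ∈ 𝓜.upper n :=
  ⟨u, Submodule.mem_iSup_of_mem (⟨j, hj⟩ : Fin n) hu, rfl⟩

theorem map_mem_upper {A : H →L[ℝ] H} (hAX : Commute A 𝓜.X)
    (hA : ∀ j, ∀ v ∈ 𝓜.block (j, false), A v ∈ 𝓜.block (j, false)) {n : ℕ} {v : H}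
    (hv : v ∈ 𝓜.upper n) : A v ∈ 𝓜.upper n := by
  obtain ⟨u, hu, rfl⟩ := Submodule.mem_map.1 hv
  refine ⟨A u, ?_, ?_⟩
  · have : (⨆ j : Fin n, 𝓜.block (j, false)) ≤
        (⨆ j : Fin n, 𝓜.block (j, false)).comap (A : H →ₗ[ℝ] H) :=
      iSup_le fun j v hv => Submodule.mem_iSup_of_mem j (hA j v hv)
    exact this hu
  · change A u + 𝓜.X (A u) = A (u + 𝓜.X u)
    rw [map_add, ← mul_apply_eq_comp, ← mul_apply_eq_comp, hAX.eq]

theorem tendsto_starProjection_upper [CompleteSpace H] (hN : 4 ∣ N) (hN0 : 2 ≤ N) {v : H}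
    (hv : 𝓜.X v = v) :
    Tendsto (fun n => (𝓜.upper n).starProjection v) atTop (𝓝 v) := by
  have hmaps : (⨆ p, 𝓜.block p) ≤
      (⨆ n, 𝓜.upper n).comap ((1 + 𝓜.X : H →L[ℝ] H) : H →ₗ[ℝ] H) := by
    refine iSup_le ?_
    rintro ⟨j, b⟩ u hu
    refine Submodule.mem_iSup_of_mem (j + 1) ?_
    change u + 𝓜.X u ∈ _
    cases b
    · exact 𝓜.add_X_mem_upper j.lt_succ_self hu
    · obtain ⟨f, hf, rfl⟩ := 𝓜.mem_block_true.1 hu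
      rw [X_X, add_comm (𝓜.X _)]
      exact 𝓜.add_X_mem_upper j.lt_succ_self (𝓜.ψ_mem_block hf)
  have hmem : v ∈ (⨆ n, 𝓜.upper n).topologicalClosure := by
    have h1 : v ∈ closure ((⨆ p, 𝓜.block p : Submodule ℝ H) : Set H) := by
      rw [← Submodule.topologicalClosure_coe, 𝓜.iSup_block_topologicalClosure hN hN0]; trivial
    have h2 : (1 + 𝓜.X : H →L[ℝ] H) v ∈ closure ((⨆ n, 𝓜.upper n : Submodule ℝ H) : Set H) :=
      map_mem_closure (1 + 𝓜.X : H →L[ℝ] H).continuous h1 hmaps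
    rw [add_apply, one_apply_eq_self, hv, ← two_smul ℝ v, ← Submodule.topologicalClosure_coe]
      at h2
    exact (Submodule.smul_mem_iff _ (two_ne_zero' ℝ)).1 h2
  have h := Submodule.starProjection_tendsto_closure_iSup 𝓜.upper 𝓜.upper_mono v
  rwa [Submodule.starProjection_eq_self_iff.2 hmem] at h

theorem vacProj_of_X_eq {v : H} (hv : 𝓜.X v = v) :
    ∃ c : ℝ, 𝓜.vacProj v = c • (𝓜.one + 𝓜.X 𝓜.one) := by
  obtain ⟨a, b, h⟩ := 𝓜.mem_vac.1 (Submodule.starProjection_apply_mem 𝓜.vac v)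
  have h1 : 𝓜.X (𝓜.vacProj v) = 𝓜.vacProj v := by
    rw [← mul_apply_eq_comp, ← 𝓜.vacProj_mul_X, mul_apply_eq_comp, hv]
  refine ⟨(a + b) / 2, ?_⟩
  have h2 : 𝓜.vacProj v = (1 / 2 : ℝ) • (𝓜.vacProj v + 𝓜.X (𝓜.vacProj v)) := by
    rw [h1]; module
  rw [h2, vacProj, ← h, map_add, map_smul, map_smul, X_X]
  module

theorem compressionDet_one_sub_two_smul_vacProj (hN : 4 ∣ N) (hN0 : 2 ≤ N) {n : ℕ} (hn : 0 < n) :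
    compressionDet (𝓜.upper n) (1 - (2 : ℝ) • 𝓜.vacProj) = -1 := by
  set w : H := 𝓜.one + 𝓜.X 𝓜.one with hw
  have hwm : w ∈ 𝓜.upper n := 𝓜.add_X_mem_upper hn 𝓜.one_mem_block
  have hwv : 𝓜.vacProj w = w := Submodule.starProjection_eq_self_iff.2
    (add_mem 𝓜.one_mem_vac 𝓜.X_one_mem_vac)
  have hX : 𝓜.X w = w := 𝓜.X_of_mem_upper hwm
  have hw0 : w ≠ 0 := fun h => by
    have n2 : ((0, false) : ℕ × Bool) ≠ (0, true) := by simp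
    have e3 : inner ℝ 𝓜.one (𝓜.X 𝓜.one) = 0 :=
      𝓜.block_orthogonal hN hN0 n2 ⟨_, 𝓜.one_mem_block⟩ ⟨_, 𝓜.X_one_mem_block⟩
    have : inner ℝ 𝓜.one w = 0 := by rw [h, inner_zero_right]
    rw [hw, inner_add_right, e3, add_zero, inner_self_eq_zero] at this
    exact 𝓜.one_ne_zero this
  have hww : inner ℝ w w ≠ 0 := fun h => hw0 (inner_self_eq_zero.1 h)
  let f : Module.Dual ℝ (𝓜.upper n) :=
    (-2 / inner ℝ w w : ℝ) • ((innerₗ H w).comp (𝓜.upper n).subtype)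
  have hf : ∀ v : 𝓜.upper n, f v = -2 / inner ℝ w w * inner ℝ w (v : H) := fun _ => rfl
  have key : (((𝓜.upper n).orthogonalProjectionOnto ∘L
      (1 - (2 : ℝ) • 𝓜.vacProj) ∘L (𝓜.upper n).subtypeL : _ →L[ℝ] _) : _ →ₗ[ℝ] _) =
        LinearMap.transvection f ⟨w, hwm⟩ := by
    refine LinearMap.ext fun v => ?_
    obtain ⟨c, hc⟩ := 𝓜.vacProj_of_X_eq (𝓜.X_of_mem_upper v.2)
    have hc' : c * inner ℝ w w = inner ℝ w (v : H) := by
      rw [← real_inner_smul_right, ← hc, vacProj,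
        ← Submodule.inner_starProjection_left_eq_right, ← vacProj, hwv]
    have hfv : f v = -2 * c := by
      rw [hf, ← hc']; field_simp
    rw [LinearMap.transvection.apply, hfv]
    have hval : (1 - (2 : ℝ) • 𝓜.vacProj) (v : H) =
        ((v + (-2 * c) • (⟨w, hwm⟩ : 𝓜.upper n) : 𝓜.upper n) : H) := by
      rw [sub_apply, one_apply_eq_self, smul_apply, hc, Submodule.coe_add, Submodule.coe_smul]
      module
    change (𝓜.upper n).orthogonalProjectionOnto ((1 - (2 : ℝ) • 𝓜.vacProj) (v : H)) = _
    rw [hval]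
    exact Submodule.orthogonalProjectionOnto_mem_subspace_eq_self _
  rw [compressionDet, ContinuousLinearMap.det, key, LinearMap.transvection.det, hf]
  field_simp
  norm_num

theorem compressionDet_nonneg_of_commute {J Y : H →L[ℝ] H} (hJ : J * J = -1)
    (hJX : Commute J 𝓜.X) (hJs : ∀ u v, inner ℝ (J u) v = -inner ℝ u (J v))
    (hJb : ∀ j, ∀ v ∈ 𝓜.block (j, false), J v ∈ 𝓜.block (j, false)) (hY : Y * J = J * Y)
    (n : ℕ) : 0 ≤ compressionDet (𝓜.upper n) Y := by
  have hJU : ∀ v ∈ 𝓜.upper n, J v ∈ 𝓜.upper n := fun v hv => 𝓜.map_mem_upper hJX hJb hv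
  refine det_nonneg_of_commute ((J : H →ₗ[ℝ] H).restrict hJU) _ ?_ ?_
  · refine LinearMap.ext fun v => Subtype.ext ?_
    have : (J * J) (v : H) = -v := by rw [hJ]; rfl
    exact this
  · refine LinearMap.ext fun v => Subtype.ext ?_
    change (𝓜.upper n).starProjection (Y (J v)) = J ((𝓜.upper n).starProjection (Y v))
    rw [← mul_apply_eq_comp Y J, hY, mul_apply_eq_comp]
    refine Submodule.eq_starProjection_of_mem_of_inner_eq_zero
      (hJU _ (Submodule.starProjection_apply_mem _ _)) fun w hw => ?_
    rw [← map_sub, hJs, neg_eq_zero]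
    exact Submodule.starProjection_inner_eq_zero _ _ (hJU w hw)

variable [CompleteSpace H]

/-- The symbols of the spinor model. -/
noncomputable abbrev units : Set (H →L[ℝ] H) := symbolUnits 𝓜.X 𝓜.F 𝓜.F_mul_F

/-- The obstruction: right multiplication by the position vector is not homotopic, up to constant
factors, to a symbol intertwining complex structures which commute with the reflection. -/
theorem not_joinedIn_units (hN : 4 ∣ N) (hN0 : 2 ≤ N) {i j : Fin (N + 1)} (hij : i ≠ j)
    {c C J' : H →L[ℝ] H} (hC : IsUnit C) (hCF : Commute C 𝓜.F) (hJ' : Commute J' 𝓜.F)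
    (hc : c * (𝓜.G i * 𝓜.G j) = J' * c) : ¬ JoinedIn 𝓜.units (C * 𝓜.cl coordFun) c := by
  intro hjoin
  have hcu : IsUnit c := hjoin.target_mem.1
  have h1 := joinedIn_twist (𝓜.F_mul_X hN hN0) hjoin
  have h2 : twist 𝓜.F (C * 𝓜.cl coordFun) =
      𝓜.cl coordFun * 𝓜.F * 𝓜.cl coordFun * 𝓜.F := by
    obtain ⟨u, rfl⟩ := hC
    let r : (H →L[ℝ] H)ˣ := ⟨𝓜.cl coordFun, 𝓜.cl coordFun, 𝓜.cl_coordFun_mul_self,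
      𝓜.cl_coordFun_mul_self⟩
    have hr : (u : H →L[ℝ] H) * 𝓜.cl coordFun = ((u * r : (H →L[ℝ] H)ˣ) : H →L[ℝ] H) := rfl
    rw [twist, hr, Ring.inverse_unit, mul_inv_rev, Units.val_mul, Units.val_mul]
    change 𝓜.cl coordFun * ↑u⁻¹ * 𝓜.F * (↑u * 𝓜.cl coordFun) * 𝓜.F = _
    have h3 : (↑u⁻¹ : H →L[ℝ] H) * 𝓜.F * ↑u = 𝓜.F := by
      rw [mul_assoc, ← hCF.eq, ← mul_assoc, Units.inv_mul, one_mul]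
    calc _ = 𝓜.cl coordFun * (↑u⁻¹ * 𝓜.F * ↑u) * 𝓜.cl coordFun * 𝓜.F := by
          simp only [mul_assoc]
      _ = _ := by rw [h3]
  rw [h2] at h1
  have h4 := (𝓜.joinedIn_base hN hN0).symm.trans h1
  set J := 𝓜.G i * 𝓜.G j with hJ
  have hanti := 𝓜.G_anticomm i j hij
  have hYJ : twist 𝓜.F c * J = J * twist 𝓜.F c := by
    have hJF : Commute J 𝓜.F := (𝓜.commute_G_F hN hN0 i).mul_left (𝓜.commute_G_F hN hN0 j)
    obtain ⟨u, rfl⟩ := hcu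
    have h5 : (↑u⁻¹ : H →L[ℝ] H) * J' = J * ↑u⁻¹ := by
      rw [Units.inv_mul_eq_iff_eq_mul, ← mul_assoc, hc, mul_assoc, Units.mul_inv, mul_one]
    rw [twist, Ring.inverse_unit]
    calc ↑u⁻¹ * 𝓜.F * ↑u * 𝓜.F * J = ↑u⁻¹ * 𝓜.F * (↑u * J) * 𝓜.F := by
          rw [mul_assoc _ 𝓜.F J, ← hJF.eq]; simp only [mul_assoc]
      _ = ↑u⁻¹ * (𝓜.F * J') * ↑u * 𝓜.F := by rw [hc]; simp only [mul_assoc]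
      _ = (↑u⁻¹ * J') * 𝓜.F * ↑u * 𝓜.F := by rw [← hJ'.eq]; simp only [mul_assoc]
      _ = _ := by rw [h5]; simp only [mul_assoc]
  have hJJ : J * J = -1 := by
    calc J * J = 𝓜.G i * (𝓜.G i * 𝓜.G j + 𝓜.G j * 𝓜.G i) * 𝓜.G j -
          (𝓜.G i * 𝓜.G i) * (𝓜.G j * 𝓜.G j) := by rw [hJ]; noncomm_ring
      _ = -1 := by rw [hanti, 𝓜.G_sq, 𝓜.G_sq]; noncomm_ring
  have hJs : ∀ u v, inner ℝ (J u) v = -inner ℝ u (J v) := fun u v => by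
    have : 𝓜.G j * 𝓜.G i = -J := by
      rw [hJ, eq_neg_iff_add_eq_zero, add_comm, hanti]
    rw [hJ, mul_apply_eq_comp, 𝓜.G_symm, 𝓜.G_symm, ← mul_apply_eq_comp, this, neg_apply,
      inner_neg_right]
  have hJb : ∀ k, ∀ v ∈ 𝓜.block (k, false), J v ∈ 𝓜.block (k, false) := fun k v hv => by
    obtain ⟨f, hf, rfl⟩ := 𝓜.mem_block_false.1 hv
    rw [hJ, mul_apply_eq_comp, ← 𝓜.ψ_eR, ← 𝓜.ψ_eR]
    exact 𝓜.ψ_mem_block (eR_mem_monogenic (eR_mem_monogenic hf _) _)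
  obtain ⟨n, hn, hpos⟩ := ((eventually_gt_atTop 0).and
    (eventually_compressionDet_mul_pos 𝓜.X_mul_X 𝓜.upper (fun _ _ => 𝓜.X_of_mem_upper)
      (fun _ => 𝓜.tendsto_starProjection_upper hN hN0) h4)).exists
  rw [𝓜.compressionDet_one_sub_two_smul_vacProj hN hN0 hn] at hpos
  have := 𝓜.compressionDet_nonneg_of_commute hJJ
    ((𝓜.commute_G_X i).mul_left (𝓜.commute_G_X j)) hJs hJb hYJ n
  linarith

end SpinorModel

section

variable {H : Type*} [NormedAddCommGroup H] [InnerProductSpace ℝ H] [CompleteSpace H]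
  {X F : H →L[ℝ] H} {hF : F * F = 1}

theorem joinedIn_symbolUnits_of_norm_sub_one {B : H →L[ℝ] H} (hB : B ∈ symbolAlgebra X F hF)
    (h : ‖B - 1‖ < 1) : JoinedIn (symbolUnits X F hF) 1 B := by
  refine JoinedIn.ofLine (f := fun r : ℝ => 1 - r • (1 - B)) (by fun_prop) (by simp) (by simp) ?_
  rintro _ ⟨r, hr, rfl⟩
  refine ⟨isUnit_one_sub_smul (by rwa [norm_sub_rev]) hr.1 hr.2, ?_⟩
  exact sub_mem (one_mem _) (Subalgebra.smul_mem _ (sub_mem (one_mem _) hB) _)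

/-- Complex structures in a continuous family are conjugate by a symbol homotopic to one. -/
theorem exists_intertwiner {J : unitInterval → H →L[ℝ] H} (hJc : Continuous J)
    (hJ : ∀ t, J t ∈ symbolAlgebra X F hF) (hJJ : ∀ t, J t * J t = -1) (s t : unitInterval) :
    ∃ a, JoinedIn (symbolUnits X F hF) 1 a ∧ a * J s = J t * a := by
  refine isPreconnected_univ.induction₂'
    (fun s t => ∃ a, JoinedIn (symbolUnits X F hF) 1 a ∧ a * J s = J t * a) ?_ ?_
    (Set.mem_univ s) (Set.mem_univ t)
  · have hloc : ∀ s t, ‖(J s - J t) * J t‖ < 1 →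
        ∃ a, JoinedIn (symbolUnits X F hF) 1 a ∧ a * J t = J s * a := fun s t hst => by
      refine ⟨(1 / 2 : ℝ) • (1 - J s * J t), joinedIn_symbolUnits_of_norm_sub_one
        (Subalgebra.smul_mem _ (sub_mem (one_mem _) (mul_mem (hJ s) (hJ t))) _) ?_, ?_⟩
      · have h1 : (1 / 2 : ℝ) • (1 - J s * J t) - 1 = -((1 / 2 : ℝ) • ((J s - J t) * J t)) := by
          rw [sub_mul, hJJ]; module
        rw [h1, norm_neg, norm_smul]
        norm_num
        linarith
      · rw [smul_mul_assoc, mul_smul_comm, sub_mul, mul_sub, mul_assoc, hJJ, ← mul_assoc, hJJ]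
        congr 1
        noncomm_ring
    intro s _
    rw [nhdsWithin_univ]
    have h1 : ∀ᶠ t in 𝓝 s, ‖(J s - J t) * J t‖ < 1 := by
      refine ContinuousAt.eventually_lt (f := fun t => ‖(J s - J t) * J t‖) (by fun_prop)
        continuousAt_const (by simp)
    have h2 : ∀ᶠ t in 𝓝 s, ‖(J t - J s) * J s‖ < 1 := by
      refine ContinuousAt.eventually_lt (f := fun t => ‖(J t - J s) * J s‖) (by fun_prop)
        continuousAt_const (by simp)
    filter_upwards [h1, h2] with t ht ht'
    exact ⟨hloc _ _ ht', hloc _ _ ht⟩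
  · rintro x y z - - - ⟨a, ha, h⟩ ⟨b, hb, h'⟩
    refine ⟨b * a, ?_, ?_⟩
    · have := joinedIn_mul hb ha
      rwa [mul_one] at this
    · rw [mul_assoc, h, ← mul_assoc, h', mul_assoc]

end

namespace SpinorModel

variable {N : ℕ} {H : Type*} [NormedAddCommGroup H] [InnerProductSpace ℝ H]
  (𝓜 : SpinorModel N H)

/-- A constant vector field. -/
def constVec (p : Fin (N + 1) → ℝ) : Fin (N + 1) → C(USphere N, ℝ) :=
  fun i => ContinuousMap.const _ (p i)

theorem cl_sub (u v : Fin (N + 1) → C(USphere N, ℝ)) : 𝓜.cl (u - v) = 𝓜.cl u - 𝓜.cl v := by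
  simp only [cl, Pi.sub_apply, map_sub, sub_mul, Finset.sum_sub_distrib]

theorem cl_mul_left (φ : C(USphere N, ℝ)) (u : Fin (N + 1) → C(USphere N, ℝ)) :
    𝓜.cl (fun i => φ * u i) = 𝓜.mul φ * 𝓜.cl u := by
  simp only [cl, map_mul, Finset.mul_sum, mul_assoc]

theorem cl_smul (r : ℝ) (u : Fin (N + 1) → C(USphere N, ℝ)) : 𝓜.cl (r • u) = r • 𝓜.cl u := by
  simp only [cl, Pi.smul_apply, map_smul, smul_mul_assoc, Finset.smul_sum]

theorem cl_mul_self (u : Fin (N + 1) → C(USphere N, ℝ)) :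
    𝓜.cl u * 𝓜.cl u = 𝓜.mul (∑ i, u i * u i) := by
  have h := 𝓜.cl_mul_cl_add u u
  rw [← two_smul ℝ] at h
  exact smul_right_injective _ (two_ne_zero (α := ℝ)) h

theorem cl_mul_cl_of_eq_zero {u v : Fin (N + 1) → C(USphere N, ℝ)} (h : ∑ i, u i * v i = 0) :
    𝓜.cl u * 𝓜.cl v = -(𝓜.cl v * 𝓜.cl u) := by
  have := 𝓜.cl_mul_cl_add u v
  rw [h, map_zero, smul_zero] at this
  exact eq_neg_of_add_eq_zero_left this

theorem cl_mul_cl_reflect {φ : C(USphere N, ℝ)} {v w : Fin (N + 1) → C(USphere N, ℝ)}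
    (h : φ * ∑ i, w i * w i = (2 : ℝ) • ∑ i, w i * v i) :
    𝓜.cl w * 𝓜.cl v = -(𝓜.cl (v - fun i => φ * w i) * 𝓜.cl w) := by
  rw [cl_sub, cl_mul_left, sub_mul, mul_assoc, cl_mul_self, ← map_mul, h, map_smul,
    ← cl_mul_cl_add]
  noncomm_ring

/-- The complex structure on spinors given by an oriented plane field. -/
noncomputable def planeStructure (r : C(USphere N, ℝ)) (a b : Fin (N + 1) → C(USphere N, ℝ)) :
    H →L[ℝ] H :=
  𝓜.mul r * (𝓜.cl a * 𝓜.cl b - 𝓜.mul (∑ i, a i * b i))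

theorem planeStructure_mul_self {r : C(USphere N, ℝ)} {a b : Fin (N + 1) → C(USphere N, ℝ)}
    (h : r * r * ((∑ i, a i * a i) * (∑ i, b i * b i) - (∑ i, a i * b i) * ∑ i, a i * b i) = 1) :
    𝓜.planeStructure r a b * 𝓜.planeStructure r a b = -1 := by
  set s := ∑ i, a i * b i with hs
  have hba : 𝓜.cl b * 𝓜.cl a = (2 : ℝ) • 𝓜.mul s - 𝓜.cl a * 𝓜.cl b :=
    eq_sub_of_add_eq' (𝓜.cl_mul_cl_add a b)
  have hsa : 𝓜.mul s * 𝓜.cl a = 𝓜.cl a * 𝓜.mul s := (𝓜.commute_mul_cl _ _).eq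
  have hsb : 𝓜.mul s * 𝓜.cl b = 𝓜.cl b * 𝓜.mul s := (𝓜.commute_mul_cl _ _).eq
  have hab : 𝓜.cl a * 𝓜.cl b * (𝓜.cl a * 𝓜.cl b) =
      (2 : ℝ) • (𝓜.cl a * 𝓜.cl b * 𝓜.mul s) -
        𝓜.mul (∑ i, a i * a i) * 𝓜.mul (∑ i, b i * b i) := by
    calc _ = 𝓜.cl a * (𝓜.cl b * 𝓜.cl a) * 𝓜.cl b := by simp only [mul_assoc]
      _ = (2 : ℝ) • (𝓜.cl a * (𝓜.mul s * 𝓜.cl b)) -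
          𝓜.cl a * 𝓜.cl a * (𝓜.cl b * 𝓜.cl b) := by
        rw [hba, mul_sub, sub_mul, mul_smul_comm, smul_mul_assoc]; simp only [mul_assoc]
      _ = _ := by rw [hsb, cl_mul_self, cl_mul_self]; simp only [mul_assoc]
  have hq : (𝓜.cl a * 𝓜.cl b - 𝓜.mul s) * (𝓜.cl a * 𝓜.cl b - 𝓜.mul s) =
      -𝓜.mul ((∑ i, a i * a i) * (∑ i, b i * b i) - s * s) := by
    have h1 : 𝓜.mul s * (𝓜.cl a * 𝓜.cl b) = 𝓜.cl a * 𝓜.cl b * 𝓜.mul s := by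
      rw [← mul_assoc, hsa, mul_assoc, hsb, mul_assoc]
    rw [sub_mul, mul_sub, mul_sub, hab, h1, map_sub, map_mul, map_mul]
    module
  have hr : Commute (𝓜.mul r) (𝓜.cl a * 𝓜.cl b - 𝓜.mul s) :=
    ((𝓜.commute_mul_cl _ _).mul_right (𝓜.commute_mul_cl _ _)).sub_right (𝓜.commute_mul_mul _ _)
  rw [planeStructure, hr.symm.mul_mul_mul_comm, hq, mul_neg, ← map_mul, ← map_mul, h, map_one]

theorem planeStructure_of_orthonormal {r : C(USphere N, ℝ)}
    {a b : Fin (N + 1) → C(USphere N, ℝ)} (hr : r = 1) (h : ∑ i, a i * b i = 0) :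
    𝓜.planeStructure r a b = 𝓜.cl a * 𝓜.cl b := by
  rw [planeStructure, hr, h, map_one, map_zero, sub_zero, one_mul]

theorem isUnit_cl {u : Fin (N + 1) → C(USphere N, ℝ)} (hu : ∀ x, ∑ i, u i x * u i x ≠ 0) :
    IsUnit (𝓜.cl u) := by
  let φ : C(USphere N, ℝ) := ⟨fun x => (∑ i, u i x * u i x)⁻¹,
    Continuous.inv₀ (by fun_prop) hu⟩
  have hφ : φ * ∑ i, u i * u i = 1 := by
    ext x
    simpa [φ] using inv_mul_cancel₀ (hu x)
  have h : 𝓜.mul φ * 𝓜.cl u * 𝓜.cl u = 1 := by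
    rw [mul_assoc, cl_mul_self, ← map_mul, hφ, map_one]
  refine ⟨⟨𝓜.cl u, 𝓜.mul φ * 𝓜.cl u, ?_, h⟩, rfl⟩
  rw [← mul_assoc, ← (𝓜.commute_mul_cl _ _).eq, h]

theorem cl_constVec_single (j : Fin (N + 1)) : 𝓜.cl (constVec (Pi.single j 1)) = 𝓜.G j := by
  rw [cl, Finset.sum_eq_single j]
  · have : constVec (Pi.single j 1) j = (1 : C(USphere N, ℝ)) := by ext x; simp [constVec]
    rw [this, map_one, one_mul]
  · intro i _ hij
    have : constVec (Pi.single j 1) i = (0 : C(USphere N, ℝ)) := by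
      ext x; simp [constVec, Pi.single_eq_of_ne hij]
    rw [this, map_zero, zero_mul]
  · simp

theorem cl_reflected_axis {j : Fin (N + 1)} {u : Fin (N + 1) → C(USphere N, ℝ)}
    (hu : ∀ i x, u i x = (if i = j then 1 else 0) - 2 * coordFun i x * coordFun j x) :
    𝓜.cl u = -(𝓜.cl coordFun * 𝓜.G j * 𝓜.cl coordFun) := by
  have h1 : u = constVec (Pi.single j 1) - fun i => ((2 : ℝ) • coordFun j) * coordFun i := by
    funext i
    ext x
    rw [hu]
    simp [constVec, Pi.single_apply]
    ring
  have h2 := 𝓜.cl_mul_cl_add coordFun (constVec (Pi.single j 1))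
  have h3 : ∑ i, coordFun i * constVec (Pi.single j 1) i = (coordFun j : C(USphere N, ℝ)) := by
    ext x
    simp [constVec, Pi.single_apply]
  rw [cl_constVec_single, h3] at h2
  rw [h1, cl_sub, cl_constVec_single, cl_mul_left, map_smul, ← h2, add_mul, mul_assoc (𝓜.G j),
    cl_coordFun_mul_self, mul_one]
  abel

variable [CompleteSpace H]

section

variable (hN : 4 ∣ N) (hN0 : 2 ≤ N)

include 𝓜 hN hN0

theorem commute_cl_constVec_F (p : Fin (N + 1) → ℝ) : Commute (𝓜.cl (constVec p)) 𝓜.F := by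
  have : ∀ r : ℝ, 𝓜.mul (ContinuousMap.const _ r) = r • 1 := fun r => by
    rw [← Algebra.algebraMap_eq_smul_one, ← AlgHom.commutes 𝓜.mul r]; rfl
  refine Commute.sum_left _ _ _ fun i _ => Commute.mul_left ?_ (𝓜.commute_G_F hN hN0 i)
  rw [constVec, this]
  exact (Commute.one_left _).smul_left _

theorem planeStructure_mem_alg (r : C(USphere N, ℝ)) (a b : Fin (N + 1) → C(USphere N, ℝ)) :
    𝓜.planeStructure r a b ∈ 𝓜.alg :=
  mul_mem (𝓜.mul_mem_alg hN hN0 _) (sub_mem (mul_mem (𝓜.cl_mem_alg hN hN0 _)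
    (𝓜.cl_mem_alg hN hN0 _)) (𝓜.mul_mem_alg hN hN0 _))

theorem cl_mem_units {u : Fin (N + 1) → C(USphere N, ℝ)} (hu : ∀ x, ∑ i, u i x * u i x ≠ 0) :
    𝓜.cl u ∈ 𝓜.units :=
  ⟨𝓜.isUnit_cl hu, 𝓜.cl_mem_alg hN hN0 u⟩

theorem joinedIn_cl_sub {u : Fin (N + 1) → C(USphere N, ℝ)} {p : Fin (N + 1) → ℝ}
    (hu : ∀ x, ∑ i, u i x * u i x = 1) (hp : ∑ i, p i * p i = 1)
    (hne : ∀ x, (fun i => u i x) ≠ p) :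
    JoinedIn 𝓜.units (𝓜.cl (-constVec p)) (𝓜.cl (u - constVec p)) := by
  refine JoinedIn.ofLine (f := fun r : ℝ => r • 𝓜.cl u - 𝓜.cl (constVec p)) (by fun_prop) ?_ ?_ ?_
  · have := 𝓜.cl_smul (-1) (constVec p)
    rw [neg_one_smul, neg_one_smul] at this
    rw [this, zero_smul, zero_sub]
  · rw [one_smul, cl_sub]
  rintro _ ⟨r, hr, rfl⟩
  change r • 𝓜.cl u - 𝓜.cl (constVec p) ∈ _
  rw [← cl_smul, ← cl_sub]
  refine 𝓜.cl_mem_units hN hN0 fun x h0 => ?_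
  have h1 := (Finset.sum_eq_zero_iff_of_nonneg fun i _ => mul_self_nonneg _).1 h0
  have h2 : ∀ i, r * u i x = p i := fun i => sub_eq_zero.1 (mul_self_eq_zero.1 (h1 i (by simp)))
  have h3 : r * r = 1 := by
    calc r * r = r * r * ∑ i, u i x * u i x := by rw [hu x, mul_one]
      _ = ∑ i, p i * p i := by
        rw [Finset.mul_sum]
        exact Finset.sum_congr rfl fun i _ => by rw [← h2]; ring
      _ = 1 := hp
  have h4 : r = 1 := by nlinarith [hr.1]
  exact hne x (funext fun i => by rw [← h2, h4, one_mul])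

/-- The tangent frame given by two columns of the characteristic map cannot be deformed through
independent pairs to an orthonormal pair which misses suitable constant vectors. -/
theorem false_of_homotopy {i₁ i₂ : Fin (N + 1)} (h12 : i₁ ≠ i₂)
    (a b : Fin (N + 1) → C(unitInterval × USphere N, ℝ))
    (hab : ∀ z, 0 < (∑ i, a i z * a i z) * (∑ i, b i z * b i z) -
      (∑ i, a i z * b i z) * ∑ i, a i z * b i z)
    (ha0 : ∀ i x, a i (0, x) = (if i = i₁ then 1 else 0) - 2 * coordFun i x * coordFun i₁ x)
    (hb0 : ∀ i x, b i (0, x) = (if i = i₂ then 1 else 0) - 2 * coordFun i x * coordFun i₂ x)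
    (ha1 : ∀ x, ∑ i, a i (1, x) * a i (1, x) = 1) (hb1 : ∀ x, ∑ i, b i (1, x) * b i (1, x) = 1)
    (hab1 : ∀ x, ∑ i, a i (1, x) * b i (1, x) = 0)
    {p q : Fin (N + 1) → ℝ} (hp : ∑ i, p i * p i = 1) (hq : ∑ i, q i * q i = 1)
    (hpq : ∑ i, p i * q i = 0) (hap : ∀ x, (fun i => a i (1, x)) ≠ p)
    (hbq : ∀ x, (fun i => b i (1, x) - 2 * (∑ j, (a j (1, x) - p j) * b j (1, x)) /
      (∑ j, (a j (1, x) - p j) * (a j (1, x) - p j)) * (a i (1, x) - p i)) ≠ q) : False := by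
  let ut : unitInterval → Fin (N + 1) → C(USphere N, ℝ) := fun t i => (a i).curry t
  let vt : unitInterval → Fin (N + 1) → C(USphere N, ℝ) := fun t i => (b i).curry t
  let r : C(unitInterval × USphere N, ℝ) :=
    ⟨fun z => (√((∑ i, a i z * a i z) * (∑ i, b i z * b i z) -
      (∑ i, a i z * b i z) * ∑ i, a i z * b i z))⁻¹,
      Continuous.inv₀ (by fun_prop) fun z => (Real.sqrt_pos.2 (hab z)).ne'⟩
  let J : unitInterval → H →L[ℝ] H := fun t => 𝓜.planeStructure (r.curry t) (ut t) (vt t)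
  have hmul := 𝓜.continuous_mul
  have hut : ∀ i, Continuous fun t => ut t i := fun i => (a i).curry.continuous
  have hvt : ∀ i, Continuous fun t => vt t i := fun i => (b i).curry.continuous
  have hJc : Continuous J := by
    have h1 : Continuous fun t => r.curry t := r.curry.continuous
    simp only [J, planeStructure, cl]
    fun_prop
  have hJJ : ∀ t, J t * J t = -1 := fun t => 𝓜.planeStructure_mul_self <| by
    ext x
    have h := hab (t, x)
    simp only [ContinuousMap.mul_apply, ContinuousMap.sub_apply, ContinuousMap.sum_apply,
      ContinuousMap.curry_apply, ContinuousMap.coe_mk, ContinuousMap.one_apply, r, ut, vt]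
    rw [← mul_inv, Real.mul_self_sqrt h.le, inv_mul_cancel₀ h.ne']
  obtain ⟨α, hα, hαJ⟩ := exists_intertwiner hJc
    (fun t => 𝓜.planeStructure_mem_alg hN hN0 _ _ _) hJJ 0 1
  set R := 𝓜.cl coordFun with hR
  have hRR : R * R = 1 := 𝓜.cl_coordFun_mul_self
  have hJ0 : J 0 = R * (𝓜.G i₁ * 𝓜.G i₂) * R := by
    have hs := fun x : USphere N => congrArg (fun f => f x) (sum_coordFun_mul_self (N := N))
    simp only [ContinuousMap.sum_apply, ContinuousMap.mul_apply, ContinuousMap.one_apply] at hs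
    have e : ∀ (c d : Fin (N + 1)) (x : USphere N),
        ∑ i, ((if i = c then 1 else 0) - 2 * coordFun i x * coordFun c x) *
          ((if i = d then 1 else 0) - 2 * coordFun i x * coordFun d x) = if c = d then 1 else 0 := by
      intro c d x
      have : ∀ i, ((if i = c then 1 else 0) - 2 * coordFun i x * coordFun c x) *
          ((if i = d then 1 else 0) - 2 * coordFun i x * coordFun d x) =
          (if i = c then (if i = d then 1 else 0) else 0) -
          (if i = c then 2 * coordFun i x * coordFun d x else 0) -
          (if i = d then 2 * coordFun i x * coordFun c x else 0) +
          4 * coordFun c x * coordFun d x * (coordFun i x * coordFun i x) := fun i => by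
        split_ifs <;> ring
      simp_rw [this]
      rw [Finset.sum_add_distrib, Finset.sum_sub_distrib, Finset.sum_sub_distrib,
        ← Finset.mul_sum, hs]
      simp
      ring
    have h1 : r.curry 0 = 1 := by
      ext x
      simp [r, ha0, hb0, e, h12]
    have h2 : ∑ i, ut 0 i * vt 0 i = 0 := by
      ext x
      simp [ut, vt, ha0, hb0, e, h12]
    have h3 : 𝓜.cl (ut 0) = -(R * 𝓜.G i₁ * R) := 𝓜.cl_reflected_axis ha0
    have h4 : 𝓜.cl (vt 0) = -(R * 𝓜.G i₂ * R) := 𝓜.cl_reflected_axis hb0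
    calc J 0 = 𝓜.cl (ut 0) * 𝓜.cl (vt 0) := 𝓜.planeStructure_of_orthonormal h1 h2
      _ = R * 𝓜.G i₁ * (R * R) * 𝓜.G i₂ * R := by rw [h3, h4]; noncomm_ring
      _ = _ := by rw [hRR]; noncomm_ring
  have hJ1 : J 1 = 𝓜.cl (ut 1) * 𝓜.cl (vt 1) := by
    refine 𝓜.planeStructure_of_orthonormal ?_ ?_
    · ext x
      simp [r, ha1, hb1, hab1]
    · ext x
      simp [ut, vt, hab1]
  set w := ut 1 - constVec p with hw
  have hwx : ∀ i x, w i x = a i (1, x) - p i := fun i x => rfl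
  have hw0 : ∀ x, ∑ i, w i x * w i x ≠ 0 := fun x h0 => hap x <| funext fun i => by
    have h1 := (Finset.sum_eq_zero_iff_of_nonneg fun i _ => mul_self_nonneg _).1 h0
    exact sub_eq_zero.1 (mul_self_eq_zero.1 (h1 i (Finset.mem_univ _)))
  let φ : C(USphere N, ℝ) := ⟨fun x => 2 * (∑ j, w j x * vt 1 j x) / ∑ j, w j x * w j x,
    Continuous.div (by fun_prop) (by fun_prop) hw0⟩
  set v' : Fin (N + 1) → C(USphere N, ℝ) := vt 1 - fun i => φ * w i with hv'
  have hv'x : ∀ i x, v' i x = vt 1 i x - φ x * w i x := fun i x => rfl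
  have hφ : ∀ x, φ x * ∑ i, w i x * w i x = 2 * ∑ i, w i x * vt 1 i x := fun x =>
    div_mul_cancel₀ _ (hw0 x)
  have hwu : ∀ x, ∑ i, w i x * w i x = 2 * ∑ i, w i x * ut 1 i x := fun x => by
    have h1 : ∑ i, w i x * w i x - 2 * ∑ i, w i x * ut 1 i x =
        ∑ i, p i * p i - ∑ i, ut 1 i x * ut 1 i x := by
      rw [Finset.mul_sum, ← Finset.sum_sub_distrib, ← Finset.sum_sub_distrib]
      refine Finset.sum_congr rfl fun i _ => ?_
      change (ut 1 i x - p i) * (ut 1 i x - p i) - 2 * ((ut 1 i x - p i) * ut 1 i x) = _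
      ring
    have h2 : ∑ i, ut 1 i x * ut 1 i x = 1 := ha1 x
    rw [hp, h2] at h1
    linarith
  have hv'v' : ∀ x, ∑ i, v' i x * v' i x = 1 := fun x => by
    have h1 : ∑ i, v' i x * v' i x = ∑ i, vt 1 i x * vt 1 i x +
        φ x * (φ x * ∑ i, w i x * w i x - 2 * ∑ i, w i x * vt 1 i x) := by
      rw [Finset.mul_sum, Finset.mul_sum, ← Finset.sum_sub_distrib, Finset.mul_sum,
        ← Finset.sum_add_distrib]
      exact Finset.sum_congr rfl fun i _ => by rw [hv'x]; ring
    rw [h1, hφ, sub_self, mul_zero, add_zero]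
    exact hb1 x
  have hv'p : ∀ x, ∑ i, v' i x * p i = 0 := fun x => by
    have h1 : ∑ i, v' i x * p i = ∑ i, ut 1 i x * vt 1 i x - ∑ i, w i x * vt 1 i x -
        φ x * (∑ i, w i x * ut 1 i x - ∑ i, w i x * w i x) := by
      rw [← Finset.sum_sub_distrib, ← Finset.sum_sub_distrib, Finset.mul_sum,
        ← Finset.sum_sub_distrib]
      refine Finset.sum_congr rfl fun i _ => ?_
      have : p i = ut 1 i x - w i x := by
        change p i = ut 1 i x - (ut 1 i x - p i); ring
      rw [hv'x, this]; ring
    have h2 : ∑ i, ut 1 i x * vt 1 i x = 0 := hab1 x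
    have h3 := hφ x
    rw [hwu] at h3
    rw [h1, h2, hwu]
    linarith
  set w' := v' - constVec q with hw'
  have hbq' : ∀ x, (fun i => v' i x) ≠ q := hbq
  have hw'p : ∑ i, w' i * constVec p i = 0 := by
    ext x
    have h1 : ∑ i, w' i x * p i = ∑ i, v' i x * p i - ∑ i, p i * q i := by
      rw [← Finset.sum_sub_distrib]
      refine Finset.sum_congr rfl fun i _ => ?_
      change (v' i x - q i) * p i = _
      ring
    rw [hv'p, hpq, sub_zero] at h1
    simpa [constVec] using h1
  have hw'v' : ∀ x, ∑ i, w' i x * w' i x = 2 * ∑ i, w' i x * v' i x := fun x => by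
    have h1 : ∑ i, w' i x * w' i x - 2 * ∑ i, w' i x * v' i x =
        ∑ i, q i * q i - ∑ i, v' i x * v' i x := by
      rw [Finset.mul_sum, ← Finset.sum_sub_distrib, ← Finset.sum_sub_distrib]
      refine Finset.sum_congr rfl fun i _ => ?_
      change (v' i x - q i) * (v' i x - q i) - 2 * ((v' i x - q i) * v' i x) = _
      ring
    rw [hq, hv'v'] at h1
    linarith
  set d := 𝓜.cl w' * 𝓜.cl w with hd
  set J' := 𝓜.cl (constVec p) * 𝓜.cl (constVec q) with hJ'
  have hdJ : d * J 1 = J' * d := by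
    have e1 : 𝓜.cl w * 𝓜.cl (ut 1) = -(𝓜.cl (constVec p) * 𝓜.cl w) := by
      rw [𝓜.cl_mul_cl_reflect (φ := 1) (v := ut 1) (w := w) (by
        ext x; simpa using hwu x)]
      congr 3
      funext i
      simp [hw]
    have e2 : 𝓜.cl w * 𝓜.cl (vt 1) = -(𝓜.cl v' * 𝓜.cl w) :=
      𝓜.cl_mul_cl_reflect (φ := φ) (by ext x; simpa using hφ x)
    have e3 : 𝓜.cl w' * 𝓜.cl (constVec p) = -(𝓜.cl (constVec p) * 𝓜.cl w') :=
      𝓜.cl_mul_cl_of_eq_zero hw'p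
    have e4 : 𝓜.cl w' * 𝓜.cl v' = -(𝓜.cl (constVec q) * 𝓜.cl w') := by
      rw [𝓜.cl_mul_cl_reflect (φ := 1) (v := v') (w := w') (by
        ext x; simpa using hw'v' x)]
      congr 3
      funext i
      simp [hw']
    calc d * J 1 = 𝓜.cl w' * (𝓜.cl w * 𝓜.cl (ut 1)) * 𝓜.cl (vt 1) := by
          rw [hJ1, hd]; noncomm_ring
      _ = -((𝓜.cl w' * 𝓜.cl (constVec p)) * (𝓜.cl w * 𝓜.cl (vt 1))) := by rw [e1]; noncomm_ring
      _ = -(𝓜.cl (constVec p) * (𝓜.cl w' * 𝓜.cl v') * 𝓜.cl w) := by rw [e2, e3]; noncomm_ring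
      _ = _ := by rw [e4, hd, hJ']; noncomm_ring
  have hneg : ∀ s : Fin (N + 1) → ℝ, -constVec s = constVec (N := N) (-s) := fun s => rfl
  have hCd : JoinedIn 𝓜.units (𝓜.cl (-constVec q) * 𝓜.cl (-constVec p)) d :=
    joinedIn_mul (𝓜.joinedIn_cl_sub hN hN0 hv'v' hq hbq') (𝓜.joinedIn_cl_sub hN hN0 ha1 hp hap)
  have hRu : R ∈ 𝓜.units :=
    ⟨⟨⟨R, R, hRR, hRR⟩, rfl⟩, 𝓜.cl_mem_alg hN hN0 _⟩
  have hjoin := joinedIn_mul (joinedIn_mul hCd hα) (JoinedIn.refl hRu)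
  rw [mul_one] at hjoin
  refine 𝓜.not_joinedIn_units hN hN0 h12 hCd.source_mem.1 ?_ ?_ (J' := J') ?_ hjoin
  · rw [hneg, hneg]
    exact (𝓜.commute_cl_constVec_F hN hN0 _).mul_left (𝓜.commute_cl_constVec_F hN hN0 _)
  · exact (𝓜.commute_cl_constVec_F hN hN0 _).mul_left (𝓜.commute_cl_constVec_F hN hN0 _)
  · have h1 : R * (𝓜.G i₁ * 𝓜.G i₂) = J 0 * R := by rw [hJ0, mul_assoc _ R R, hRR, mul_one]
    calc d * α * R * (𝓜.G i₁ * 𝓜.G i₂) = d * α * (R * (𝓜.G i₁ * 𝓜.G i₂)) := by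
          simp only [mul_assoc]
      _ = d * (α * J 0) * R := by rw [h1]; simp only [mul_assoc]
      _ = d * J 1 * α * R := by rw [hαJ]; simp only [mul_assoc]
      _ = _ := by rw [hdJ]; simp only [mul_assoc]


end

end SpinorModel

theorem exists_unit_notMem_of_dimH_lt {E : Type*} [NormedAddCommGroup E] [InnerProductSpace ℝ E]
    [FiniteDimensional ℝ E] (D : Submodule ℝ E) {k : ℕ} (hD : Module.finrank ℝ D = k + 1)
    {B : Set E} (hB : dimH B < k) : ∃ q ∈ D, ‖q‖ = 1 ∧ q ∉ B := by
  by_contra! hcon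
  have hDbot : D ≠ ⊥ := fun h => by rw [h, finrank_bot] at hD; omega
  obtain ⟨r₀, hr₀, hr₀0⟩ := Submodule.exists_mem_ne_zero_of_ne_bot hDbot
  set r : E := (‖r₀‖⁻¹ : ℝ) • r₀ with hr
  have hrD : r ∈ D := D.smul_mem _ hr₀
  have hr1 : ‖r‖ = 1 := norm_smul_inv_norm hr₀0
  have hr0 : r ≠ 0 := fun h => by simp [h] at hr1
  set W : Submodule ℝ E := (ℝ ∙ r)ᗮ ⊓ D with hW
  have hWk : Module.finrank ℝ W = k := by
    have := Submodule.finrank_add_inf_finrank_orthogonal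
      ((Submodule.span_singleton_le_iff_mem r D).2 hrD)
    rw [finrank_span_singleton hr0, hD, ← hW] at this
    omega
  set S : Set E := {q | q ∈ D ∧ ‖q‖ = 1} with hS
  have hSB : S ⊆ B := fun q hq => hcon q hq.1 hq.2
  have hball : Metric.ball (0 : W) 1 ⊆ W.orthogonalProjectionOnto '' S := fun y hy => by
    rw [mem_ball_zero_iff] at hy
    have hy' : ‖(y : E)‖ < 1 := hy
    have hyr : inner ℝ (y : E) r = 0 := by
      rw [real_inner_comm]
      exact Submodule.mem_orthogonal_singleton_iff_inner_right.1 y.2.1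
    have hpos : 0 ≤ 1 - ‖(y : E)‖ ^ 2 := by nlinarith [norm_nonneg (y : E)]
    refine ⟨y + √(1 - ‖(y : E)‖ ^ 2) • r, ⟨D.add_mem y.2.2 (D.smul_mem _ hrD), ?_⟩, ?_⟩
    · have h : ‖(y : E) + √(1 - ‖(y : E)‖ ^ 2) • r‖ ^ 2 = 1 := by
        rw [norm_add_sq_real, real_inner_smul_right, hyr, norm_smul, hr1,
          Real.norm_of_nonneg (Real.sqrt_nonneg _), mul_one, Real.sq_sqrt hpos]
        ring
      exact (pow_eq_one_iff_of_nonneg (norm_nonneg _) two_ne_zero).1 h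
    · have hrW : W.orthogonalProjectionOnto r = 0 := by
        rw [Submodule.orthogonalProjectionOnto_eq_zero_iff]
        exact fun w hw => by
          rw [real_inner_comm]
          exact Submodule.mem_orthogonal_singleton_iff_inner_right.1 hw.1
      rw [map_add, map_smul, hrW, smul_zero, add_zero]
      exact Submodule.orthogonalProjectionOnto_mem_subspace_eq_self y
  have h1 : dimH (W.orthogonalProjectionOnto '' S) = k := by
    rw [← hWk]
    refine Real.dimH_of_nonempty_interior ⟨0, ?_⟩
    exact mem_interior.2 ⟨_, hball, Metric.isOpen_ball, Metric.mem_ball_self one_pos⟩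
  have h2 : dimH (W.orthogonalProjectionOnto '' S) ≤ dimH S :=
    W.orthogonalProjectionOnto.lipschitz.dimH_image_le S
  rw [h1] at h2
  exact absurd (h2.trans (dimH_mono hSB)) (not_le.2 hB)

/-- A set of matrices of small dimension does not move a pair of basis vectors onto all
orthonormal pairs. -/
theorem exists_orthonormal_pair {N : ℕ} (hN : 1 ≤ N) (i₁ i₂ : Fin (N + 1))
    {B : Set (Fin (N + 1) → Fin (N + 1) → ℝ)} (hB : dimH B < (N - 1 : ℕ)) :
    ∃ p q : Fin (N + 1) → ℝ, ∑ i, p i * p i = 1 ∧ ∑ i, q i * q i = 1 ∧ ∑ i, p i * q i = 0 ∧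
      (∀ A ∈ B, (fun i => A i i₁) ≠ p) ∧
      ∀ A ∈ B, (fun i => A i i₂ - 2 * (∑ j, (A j i₁ - p j) * A j i₂) /
        (∑ j, (A j i₁ - p j) * (A j i₁ - p j)) * (A i i₁ - p i)) ≠ q := by
  let f₁ : (Fin (N + 1) → Fin (N + 1) → ℝ) → EuclideanSpace ℝ (Fin (N + 1)) :=
    fun A => WithLp.toLp 2 fun i => A i i₁
  have hf₁ : ContDiff ℝ 1 f₁ := by
    refine contDiff_euclidean.2 fun i => ?_
    change ContDiff ℝ 1 fun A : Fin (N + 1) → Fin (N + 1) → ℝ => A i i₁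
    fun_prop
  have hd₁ : dimH (f₁ '' B) ≤ dimH B := by
    refine dimH_image_le_of_locally_lipschitzOn fun A _ => ?_
    obtain ⟨C, t, ht, hL⟩ := hf₁.contDiffAt.exists_lipschitzOnWith (x := A)
    exact ⟨C, t, mem_nhdsWithin_of_mem_nhds ht, hL⟩
  obtain ⟨p, -, hp1, hpB⟩ := exists_unit_notMem_of_dimH_lt
    (⊤ : Submodule ℝ (EuclideanSpace ℝ (Fin (N + 1)))) (k := N) (by simp)
    ((hd₁.trans_lt hB).trans_le (by exact_mod_cast Nat.sub_le _ _))
  have hpB' : ∀ A ∈ B, (fun i => A i i₁) ≠ p := fun A hA h =>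
    hpB ⟨A, hA, PiLp.ext fun i => congrFun h i⟩
  let f₂ : (Fin (N + 1) → Fin (N + 1) → ℝ) → EuclideanSpace ℝ (Fin (N + 1)) :=
    fun A => WithLp.toLp 2 fun i => A i i₂ - 2 * (∑ j, (A j i₁ - p j) * A j i₂) /
        (∑ j, (A j i₁ - p j) * (A j i₁ - p j)) * (A i i₁ - p i)
  have hf₂ : ∀ A ∈ B, ContDiffAt ℝ 1 f₂ A := fun A hA => by
    have h0 : ∑ j, (A j i₁ - p j) * (A j i₁ - p j) ≠ 0 := fun h0 => hpB' A hA <| funext fun i => by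
      have h1 := (Finset.sum_eq_zero_iff_of_nonneg fun i _ => mul_self_nonneg _).1 h0
      exact sub_eq_zero.1 (mul_self_eq_zero.1 (h1 i (Finset.mem_univ _)))
    have hc : ∀ i j, ContDiffAt ℝ 1 (fun A : Fin (N + 1) → Fin (N + 1) → ℝ => A i j) A := by
      fun_prop
    refine contDiffAt_euclidean.2 fun i => ?_
    change ContDiffAt ℝ 1 (fun A : Fin (N + 1) → Fin (N + 1) → ℝ =>
      A i i₂ - 2 * (∑ j, (A j i₁ - p j) * A j i₂) /
        (∑ j, (A j i₁ - p j) * (A j i₁ - p j)) * (A i i₁ - p i)) A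
    have h1 : ContDiffAt ℝ 1 (fun A : Fin (N + 1) → Fin (N + 1) → ℝ =>
        2 * ∑ j, (A j i₁ - p j) * A j i₂) A :=
      contDiffAt_const.mul
        (ContDiffAt.sum fun j _ => ((hc _ _).sub contDiffAt_const).mul (hc _ _))
    have h2 : ContDiffAt ℝ 1 (fun A : Fin (N + 1) → Fin (N + 1) → ℝ =>
        ∑ j, (A j i₁ - p j) * (A j i₁ - p j)) A :=
      ContDiffAt.sum fun j _ => ((hc _ _).sub contDiffAt_const).mul ((hc _ _).sub contDiffAt_const)
    exact (hc _ _).sub ((h1.div h2 h0).mul ((hc _ _).sub contDiffAt_const))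
  have hd₂ : dimH (f₂ '' B) ≤ dimH B := by
    refine dimH_image_le_of_locally_lipschitzOn fun A hA => ?_
    obtain ⟨C, t, ht, hL⟩ := (hf₂ A hA).exists_lipschitzOnWith
    exact ⟨C, t, mem_nhdsWithin_of_mem_nhds ht, hL⟩
  have hp0 : p ≠ 0 := fun h => by simp [h] at hp1
  have hrank : Module.finrank ℝ (ℝ ∙ p)ᗮ = N - 1 + 1 := by
    have := Submodule.finrank_add_finrank_orthogonal (ℝ ∙ p)
    rw [finrank_span_singleton hp0, finrank_euclideanSpace, Fintype.card_fin] at this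
    omega
  obtain ⟨q, hqp, hq1, hqB⟩ := exists_unit_notMem_of_dimH_lt _ hrank (hd₂.trans_lt hB)
  have hsq : ∀ v : EuclideanSpace ℝ (Fin (N + 1)), ‖v‖ = 1 → ∑ i, v i * v i = 1 := fun v hv => by
    have := EuclideanSpace.real_norm_sq_eq v
    rw [hv, one_pow] at this
    rw [this]
    exact Finset.sum_congr rfl fun i _ => (sq _).symm
  refine ⟨p, q, hsq p hp1, hsq q hq1, ?_, hpB', fun A hA h =>
    hqB ⟨A, hA, PiLp.ext fun i => congrFun h i⟩⟩
  have h := Submodule.mem_orthogonal_singleton_iff_inner_right.1 hqp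
  rw [PiLp.inner_apply] at h
  rw [← h]
  exact Finset.sum_congr rfl fun i _ => by simp [mul_comm]

open MeasureTheory

section Rotation
variable {m : ℕ}

/-- The rotation by the angle `θ` in a coordinate plane. -/
noncomputable def planeRotation (i j : Fin m) (θ : ℝ) :
    EuclideanSpace ℝ (Fin m) →ₗ[ℝ] EuclideanSpace ℝ (Fin m) where
  toFun x := WithLp.toLp 2 fun k => if k = i then Real.cos θ * x i - Real.sin θ * x j else
    if k = j then Real.sin θ * x i + Real.cos θ * x j else x k
  map_add' x y := by
    ext k
    simp only [PiLp.add_apply]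
    split_ifs <;> ring
  map_smul' r x := by
    ext k
    simp only [PiLp.smul_apply, smul_eq_mul, RingHom.id_apply]
    split_ifs <;> ring

theorem planeRotation_apply (i j : Fin m) (θ : ℝ) (x : EuclideanSpace ℝ (Fin m)) (k : Fin m) :
    planeRotation i j θ x k = if k = i then Real.cos θ * x i - Real.sin θ * x j else
      if k = j then Real.sin θ * x i + Real.cos θ * x j else x k := rfl

theorem norm_planeRotation {i j : Fin m} (hij : i ≠ j) (θ : ℝ) (x : EuclideanSpace ℝ (Fin m)) :
    ‖planeRotation i j θ x‖ = ‖x‖ := by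
  refine (sq_eq_sq₀ (norm_nonneg _) (norm_nonneg _)).1 ?_
  rw [EuclideanSpace.real_norm_sq_eq, EuclideanSpace.real_norm_sq_eq, ← sub_eq_zero,
    ← Finset.sum_sub_distrib]
  have h : ∀ k, planeRotation i j θ x k ^ 2 - x k ^ 2 =
      (if k = i then (Real.cos θ * x i - Real.sin θ * x j) ^ 2 - x i ^ 2 else 0) +
      if k = j then (Real.sin θ * x i + Real.cos θ * x j) ^ 2 - x j ^ 2 else 0 := fun k => by
    rw [planeRotation_apply]
    rcases eq_or_ne k i with rfl | hki
    · simp [hij]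
    · rcases eq_or_ne k j with rfl | hkj <;> simp [*]
  rw [Finset.sum_congr rfl fun k _ => h k, Finset.sum_add_distrib]
  simp only [Finset.sum_ite_eq', Finset.mem_univ, if_true]
  linear_combination (x i ^ 2 + x j ^ 2) * Real.sin_sq_add_cos_sq θ

/-- A plane rotation as a linear isometry. -/
noncomputable def planeRotationEquiv {i j : Fin m} (hij : i ≠ j) (θ : ℝ) :
    EuclideanSpace ℝ (Fin m) ≃ₗᵢ[ℝ] EuclideanSpace ℝ (Fin m) :=
  LinearIsometry.toLinearIsometryEquiv ⟨planeRotation i j θ, norm_planeRotation hij θ⟩ rfl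

theorem hasDerivAt_planeRotation {i j : Fin m} (hij : i ≠ j) (x : EuclideanSpace ℝ (Fin m)) (θ : ℝ)
    (k : Fin m) : HasDerivAt (fun t => planeRotation i j t x k)
      (if k = i then - planeRotation i j θ x j else if k = j then planeRotation i j θ x i else 0)
      θ := by
  have hc := Real.hasDerivAt_cos θ
  have hs := Real.hasDerivAt_sin θ
  simp only [planeRotation_apply, if_true, hij.symm, if_false]
  split_ifs
  · refine ((hc.mul_const (x i)).sub (hs.mul_const (x j))).congr_deriv ?_
    ring
  · refine ((hs.mul_const (x i)).add (hc.mul_const (x j))).congr_deriv ?_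
    ring
  · exact hasDerivAt_const _ _

/-- The derivation of the polynomial ring generating the rotations in a coordinate plane. -/
noncomputable def rotPoly (i j : Fin m) (p : MvPolynomial (Fin m) ℝ) : MvPolynomial (Fin m) ℝ :=
  MvPolynomial.X i * MvPolynomial.pderiv j p - MvPolynomial.X j * MvPolynomial.pderiv i p

theorem rotPoly_mul (i j : Fin m) (p q : MvPolynomial (Fin m) ℝ) :
    rotPoly i j (p * q) = rotPoly i j p * q + p * rotPoly i j q := by
  simp only [rotPoly, Derivation.leibniz, smul_eq_mul]
  ring

theorem hasDerivAt_eval_planeRotation {i j : Fin m} (hij : i ≠ j) (x : EuclideanSpace ℝ (Fin m))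
    (θ : ℝ) (p : MvPolynomial (Fin m) ℝ) :
    HasDerivAt (fun t => MvPolynomial.eval (fun k => planeRotation i j t x k) p)
      (MvPolynomial.eval (fun k => planeRotation i j θ x k) (rotPoly i j p)) θ := by
  refine MvPolynomial.induction_on (motive := fun p =>
    HasDerivAt (fun t => MvPolynomial.eval (fun k => planeRotation i j t x k) p)
      (MvPolynomial.eval (fun k => planeRotation i j θ x k) (rotPoly i j p)) θ) p
    (fun a => ?_) (fun p q hp hq => ?_) fun p k hp => ?_
  · simpa [rotPoly] using hasDerivAt_const θ a
  · simp only [map_add]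
    refine (hp.add hq).congr_deriv ?_
    simp only [rotPoly, map_add, map_sub, map_mul]
    ring
  · simp only [map_mul, MvPolynomial.eval_X]
    refine (hp.mul (hasDerivAt_planeRotation hij x θ k)).congr_deriv ?_
    rw [rotPoly_mul, map_add, map_mul, map_mul, MvPolynomial.eval_X]
    congr 2
    simp only [rotPoly, MvPolynomial.pderiv_X, Pi.single_apply, map_sub, map_mul,
      MvPolynomial.eval_X]
    rcases eq_or_ne k i with rfl | hki
    · simp [hij]
    · rcases eq_or_ne k j with rfl | hkj
      · simp [hki]
      · simp [hki, hkj]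

/-- A linear isometry acting on the unit sphere. -/
noncomputable def sphereHomeo (R : EuclideanSpace ℝ (Fin m) ≃ₗᵢ[ℝ] EuclideanSpace ℝ (Fin m)) :
    Metric.sphere (0 : EuclideanSpace ℝ (Fin m)) 1 ≃ₜ
      Metric.sphere (0 : EuclideanSpace ℝ (Fin m)) 1 :=
  R.toHomeomorph.subtype fun x => by simp

open scoped Pointwise in
theorem measurePreserving_sphereHomeo
    (R : EuclideanSpace ℝ (Fin m) ≃ₗᵢ[ℝ] EuclideanSpace ℝ (Fin m)) :
    MeasurePreserving (sphereHomeo R) (volume : Measure (EuclideanSpace ℝ (Fin m))).toSphere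
      (volume : Measure (EuclideanSpace ℝ (Fin m))).toSphere := by
  refine ⟨(sphereHomeo R).continuous.measurable, Measure.ext fun s hs => ?_⟩
  rw [Measure.map_apply (sphereHomeo R).continuous.measurable hs,
    Measure.toSphere_apply' _ hs,
    Measure.toSphere_apply' _ ((sphereHomeo R).continuous.measurable hs)]
  congr 1
  rw [← R.measurePreserving.measure_preimage_equiv (f := R.toMeasurableEquiv)
    (Set.Ioo (0 : ℝ) 1 • (Subtype.val '' s))]
  congr 1
  ext x
  simp only [Set.mem_smul, Set.mem_image, Set.mem_preimage]
  constructor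
  · rintro ⟨r, hr, _, ⟨y, hy, rfl⟩, rfl⟩
    exact ⟨r, hr, _, ⟨_, hy, rfl⟩, (R.map_smul r y).symm⟩
  · rintro ⟨r, hr, _, ⟨y, hy, rfl⟩, h⟩
    refine ⟨r, hr, _, ⟨(sphereHomeo R).symm y, ?_, rfl⟩, ?_⟩
    · rwa [Homeomorph.apply_symm_apply]
    · refine R.injective ((R.map_smul _ _).trans (Eq.trans ?_ h))
      exact congrArg (fun z : Metric.sphere (0 : EuclideanSpace ℝ (Fin m)) 1 => r • (z : EuclideanSpace ℝ (Fin m))) ((sphereHomeo R).apply_symm_apply y)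

/-- The restriction of a polynomial to the unit sphere. -/
noncomputable def polyFun : MvPolynomial (Fin m) ℝ →ₐ[ℝ]
    C(Metric.sphere (0 : EuclideanSpace ℝ (Fin m)) 1, ℝ) :=
  MvPolynomial.aeval fun i =>
    ⟨fun x => (x : EuclideanSpace ℝ (Fin m)) i, by fun_prop⟩

theorem polyFun_apply (p : MvPolynomial (Fin m) ℝ)
    (x : Metric.sphere (0 : EuclideanSpace ℝ (Fin m)) 1) :
    polyFun p x = MvPolynomial.eval (fun k => (x : EuclideanSpace ℝ (Fin m)) k) p := by
  refine MvPolynomial.induction_on (motive := fun p =>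
    polyFun p x = MvPolynomial.eval (fun k => (x : EuclideanSpace ℝ (Fin m)) k) p) p
    (fun a => ?_) (fun p q hp hq => ?_) fun p k hp => ?_
  · simp [polyFun]
  · rw [map_add, map_add, ContinuousMap.add_apply, hp, hq]
  · rw [map_mul, map_mul, ContinuousMap.mul_apply, hp, MvPolynomial.eval_X]
    simp [polyFun]

theorem integral_rotPoly {i j : Fin m} (hij : i ≠ j) (p : MvPolynomial (Fin m) ℝ) :
    ∫ x, polyFun (rotPoly i j p) x ∂(volume : Measure (EuclideanSpace ℝ (Fin m))).toSphere = 0 := by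
  set μ := (volume : Measure (EuclideanSpace ℝ (Fin m))).toSphere with hμ
  let R : ℝ → _ := fun θ => sphereHomeo (planeRotationEquiv hij θ)
  have hR : ∀ (q : MvPolynomial (Fin m) ℝ) θ x, polyFun q (R θ x) =
      MvPolynomial.eval (fun k => planeRotation i j θ x k) q := fun q θ x => polyFun_apply _ _
  have hintg : ∀ f : C(Metric.sphere (0 : EuclideanSpace ℝ (Fin m)) 1, ℝ), Integrable f μ :=
    fun f => f.continuous.integrable_of_hasCompactSupport (HasCompactSupport.of_compactSpace f)
  have hd := (hasDerivAt_integral_of_dominated_loc_of_deriv_le (μ := μ) (𝕜 := ℝ) (x₀ := 0)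
    (F := fun θ x => polyFun p (R θ x)) (F' := fun θ x => polyFun (rotPoly i j p) (R θ x))
    (bound := fun _ => ‖polyFun (rotPoly i j p)‖) Filter.univ_mem
    (Filter.Eventually.of_forall fun θ =>
      ((polyFun p).continuous.comp (R θ).continuous).aestronglyMeasurable)
    (hintg ((polyFun p).comp (R 0)))
    ((polyFun (rotPoly i j p)).continuous.comp (R 0).continuous).aestronglyMeasurable
    (Filter.Eventually.of_forall fun x θ _ => (polyFun (rotPoly i j p)).norm_coe_le_norm _)
    (integrable_const _)
    (Filter.Eventually.of_forall fun x θ _ => by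
      simp only [hR]
      exact hasDerivAt_eval_planeRotation hij x θ p)).2
  have hinv : ∀ (q : MvPolynomial (Fin m) ℝ) θ, ∫ x, polyFun q (R θ x) ∂μ = ∫ x, polyFun q x ∂μ :=
    fun q θ => (measurePreserving_sphereHomeo (planeRotationEquiv hij θ)).integral_comp
      (Homeomorph.measurableEmbedding _) _
  simp only [hinv] at hd
  exact hd.unique (hasDerivAt_const _ _)

end Rotation

section MultiplicationOperators

variable {α : Type*} [TopologicalSpace α] [CompactSpace α] [MeasurableSpace α] [BorelSpace α]
  (μ : Measure α)

theorem memLp_mul (φ : C(α, ℝ)) (f : Lp ℝ 2 μ) : MemLp (fun x => φ x * f x) 2 μ := by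
  refine MemLp.of_le_mul (g := f) (c := ‖φ‖) (Lp.memLp f)
    (φ.continuous.aestronglyMeasurable.mul (Lp.aestronglyMeasurable f))
    (Filter.Eventually.of_forall fun x => ?_)
  rw [norm_mul]
  exact mul_le_mul_of_nonneg_right (φ.norm_coe_le_norm x) (norm_nonneg _)

/-- The operator of multiplication by a continuous function. -/
noncomputable def mulLp (φ : C(α, ℝ)) : Lp ℝ 2 μ →L[ℝ] Lp ℝ 2 μ :=
  LinearMap.mkContinuous
    { toFun := fun f => (memLp_mul μ φ f).toLp _
      map_add' := fun f g => by
        rw [← MemLp.toLp_add]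
        refine MemLp.toLp_congr _ _ ?_
        filter_upwards [Lp.coeFn_add f g] with x hx
        rw [hx]
        simp [mul_add]
      map_smul' := fun r f => by
        rw [RingHom.id_apply, ← MemLp.toLp_const_smul]
        refine MemLp.toLp_congr _ _ ?_
        filter_upwards [Lp.coeFn_smul r f] with x hx
        rw [hx]
        simp [mul_left_comm] } ‖φ‖ fun f => by
    refine Lp.norm_le_mul_norm_of_ae_le_mul ?_
    filter_upwards [(memLp_mul μ φ f).coeFn_toLp] with x hx
    change ‖(memLp_mul μ φ f).toLp _ x‖ ≤ _
    rw [hx, norm_mul]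
    exact mul_le_mul_of_nonneg_right (φ.norm_coe_le_norm x) (norm_nonneg _)

theorem coeFn_mulLp (φ : C(α, ℝ)) (f : Lp ℝ 2 μ) : mulLp μ φ f =ᵐ[μ] fun x => φ x * f x :=
  (memLp_mul μ φ f).coeFn_toLp

theorem norm_mulLp_apply_le (φ : C(α, ℝ)) (f : Lp ℝ 2 μ) : ‖mulLp μ φ f‖ ≤ ‖φ‖ * ‖f‖ :=
  ContinuousLinearMap.le_of_opNorm_le _ (LinearMap.mkContinuous_norm_le _ (norm_nonneg _) _) f

theorem mulLp_mul (φ χ : C(α, ℝ)) (f : Lp ℝ 2 μ) :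
    mulLp μ (φ * χ) f = mulLp μ φ (mulLp μ χ f) := by
  refine Lp.ext ?_
  filter_upwards [coeFn_mulLp μ (φ * χ) f, coeFn_mulLp μ φ (mulLp μ χ f), coeFn_mulLp μ χ f]
    with x h1 h2 h3
  rw [h1, h2, h3, ContinuousMap.mul_apply, mul_assoc]

theorem mulLp_add (φ χ : C(α, ℝ)) (f : Lp ℝ 2 μ) :
    mulLp μ (φ + χ) f = mulLp μ φ f + mulLp μ χ f := by
  refine Lp.ext ?_
  filter_upwards [coeFn_mulLp μ (φ + χ) f, coeFn_mulLp μ φ f, coeFn_mulLp μ χ f,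
    Lp.coeFn_add (mulLp μ φ f) (mulLp μ χ f)] with x h1 h2 h3 h4
  rw [h1, h4, Pi.add_apply, h2, h3, ContinuousMap.add_apply, add_mul]

theorem mulLp_algebraMap (r : ℝ) (f : Lp ℝ 2 μ) :
    mulLp μ (algebraMap ℝ C(α, ℝ) r) f = r • f := by
  refine Lp.ext ?_
  filter_upwards [coeFn_mulLp μ (algebraMap ℝ C(α, ℝ) r) f, Lp.coeFn_smul r f] with x h1 h2
  rw [h1, h2]
  simp

theorem inner_mulLp (φ : C(α, ℝ)) (f g : Lp ℝ 2 μ) :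
    inner ℝ (mulLp μ φ f) g = inner ℝ f (mulLp μ φ g) := by
  rw [L2.inner_def, L2.inner_def]
  refine integral_congr_ae ?_
  filter_upwards [coeFn_mulLp μ φ f, coeFn_mulLp μ φ g] with x h1 h2
  rw [h1, h2]
  simp only [Real.inner_apply]
  ring

theorem mulLp_toLp [IsFiniteMeasure μ] (φ χ : C(α, ℝ)) :
    mulLp μ φ (ContinuousMap.toLp 2 μ ℝ χ) = ContinuousMap.toLp 2 μ ℝ (φ * χ) := by
  refine Lp.ext ?_
  filter_upwards [coeFn_mulLp μ φ (ContinuousMap.toLp 2 μ ℝ χ),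
    ContinuousMap.coeFn_toLp (p := 2) (𝕜 := ℝ) μ χ,
    ContinuousMap.coeFn_toLp (p := 2) (𝕜 := ℝ) μ (φ * χ)] with x h1 h2 h3
  rw [h1, h2, h3, ContinuousMap.mul_apply]

end MultiplicationOperators

section BladeOperators

variable {N : ℕ} {L : Type*} [NormedAddCommGroup L] [InnerProductSpace ℝ L]

/-- A bounded operator on the direct sum with the Euclidean norm. -/
noncomputable def piOp (T : (Blade N → L) →L[ℝ] (Blade N → L)) :
    PiLp 2 (fun _ : Blade N => L) →L[ℝ] PiLp 2 (fun _ : Blade N => L) :=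
  ((PiLp.continuousLinearEquiv 2 ℝ fun _ : Blade N => L).symm : _ →L[ℝ] _) ∘L T ∘L
    (PiLp.continuousLinearEquiv 2 ℝ fun _ : Blade N => L : _ →L[ℝ] _)

/-- A bounded operator acting on each component. -/
noncomputable def diagOp (T : L →L[ℝ] L) :
    PiLp 2 (fun _ : Blade N => L) →L[ℝ] PiLp 2 (fun _ : Blade N => L) :=
  piOp (ContinuousLinearMap.pi fun S => T ∘L ContinuousLinearMap.proj S)

theorem diagOp_apply (T : L →L[ℝ] L) (u : PiLp 2 (fun _ : Blade N => L)) (S : Blade N) :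
    diagOp T u S = T (u S) := rfl

theorem norm_diagOp_apply_le {T : L →L[ℝ] L} {c : ℝ} (hc : 0 ≤ c) (hT : ∀ f, ‖T f‖ ≤ c * ‖f‖)
    (u : PiLp 2 (fun _ : Blade N => L)) : ‖diagOp T u‖ ≤ c * ‖u‖ := by
  refine (sq_le_sq₀ (norm_nonneg _) (by positivity)).1 ?_
  rw [mul_pow, PiLp.norm_sq_eq_of_L2, PiLp.norm_sq_eq_of_L2, Finset.mul_sum]
  refine Finset.sum_le_sum fun S _ => ?_
  rw [← mul_pow]
  exact pow_le_pow_left₀ (norm_nonneg _) (hT _) 2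

/-- Left multiplication by a blade. -/
noncomputable def leftOp (A : Blade N) :
    PiLp 2 (fun _ : Blade N => L) →L[ℝ] PiLp 2 (fun _ : Blade N => L) :=
  piOp ⟨cliffL A, continuous_pi fun S => (continuous_apply (S + A)).const_smul _⟩

/-- Right multiplication by a blade. -/
noncomputable def rightOp (A : Blade N) :
    PiLp 2 (fun _ : Blade N => L) →L[ℝ] PiLp 2 (fun _ : Blade N => L) :=
  piOp ⟨cliffR A, continuous_pi fun S => (continuous_apply (S + A)).const_smul _⟩

theorem leftOp_apply (A : Blade N) (u : PiLp 2 (fun _ : Blade N => L)) (S : Blade N) :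
    leftOp A u S = sgn (bladeForm A (S + A)) • u (S + A) := rfl

theorem rightOp_apply (A : Blade N) (u : PiLp 2 (fun _ : Blade N => L)) (S : Blade N) :
    rightOp A u S = sgn (bladeForm (S + A) A) • u (S + A) := rfl

theorem leftOp_symm {A : Blade N} (hA : bladeForm A A = 0)
    (u v : PiLp 2 (fun _ : Blade N => L)) :
    inner ℝ (leftOp A u) v = inner ℝ u (leftOp A v) := by
  rw [PiLp.inner_apply, PiLp.inner_apply, ← Fintype.sum_equiv (Equiv.addRight A) _ _ fun _ => rfl]
  refine Finset.sum_congr rfl fun S _ => ?_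
  rw [leftOp_apply, leftOp_apply, Equiv.coe_addRight, blade_add_add_cancel, bladeForm_add_right, hA,
    add_zero, real_inner_smul_left, real_inner_smul_right]

theorem rightOp_symm {A : Blade N} (hA : bladeForm A A = 0)
    (u v : PiLp 2 (fun _ : Blade N => L)) :
    inner ℝ (rightOp A u) v = inner ℝ u (rightOp A v) := by
  rw [PiLp.inner_apply, PiLp.inner_apply, ← Fintype.sum_equiv (Equiv.addRight A) _ _ fun _ => rfl]
  refine Finset.sum_congr rfl fun S _ => ?_
  rw [rightOp_apply, rightOp_apply, Equiv.coe_addRight, blade_add_add_cancel, bladeForm_add_left,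
    hA, add_zero, real_inner_smul_left, real_inner_smul_right]

end BladeOperators

section Concrete

variable (N : ℕ)

/-- The rotation invariant measure on the sphere. -/
noncomputable abbrev sphereMeasure : Measure (USphere N) :=
  (volume : Measure (EuclideanSpace ℝ (Fin (N + 1)))).toSphere

/-- Square integrable Clifford algebra valued functions on the sphere. -/
abbrev SpinorL2 : Type := PiLp 2 fun _ : Blade N => Lp ℝ 2 (sphereMeasure N)

/-- Multiplication of spinors by continuous functions. -/
noncomputable def spinorMul : C(USphere N, ℝ) →ₐ[ℝ] (SpinorL2 N →L[ℝ] SpinorL2 N) where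
  toFun φ := diagOp (mulLp _ φ)
  map_one' := ContinuousLinearMap.ext fun u => PiLp.ext fun S => by
    rw [diagOp_apply, ← map_one (algebraMap ℝ C(USphere N, ℝ)), mulLp_algebraMap, one_smul,
      one_apply_eq_self]
  map_mul' φ χ := ContinuousLinearMap.ext fun u => PiLp.ext fun S => mulLp_mul _ φ χ _
  map_zero' := ContinuousLinearMap.ext fun u => PiLp.ext fun S => by
    rw [diagOp_apply, ← map_zero (algebraMap ℝ C(USphere N, ℝ)), mulLp_algebraMap, zero_smul]
    rfl
  map_add' φ χ := ContinuousLinearMap.ext fun u => PiLp.ext fun S => mulLp_add _ φ χ _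
  commutes' r := ContinuousLinearMap.ext fun u => PiLp.ext fun S => mulLp_algebraMap _ r _

variable {N}

theorem spinorMul_apply (φ : C(USphere N, ℝ)) (u : SpinorL2 N) (S : Blade N) :
    spinorMul N φ u S = mulLp _ φ (u S) := rfl

theorem continuous_spinorMul : Continuous (spinorMul N) :=
  AddMonoidHomClass.continuous_of_bound (spinorMul N) 1 fun φ => by
    rw [one_mul]
    exact ContinuousLinearMap.opNorm_le_bound _ (norm_nonneg _)
      (norm_diagOp_apply_le (norm_nonneg _) (norm_mulLp_apply_le _ φ))

variable (N)

/-- The linear map sending a polynomial to its restriction to the sphere. -/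
noncomputable def polyLp : MvPolynomial (Fin (N + 1)) ℝ →ₗ[ℝ] Lp ℝ 2 (sphereMeasure N) :=
  (ContinuousMap.toLp (E := ℝ) 2 (sphereMeasure N) ℝ).toLinearMap ∘ₗ polyFun.toLinearMap

/-- The linear map sending a polynomial spinor to its restriction to the sphere. -/
noncomputable def spinorRestrict : PolySpinor N →ₗ[ℝ] SpinorL2 N :=
  ((PiLp.continuousLinearEquiv 2 ℝ fun _ : Blade N => Lp ℝ 2 (sphereMeasure N)).symm : _ →ₗ[ℝ] _) ∘ₗ
    (polyLp N).compLeft (Blade N)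

variable {N}

theorem polyLp_apply (p : MvPolynomial (Fin (N + 1)) ℝ) :
    polyLp N p = ContinuousMap.toLp 2 (sphereMeasure N) ℝ (polyFun p) := rfl

theorem spinorRestrict_apply (f : PolySpinor N) (S : Blade N) :
    spinorRestrict N f S = polyLp N (f S) := rfl

theorem denseRange_polyFun : DenseRange (polyFun (m := N + 1)) := by
  let B : Subalgebra ℝ C(USphere N, ℝ) := polyFun.range
  have : B.topologicalClosure = ⊤ := by
    refine ContinuousMap.subalgebra_topologicalClosure_eq_top_of_separatesPoints B ?_
    intro x y hxy
    by_contra! hcon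
    refine hxy (Subtype.ext (PiLp.ext fun i => ?_))
    have := hcon _ ⟨polyFun (MvPolynomial.X i), ⟨_, rfl⟩, rfl⟩
    simpa [polyFun_apply] using this
  intro φ
  have h : φ ∈ B.topologicalClosure := this ▸ trivial
  exact h

theorem denseRange_polyLp : DenseRange (polyLp N) :=
  (ContinuousMap.toLp_denseRange ℝ (sphereMeasure N) ℝ (by norm_num)).comp denseRange_polyFun
    (ContinuousMap.toLp 2 (sphereMeasure N) ℝ).continuous

theorem denseRange_spinorRestrict : DenseRange (spinorRestrict N) :=
  (PiLp.continuousLinearEquiv 2 ℝ fun _ : Blade N => Lp ℝ 2 (sphereMeasure N)).symm.surjective.denseRange.comp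
    (DenseRange.piMap fun _ => denseRange_polyLp) (ContinuousLinearEquiv.continuous _)

theorem inner_polyLp (p q : MvPolynomial (Fin (N + 1)) ℝ) :
    inner ℝ (polyLp N p) (polyLp N q) = ∫ x, polyFun (p * q) x ∂(sphereMeasure N) := by
  rw [polyLp_apply, polyLp_apply, ContinuousMap.inner_toLp]
  simp only [map_mul, ContinuousMap.mul_apply, conj_trivial, mul_comm]

theorem inner_polyLp_rotPoly {i j : Fin (N + 1)} (hij : i ≠ j)
    (p q : MvPolynomial (Fin (N + 1)) ℝ) :
    inner ℝ (polyLp N (rotPoly i j p)) (polyLp N q) =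
      - inner ℝ (polyLp N p) (polyLp N (rotPoly i j q)) := by
  have hintg : ∀ f : C(USphere N, ℝ), Integrable f (sphereMeasure N) :=
    fun f => f.continuous.integrable_of_hasCompactSupport (HasCompactSupport.of_compactSpace f)
  rw [eq_neg_iff_add_eq_zero, inner_polyLp, inner_polyLp, ← integral_add (hintg _) (hintg _),
    ← integral_rotPoly hij (p * q), rotPoly_mul, map_add]
  rfl

theorem rotP_apply (i j : Fin (N + 1)) (f : PolySpinor N) (S : Blade N) :
    rotP i j f S = rotPoly i j (f S) := rfl

theorem inner_spinorRestrict_rotP (i j : Fin (N + 1)) (f g : PolySpinor N) :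
    inner ℝ (spinorRestrict N (rotP i j f)) (spinorRestrict N g) =
      - inner ℝ (spinorRestrict N f) (spinorRestrict N (rotP i j g)) := by
  rcases eq_or_ne i j with rfl | hij
  · simp [rotP]
  · simp only [PiLp.inner_apply, spinorRestrict_apply, rotP_apply, inner_polyLp_rotPoly hij,
      Finset.sum_neg_distrib]

/-- The model of square integrable Clifford algebra valued functions on the sphere. -/
noncomputable def spinorModelL2 (hN : 4 ∣ N) : SpinorModel N (SpinorL2 N) where
  mul := spinorMul N
  E i := leftOp (genBlade i)
  G i := rightOp (genBlade i)
  ψ := spinorRestrict N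
  continuous_mul := continuous_spinorMul
  mul_symm φ u v := by
    simp only [PiLp.inner_apply, spinorMul_apply, inner_mulLp]
  E_symm i := leftOp_symm (bladeForm_genBlade_self hN i)
  G_symm i := rightOp_symm (bladeForm_genBlade_self hN i)
  E_sq i := ContinuousLinearMap.ext fun u => PiLp.ext fun S => congrFun (genL_sq hN i _) S
  G_sq i := ContinuousLinearMap.ext fun u => PiLp.ext fun S => congrFun (genR_sq hN i _) S
  E_anticomm i j h := ContinuousLinearMap.ext fun u => PiLp.ext fun S =>
    congrFun (genL_anticomm hN h _) S
  G_anticomm i j h := ContinuousLinearMap.ext fun u => PiLp.ext fun S =>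
    congrFun (genR_anticomm hN h _) S
  commute_E_G i j := ContinuousLinearMap.ext fun u => PiLp.ext fun S =>
    congrFun (cliffL_cliffR _ _ _) S
  commute_mul_E φ i := ContinuousLinearMap.ext fun u => PiLp.ext fun S => by
    simp only [mul_apply_eq_comp, spinorMul_apply, leftOp_apply, map_smul]
  commute_mul_G φ i := ContinuousLinearMap.ext fun u => PiLp.ext fun S => by
    simp only [mul_apply_eq_comp, spinorMul_apply, rightOp_apply, map_smul]
  ψ_xP i f := PiLp.ext fun S => by
    rw [spinorMul_apply, spinorRestrict_apply, spinorRestrict_apply, xP_apply, polyLp_apply,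
      polyLp_apply, mulLp_toLp, map_mul]
    congr 2
    ext x
    simp [polyFun_apply, coordFun]
  ψ_eL i f := PiLp.ext fun S => by
    rw [spinorRestrict_apply, leftOp_apply, eL_apply, map_smul, spinorRestrict_apply]
  ψ_eR i f := PiLp.ext fun S => by
    rw [spinorRestrict_apply, rightOp_apply, eR_apply, map_smul, spinorRestrict_apply]
  dense_ψ := denseRange_spinorRestrict
  inner_rotP := inner_spinorRestrict_rotP
  vol := (sphereMeasure N).real Set.univ
  vol_pos := by
    rw [measureReal_def]
    exact ENNReal.toReal_pos (by
      rw [Ne, Measure.measure_univ_eq_zero]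
      exact Measure.toSphere_ne_zero _) (measure_ne_top _ _)
  inner_const a b := by
    simp only [PiLp.inner_apply, spinorRestrict_apply, inner_polyLp, ← MvPolynomial.C_mul,
      polyFun_apply, MvPolynomial.eval_C, integral_const, smul_eq_mul, Finset.mul_sum]

end Concrete

theorem exists_spinorModel {N : ℕ} (hN : 4 ∣ N) :
    ∃ (H : Type) (_ : NormedAddCommGroup H) (_ : InnerProductSpace ℝ H) (_ : CompleteSpace H),
      Nonempty (SpinorModel N H) :=
  ⟨SpinorL2 N, inferInstance, inferInstance, inferInstance, ⟨spinorModelL2 hN⟩⟩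

theorem gram_pos_of_isUnit {m : ℕ} {M : Matrix (Fin m) (Fin m) ℝ} (hM : IsUnit M) {i₁ i₂ : Fin m}
    (h12 : i₁ ≠ i₂) : 0 < (∑ i, M i i₁ * M i i₁) * (∑ i, M i i₂ * M i i₂) -
      (∑ i, M i i₁ * M i i₂) * ∑ i, M i i₁ * M i i₂ := by
  have hinj := Matrix.mulVec_injective_iff_isUnit.2 hM
  have hpos : ∀ v : Fin m → ℝ, v ≠ 0 → 0 < ∑ i, M.mulVec v i * M.mulVec v i := fun v hv => by
    refine (Finset.sum_nonneg fun i _ => mul_self_nonneg _).lt_of_ne' fun h0 => hv ?_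
    have h1 := (Finset.sum_eq_zero_iff_of_nonneg fun i _ => mul_self_nonneg _).1 h0
    refine hinj (funext fun i => ?_)
    rw [Matrix.mulVec_zero]
    exact mul_self_eq_zero.1 (h1 i (Finset.mem_univ _))
  set s := ∑ i, M i i₁ * M i i₂ with hs
  set β := ∑ i, M i i₂ * M i i₂ with hβ
  have hβ0 : 0 < β := by
    have := hpos (Pi.single i₂ 1) (by simp)
    simpa using this
  have h := hpos (β • Pi.single i₁ 1 - s • Pi.single i₂ 1) fun h => by
    have := congrFun h i₁
    simp [h12, hβ0.ne'] at this
  have h2 : ∑ i, M.mulVec (β • Pi.single i₁ 1 - s • Pi.single i₂ 1) i *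
      M.mulVec (β • Pi.single i₁ 1 - s • Pi.single i₂ 1) i =
      β * ((∑ i, M i i₁ * M i i₁) * β - s * s) := by
    have h3 : ∀ i, M.mulVec (β • Pi.single i₁ 1 - s • Pi.single i₂ 1) i =
        β * M i i₁ - s * M i i₂ := fun i => by
      simp [Matrix.mulVec_sub, Matrix.mulVec_smul]
    simp_rw [h3]
    calc ∑ i, (β * M i i₁ - s * M i i₂) * (β * M i i₁ - s * M i i₂) =
        ∑ i, (β * β * (M i i₁ * M i i₁) - 2 * β * s * (M i i₁ * M i i₂) +
          s * s * (M i i₂ * M i i₂)) := Finset.sum_congr rfl fun i _ => by ring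
      _ = β * β * (∑ i, M i i₁ * M i i₁) - 2 * β * s * s + s * s * β := by
        rw [Finset.sum_add_distrib, Finset.sum_sub_distrib, ← Finset.mul_sum, ← Finset.mul_sum,
          ← Finset.mul_sum]
      _ = _ := by ring
  rw [h2] at h
  exact pos_of_mul_pos_right h hβ0.le

theorem sum_mul_of_mem_SOSet {m : ℕ} {A : Matrix (Fin m) (Fin m) ℝ} (hA : A ∈ SOSet m)
    (i j : Fin m) : ∑ k, A k i * A k j = if i = j then 1 else 0 := by
  have h : A.transpose * A = 1 := mul_eq_one_comm.1 hA.1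
  have h2 := congrFun (congrFun h i) j
  rwa [Matrix.one_apply, Matrix.mul_apply] at h2

theorem charMatrix_apply {m : ℕ} (x : EuclideanSpace ℝ (Fin m)) (i : Fin m) {j : Fin m}
    (hj : j.val ≠ 0) : charMatrix m x i j = (if i = j then 1 else 0) - 2 * x i * x j := by
  rw [charMatrix, Matrix.mul_diagonal, if_neg hj, mul_one, Matrix.sub_apply, Matrix.one_apply,
    Matrix.smul_apply, Matrix.vecMulVec_apply, smul_eq_mul, mul_assoc]

end SphereReduction

/-- For n ≡ 1 (mod 4), n ≥ 5: if the structure group of Sⁿ reduces to a closed connected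
subgroup G ⊆ SO(n), then dim G ≥ n − 2 (dimension taken as Hausdorff dimension of G as a
subset of the matrix space; for a Lie subgroup this is the usual dimension). -/
theorem reduced_group_dimension_lower_bound
    {n : ℕ} (hn : 5 ≤ n) (hmod : n % 4 = 1)
    (G : Set (Matrix (Fin n) (Fin n) ℝ))
    (hGcl : IsClosed G) (hGconn : IsConnected G)
    (h1 : (1 : Matrix (Fin n) (Fin n) ℝ) ∈ G)
    (hmul : ∀ A ∈ G, ∀ B ∈ G, A * B ∈ G)
    (hinv : ∀ A ∈ G, A⁻¹ ∈ G)
    (hGSO : G ⊆ SOSet n)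
    (hred : SphereStructureGroupReducesTo n G) :
    ((n - 2 : ℕ) : ENNReal) ≤
      dimH ((fun A : Matrix (Fin n) (Fin n) ℝ =>
        (Matrix.of.symm A : Fin n → Fin n → ℝ)) '' G) := by
  by_contra hlt
  rw [not_le] at hlt
  obtain ⟨N, rfl⟩ : ∃ N, n = N + 1 := ⟨n - 1, by omega⟩
  have hN : 4 ∣ N := by omega
  obtain ⟨χ, g, hχ, hg, ⟨K⟩⟩ := hred
  let i₁ : Fin (N + 1) := ⟨1, by omega⟩
  let i₂ : Fin (N + 1) := ⟨2, by omega⟩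
  have h12 : i₁ ≠ i₂ := by simp [i₁, i₂]
  obtain ⟨p, q, hp, hq, hpq, hpB, hqB⟩ :=
    SphereReduction.exists_orthonormal_pair (by omega) i₁ i₂ hlt
  obtain ⟨H, _, _, _, ⟨𝓜⟩⟩ := SphereReduction.exists_spinorModel hN
  have hK0 : ∀ x, K (0, x) = charMatrix (N + 1) x := fun x => (K.apply_zero x).trans (hχ x)
  have hK1 : ∀ x, K (1, x) ∈ G := fun x => (K.apply_one x).symm ▸ hg x
  have hcol : ∀ i j, Continuous fun z => K z i j := fun i j =>
    (continuous_apply_apply i j).comp K.continuous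
  refine 𝓜.false_of_homotopy hN (by omega) h12 (fun i => ⟨fun z => K z i i₁, hcol i i₁⟩)
    (fun i => ⟨fun z => K z i i₂, hcol i i₂⟩)
    (fun z => SphereReduction.gram_pos_of_isUnit (K.prop z.1 z.2) h12) ?_ ?_ ?_ ?_ ?_ hp hq hpq ?_ ?_
  · intro i x
    exact (congrFun (congrFun (hK0 x) i) i₁).trans
      (SphereReduction.charMatrix_apply _ _ (by simp [i₁]))
  · intro i x
    exact (congrFun (congrFun (hK0 x) i) i₂).trans
      (SphereReduction.charMatrix_apply _ _ (by simp [i₂]))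
  · intro x
    exact (SphereReduction.sum_mul_of_mem_SOSet (hGSO (hK1 x)) i₁ i₁).trans (if_pos rfl)
  · intro x
    exact (SphereReduction.sum_mul_of_mem_SOSet (hGSO (hK1 x)) i₂ i₂).trans (if_pos rfl)
  · intro x
    exact (SphereReduction.sum_mul_of_mem_SOSet (hGSO (hK1 x)) i₁ i₂).trans (if_neg h12)
  · exact fun x => hpB _ ⟨_, hK1 x, rfl⟩
  · exact fun x => hqB _ ⟨_, hK1 x, rfl⟩
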